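/- There exists a constant C > 0, depending only on Ω, such that for every λ > 0 and every Dirichlet eigenfunction φ of Ω with eigenvalue λ², the set of connected components K of the nodal set N = {x ∈ Ω : φ(x) = 0} whose closure intersects ∂Ω (i.e. the set {K : ∃ x ∈ N, K = connectedComponentIn N x and closure K ∩ ∂Ω ≠ ∅}) is finite and has cardinality at most C·λ. -/

import Mathlib

open MeasureTheory Real
open scoped RealInnerProductSpace

noncomputable section

abbrev E2 : Type := EuclideanSpace ℝ (Fin 2)

/-- The Euclidean Laplacian `∂²/∂x₁² + ∂²/∂x₂²` on `ℝ²`. -/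
def lap (φ : E2 → ℝ) (x : E2) : ℝ :=
  ∑ i : Fin 2,
    fderiv ℝ (fun y => fderiv ℝ φ y (EuclideanSpace.single i 1)) x (EuclideanSpace.single i 1)

/-- A bounded open connected planar domain. -/
structure IsPlaneDomain (Ω : Set E2) : Prop where
  isOpen : IsOpen Ω
  isBounded : Bornology.IsBounded Ω
  isConnected : IsConnected Ω

/-- An arc-length parametrization `q` of the boundary of `Ω` (periodic with period `len`,
injective on `[0, len)`, unit speed, image equal to the frontier of `Ω`), together with the
unit normal `ν` along the boundary, pointing into `Ω`. -/
structure BoundaryParam (Ω : Set E2) where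
  len : ℝ
  len_pos : 0 < len
  q : ℝ → E2
  qd : ℝ → E2
  hasDerivAt : ∀ s, HasDerivAt q (qd s) s
  periodic : Function.Periodic q len
  injOn : Set.InjOn q (Set.Ico 0 len)
  unitSpeed : ∀ s, ‖qd s‖ = 1
  range_eq : Set.range q = frontier Ω
  ν : ℝ → E2
  ν_unit : ∀ s, ‖ν s‖ = 1
  ν_orth : ∀ s, ⟪ν s, qd s⟫ = 0
  ν_inward : ∀ s, ∃ δ > 0, ∀ t ∈ Set.Ioo (0 : ℝ) δ, q s + t • ν s ∈ Ω

/-- The boundary parametrization is real-analytic. -/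
def BoundaryParam.IsAnalytic {Ω : Set E2} (B : BoundaryParam Ω) : Prop :=
  AnalyticOnNhd ℝ B.q Set.univ

/-- `φ` is a Dirichlet eigenfunction of `Ω` with eigenvalue `lam²`: it is real-analytic on an
open neighborhood of the closure of `Ω`, not identically zero on `Ω`, satisfies
`Δφ = -lam² φ` on `Ω` and vanishes along the boundary. -/
structure IsDirichletEigenfunction {Ω : Set E2} (B : BoundaryParam Ω) (lam : ℝ)
    (φ : E2 → ℝ) : Prop where
  analytic : ∃ U : Set E2, IsOpen U ∧ closure Ω ⊆ U ∧ AnalyticOnNhd ℝ φ U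
  nontrivial : ∃ x ∈ Ω, φ x ≠ 0
  eigen : ∀ x ∈ Ω, lap φ x = -lam ^ 2 * φ x
  dirichlet : ∀ s : ℝ, φ (B.q s) = 0

theorem iteratedDeriv_comp_ofReal {G : ℂ → ℂ} {O : Set ℂ} (hO : IsOpen O)
    (hG : DifferentiableOn ℂ G O) (n : ℕ) :
    ∀ x : ℝ, (x : ℂ) ∈ O → iteratedDeriv n (fun t : ℝ => G t) x = iteratedDeriv n G x := by
  induction n with
  | zero => intro x _; simp
  | succ n ih =>
    intro x hx
    rw [iteratedDeriv_succ, iteratedDeriv_succ]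
    have h1 : iteratedDeriv n (fun t : ℝ => G t) =ᶠ[nhds x]
        fun t : ℝ => iteratedDeriv n G t := by
      filter_upwards [(hO.preimage Complex.continuous_ofReal).mem_nhds hx] with t ht
      exact ih t ht
    rw [h1.deriv_eq]
    have h2 : DifferentiableAt ℂ (iteratedDeriv n G) x := by
      have := (hG.analyticOnNhd hO) x hx
      exact (this.iterated_deriv n |>.congr (by simp [iteratedDeriv_eq_iterate])).differentiableAt
    exact h2.hasDerivAt.comp_ofReal.deriv

theorem AnalyticAt.exists_local_complexification {g : ℝ → ℂ} {x : ℝ} (hg : AnalyticAt ℝ g x) :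
    ∃ G : ℂ → ℂ, AnalyticAt ℂ G x ∧ ∀ᶠ t in nhds x, g t = G (t : ℝ) := by
  obtain ⟨p, r, hp⟩ := hg
  set P : FormalMultilinearSeries ℂ ℂ ℂ := FormalMultilinearSeries.ofScalars ℂ (fun n => p.coeff n)
    with hP
  have hrad : 0 < P.radius := by
    have h1 : p.radius ≤ P.radius := by
      refine ENNReal.le_of_forall_nnreal_lt fun s hs => ?_
      obtain ⟨C, _, hC⟩ := p.norm_mul_pow_le_of_lt_radius hs
      refine P.le_radius_of_bound C fun n => ?_
      have : ‖P n‖ = ‖p n‖ := by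
        rw [hP, FormalMultilinearSeries.ofScalars_norm, p.norm_apply_eq_norm_coef]
      rw [this]; exact hC n
    exact lt_of_lt_of_le (lt_of_lt_of_le hp.r_pos hp.r_le) h1
  have hPs := P.hasFPowerSeriesOnBall hrad
  refine ⟨fun z => P.sum (z - x), ?_, ?_⟩
  · have h0 : AnalyticAt ℂ P.sum ((x : ℂ) - x) := by simpa using hPs.analyticAt
    exact h0.comp (f := fun z : ℂ => z - x) (by fun_prop)
  · have e1 : ∀ᶠ t in nhds x, t - x ∈ Metric.eball (0 : ℝ) r := by
      have : Filter.Tendsto (fun t : ℝ => t - x) (nhds x) (nhds 0) := by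
        have : ContinuousAt (fun t : ℝ => t - x) x := by fun_prop
        simpa [ContinuousAt] using this
      exact this.eventually (Metric.isOpen_eball.mem_nhds (by simpa using hp.r_pos))
    have e2 : ∀ᶠ t : ℝ in nhds x, ((t : ℂ) - x) ∈ Metric.eball (0 : ℂ) P.radius := by
      have : Filter.Tendsto (fun t : ℝ => (t : ℂ) - x) (nhds x) (nhds 0) := by
        have : ContinuousAt (fun t : ℝ => (t : ℂ) - x) x := by fun_prop
        simpa [ContinuousAt] using this
      exact this.eventually (Metric.isOpen_eball.mem_nhds (by simpa using hrad))
    filter_upwards [e1, e2] with t h1 h2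
    have a1 := hp.hasSum h1
    have a2 := hPs.hasSum h2
    simp only [zero_add, add_sub_cancel] at a1 a2
    refine a1.unique ?_
    convert! a2 using 1
    funext n
    rw [p.apply_eq_pow_smul_coeff, hP, FormalMultilinearSeries.ofScalars_apply_eq]
    simp [mul_comm]

theorem norm_iteratedDeriv_le_of_analyticAt {g : ℝ → ℂ} {x : ℝ} (hg : AnalyticAt ℝ g x) :
    ∃ M > 0, ∃ r > 0, ∀ᶠ y in nhds x, ∀ n, ‖iteratedDeriv n g y‖ ≤ M * n.factorial / r ^ n := by
  obtain ⟨G, hG, hgG⟩ := hg.exists_local_complexification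
  obtain ⟨s, hs, hsG⟩ := Metric.eventually_nhds_iff.1 (hG.eventually_analyticAt)
  obtain ⟨R, hR, hRs⟩ : ∃ R > 0, R < s := ⟨s / 2, by positivity, by linarith⟩
  have hd : DifferentiableOn ℂ G (Metric.ball x s) := fun z hz =>
    (hsG hz).differentiableAt.differentiableWithinAt
  obtain ⟨M, hM⟩ := (isCompact_closedBall (x : ℂ) R).exists_bound_of_continuousOn
    (hd.continuousOn.mono (Metric.closedBall_subset_ball hRs))
  refine ⟨max M 1, by positivity, R / 2, by positivity, ?_⟩
  have e1 : ∀ᶠ y : ℝ in nhds x, dist y x < R / 2 := Metric.ball_mem_nhds _ (by positivity)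
  filter_upwards [e1, hgG.eventually_nhds] with y hy hyG n
  have hyx : dist (y : ℂ) x < R / 2 := by
    rw [Complex.dist_of_im_eq (by simp)]; simpa using hy
  have hsub : Metric.closedBall (y : ℂ) (R / 2) ⊆ Metric.closedBall (x : ℂ) R := by
    refine Metric.closedBall_subset_closedBall' (by linarith)
  have e : iteratedDeriv n g y = iteratedDeriv n G y := by
    rw [← iteratedDeriv_comp_ofReal Metric.isOpen_ball hd n y (by
      simp only [Metric.mem_ball]; linarith)]
    exact Filter.EventuallyEq.iteratedDeriv_eq n hyG
  rw [e]
  have := Complex.norm_iteratedDeriv_le_of_forall_mem_sphere_norm_le (c := (y : ℂ)) (R := R / 2)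
    (C := max M 1) (f := G) n (by positivity) ?_ ?_
  · convert! this using 1; ring
  · exact ((hd.mono ((hsub.trans (Metric.closedBall_subset_ball hRs)))).diffContOnCl_ball
      (U := Metric.closedBall (y : ℂ) (R / 2)) subset_rfl)
  · intro z hz
    exact (hM z (hsub (Metric.sphere_subset_closedBall hz))).trans (le_max_left _ _)

/-- A periodic real-analytic function satisfies uniform Cauchy estimates. -/
theorem exists_norm_iteratedDeriv_le_of_periodic {g : ℝ → ℂ} (hg : AnalyticOnNhd ℝ g Set.univ)
    {l : ℝ} (hl : 0 < l) (hper : Function.Periodic g l) :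
    ∃ M > 0, ∃ r > 0, ∀ n y, ‖iteratedDeriv n g y‖ ≤ M * n.factorial / r ^ n := by
  have key : ∃ M > 0, ∃ r > 0, ∀ y ∈ Set.Icc 0 l, ∀ n,
      ‖iteratedDeriv n g y‖ ≤ M * n.factorial / r ^ n := by
    refine isCompact_Icc.induction_on (p := fun s => ∃ M > 0, ∃ r > 0, ∀ y ∈ s, ∀ n,
      ‖iteratedDeriv n g y‖ ≤ M * n.factorial / r ^ n) ?_ ?_ ?_ ?_
    · exact ⟨1, one_pos, 1, one_pos, by simp⟩
    · rintro s t hst ⟨M, hM, r, hr, h⟩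
      exact ⟨M, hM, r, hr, fun y hy => h y (hst hy)⟩
    · rintro s t ⟨M, hM, r, hr, h⟩ ⟨M', hM', r', hr', h'⟩
      refine ⟨max M M', by positivity, min r r', by positivity, fun y hy n => ?_⟩
      rcases hy with hy | hy
      · refine (h y hy n).trans ?_
        gcongr
        · exact le_max_left _ _
        · exact min_le_left _ _
      · refine (h' y hy n).trans ?_
        gcongr
        · exact le_max_right _ _
        · exact min_le_right _ _
    · intro x _
      obtain ⟨M, hM, r, hr, h⟩ := norm_iteratedDeriv_le_of_analyticAt (hg x trivial)
      exact ⟨_, mem_nhdsWithin_of_mem_nhds h, M, hM, r, hr, fun y hy => hy⟩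
  obtain ⟨M, hM, r, hr, h⟩ := key
  refine ⟨M, hM, r, hr, fun n y => ?_⟩
  obtain ⟨z, hz, e⟩ : ∃ z ∈ Set.Ico 0 l, iteratedDeriv n g y = iteratedDeriv n g z := by
    have hp : Function.Periodic (iteratedDeriv n g) l := fun x => by
      have : (fun t => g (t + l)) = g := funext hper
      calc iteratedDeriv n g (x + l) = iteratedDeriv n (fun t => g (t + l)) x := by
            rw [iteratedDeriv_comp_add_const]
        _ = _ := by rw [this]
    obtain ⟨z, hz, e⟩ := hp.exists_mem_Ico₀ hl y
    exact ⟨z, hz, e⟩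
  rw [e]
  exact h z ⟨hz.1, hz.2.le⟩ n

/-- The complex Taylor series of `g : ℝ → ℂ` at the real point `x`. -/
def complexTaylor (g : ℝ → ℂ) (x : ℝ) (z : ℂ) : ℂ :=
  (FormalMultilinearSeries.ofScalars ℂ
    (fun n => iteratedDeriv n g x / (n.factorial : ℂ))).sum (z - x)

section complexTaylor

theorem complexTaylor_eq_tsum (g : ℝ → ℂ) (x : ℝ) (z : ℂ) : complexTaylor g x z =
    ∑' n : ℕ, (iteratedDeriv n g x / (n.factorial : ℂ)) * (z - x) ^ n := by
  rw [complexTaylor, FormalMultilinearSeries.sum]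
  refine tsum_congr fun n => ?_
  rw [FormalMultilinearSeries.ofScalars_apply_eq, smul_eq_mul]

variable {g : ℝ → ℂ} {M r : ℝ}

theorem complexTaylor_radius (hr : 0 < r)
    (hb : ∀ n y, ‖iteratedDeriv n g y‖ ≤ M * n.factorial / r ^ n) (x : ℝ) :
    ENNReal.ofReal r ≤ (FormalMultilinearSeries.ofScalars ℂ
      (fun n => iteratedDeriv n g x / (n.factorial : ℂ))).radius := by
  refine FormalMultilinearSeries.le_radius_of_bound _ M fun n => ?_
  rw [FormalMultilinearSeries.ofScalars_norm, norm_div, Real.coe_toNNReal _ hr.le]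
  have := hb n x
  have h2 : (0 : ℝ) < n.factorial := by positivity
  simp only [Complex.norm_natCast]
  rw [div_mul_eq_mul_div, div_le_iff₀ h2]
  rwa [le_div_iff₀ (by positivity)] at this

theorem complexTaylor_analyticOnNhd (hr : 0 < r)
    (hb : ∀ n y, ‖iteratedDeriv n g y‖ ≤ M * n.factorial / r ^ n) (x : ℝ) :
    AnalyticOnNhd ℂ (complexTaylor g x) (Metric.ball x r) := by
  have hrad := complexTaylor_radius hr hb x
  have hP := FormalMultilinearSeries.hasFPowerSeriesOnBall _
    (lt_of_lt_of_le (ENNReal.ofReal_pos.2 hr) hrad)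
  intro z hz
  have h0 := hP.analyticAt_of_mem (y := z - x) (by
    refine Metric.mem_eball.2 (lt_of_lt_of_le ?_ hrad)
    rw [edist_zero_right, ← ofReal_norm, ENNReal.ofReal_lt_ofReal_iff hr]
    simpa [dist_eq_norm] using hz)
  exact h0.comp (f := fun z : ℂ => z - x) (by fun_prop)

theorem norm_complexTaylor_le (hr : 0 < r)
    (hb : ∀ n y, ‖iteratedDeriv n g y‖ ≤ M * n.factorial / r ^ n) (x : ℝ) {z : ℂ}
    (hz : ‖z - x‖ ≤ r / 2) : ‖complexTaylor g x z‖ ≤ 2 * M := by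
  have hterm : ∀ n : ℕ, ‖(iteratedDeriv n g x / (n.factorial : ℂ)) * (z - x) ^ n‖ ≤
      M * (1 / 2) ^ n := by
    intro n
    have h2 : (0 : ℝ) < n.factorial := by positivity
    rw [norm_mul, norm_div, norm_pow, Complex.norm_natCast]
    calc ‖iteratedDeriv n g x‖ / n.factorial * ‖z - x‖ ^ n
        ≤ (M * n.factorial / r ^ n) / n.factorial * (r / 2) ^ n := by
          have h0 := (norm_nonneg _).trans (hb n x)
          have h1 := hb n x
          gcongr
      _ = M * (1 / 2) ^ n := by
          rw [div_pow, div_pow, one_pow]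
          field_simp
  have hs : HasSum (fun n : ℕ => M * (1 / 2 : ℝ) ^ n) (2 * M) := by
    have := (hasSum_geometric_two).mul_left M
    rwa [mul_comm M 2] at this
  rw [complexTaylor_eq_tsum]
  exact tsum_of_norm_bounded hs hterm

theorem complexTaylor_ofReal (hg : AnalyticOnNhd ℝ g Set.univ) (hr : 0 < r)
    (hb : ∀ n y, ‖iteratedDeriv n g y‖ ≤ M * n.factorial / r ^ n) (x : ℝ) :
    Set.EqOn (fun t : ℝ => complexTaylor g x t) g (Metric.ball x r) := by
  have hT : AnalyticOnNhd ℝ (fun t : ℝ => complexTaylor g x t) (Metric.ball x r) := by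
    intro t ht
    have h1 := (complexTaylor_analyticOnNhd hr hb x t (by
      rw [Metric.mem_ball, Complex.dist_of_im_eq (by simp)]; simpa using ht)).restrictScalars
      (𝕜 := ℝ)
    exact h1.comp (f := fun t : ℝ => (t : ℂ)) (Complex.ofRealCLM.analyticAt t)
  refine hT.eqOn_of_preconnected_of_eventuallyEq (hg.mono (Set.subset_univ _))
    (convex_ball x r).isPreconnected (Metric.mem_ball_self hr) ?_
  obtain ⟨G, hG, hgG⟩ := (hg x trivial).exists_local_complexification
  obtain ⟨s, hs, hsG⟩ := Metric.eventually_nhds_iff.1 (hG.eventually_analyticAt)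
  have hd : DifferentiableOn ℂ G (Metric.ball x s) := fun z hz =>
    (hsG hz).differentiableAt.differentiableWithinAt
  have hder : ∀ n, iteratedDeriv n g x = iteratedDeriv n G x := fun n => by
    rw [← iteratedDeriv_comp_ofReal Metric.isOpen_ball hd n x (Metric.mem_ball_self hs)]
    exact Filter.EventuallyEq.iteratedDeriv_eq n hgG
  filter_upwards [hgG, Metric.ball_mem_nhds x hs] with t ht hts
  rw [ht]
  have := Complex.taylorSeries_eq_on_ball (f := G) (c := x) (z := t) hd (by
    rw [Metric.mem_ball, Complex.dist_of_im_eq (by simp)]; simpa using hts)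
  rw [← this, complexTaylor_eq_tsum]
  refine tsum_congr fun n => ?_
  rw [hder n]
  simp only [smul_eq_mul]
  ring

theorem complexTaylor_eq (hg : AnalyticOnNhd ℝ g Set.univ) (hr : 0 < r)
    (hb : ∀ n y, ‖iteratedDeriv n g y‖ ≤ M * n.factorial / r ^ n) {x : ℝ} {z : ℂ}
    (hz : z ∈ Metric.ball (x : ℂ) r) : complexTaylor g x z = complexTaylor g z.re z := by
  have hre : ∀ c : ℝ, z ∈ Metric.ball (c : ℂ) r → z.re ∈ Metric.ball c r := fun c hc => by
    rw [Metric.mem_ball, Complex.dist_eq] at hc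
    rw [Metric.mem_ball, Real.dist_eq]
    have := Complex.abs_re_le_norm (z - c)
    simp only [Complex.sub_re, Complex.ofReal_re] at this
    linarith
  have hz' : z ∈ Metric.ball (z.re : ℂ) r := by
    have : dist z z.re ≤ dist z x := by
      rw [Complex.dist_eq, Complex.dist_eq]
      have e : z - (z.re : ℂ) = (z.im : ℂ) * Complex.I := by
        apply Complex.ext <;> simp
      rw [e, norm_mul, Complex.norm_I, mul_one, Complex.norm_real]
      simpa using Complex.abs_im_le_norm (z - x)
    exact lt_of_le_of_lt this hz
  set O : Set ℂ := Metric.ball (x : ℂ) r ∩ Metric.ball (z.re : ℂ) r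
  have hO : IsPreconnected O := ((convex_ball _ _).inter (convex_ball _ _)).isPreconnected
  have hmem : ∀ c : ℝ, z.re ∈ Metric.ball c r → (z.re : ℂ) ∈ Metric.ball (c : ℂ) r := fun c hc => by
    rw [Metric.mem_ball, Complex.dist_of_im_eq (by simp)]; simpa using hc
  have h1 : ∀ᶠ t : ℝ in nhdsWithin z.re {z.re}ᶜ, complexTaylor g x t = complexTaylor g z.re t := by
    refine Filter.Eventually.filter_mono nhdsWithin_le_nhds ?_
    filter_upwards [Metric.isOpen_ball.mem_nhds (hre x hz), Metric.ball_mem_nhds z.re hr] with t h h'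
    exact (complexTaylor_ofReal hg hr hb x h).trans (complexTaylor_ofReal hg hr hb z.re h').symm
  have h2 : Filter.Tendsto (fun t : ℝ => (t : ℂ)) (nhdsWithin z.re {z.re}ᶜ)
      (nhdsWithin (z.re : ℂ) {(z.re : ℂ)}ᶜ) := by
    refine tendsto_nhdsWithin_iff.2 ⟨?_, ?_⟩
    · exact (Complex.continuous_ofReal.tendsto z.re).mono_left nhdsWithin_le_nhds
    · filter_upwards [self_mem_nhdsWithin] with t ht
      simpa using ht
  have hx : AnalyticOnNhd ℂ (complexTaylor g x) O :=
    (complexTaylor_analyticOnNhd hr hb x).mono Set.inter_subset_left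
  have hx' : AnalyticOnNhd ℂ (complexTaylor g z.re) O :=
    (complexTaylor_analyticOnNhd hr hb z.re).mono Set.inter_subset_right
  exact hx.eqOn_of_preconnected_of_frequently_eq hx' hO
    (z₀ := (z.re : ℂ)) ⟨hmem x (hre x hz), Metric.mem_ball_self hr⟩
    (h2.frequently h1.frequently) ⟨hz, hz'⟩

/-- A real-analytic function with uniform Cauchy estimates of radius `r` extends
holomorphically to the strip of half-width `r`. -/
theorem exists_strip_extension (hg : AnalyticOnNhd ℝ g Set.univ) (hr : 0 < r)
    (hb : ∀ n y, ‖iteratedDeriv n g y‖ ≤ M * n.factorial / r ^ n) :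
    ∃ G : ℂ → ℂ, DifferentiableOn ℂ G {w | |w.im| < r} ∧ (∀ x : ℝ, G x = g x) ∧
      ∀ w, |w.im| ≤ r / 2 → ‖G w‖ ≤ 2 * M := by
  have hdist : ∀ w : ℂ, ‖w - w.re‖ = |w.im| := fun w => by
    have e : w - (w.re : ℂ) = (w.im : ℂ) * Complex.I := by
      apply Complex.ext <;> simp
    rw [e, norm_mul, Complex.norm_I, mul_one, Complex.norm_real, Real.norm_eq_abs]
  refine ⟨fun w => complexTaylor g w.re w, fun w hw => ?_, fun x => ?_, fun w hw => ?_⟩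
  · have hw' : w ∈ Metric.ball (w.re : ℂ) r := by
      rw [Metric.mem_ball, Complex.dist_eq, hdist]; exact hw
    have h1 := (complexTaylor_analyticOnNhd hr hb w.re w hw').differentiableAt
    refine (h1.congr_of_eventuallyEq ?_).differentiableWithinAt
    filter_upwards [Metric.isOpen_ball.mem_nhds hw'] with z hz
    exact (complexTaylor_eq hg hr hb hz).symm
  · exact complexTaylor_ofReal hg hr hb x (Metric.mem_ball_self hr)
  · exact norm_complexTaylor_le hr hb _ (by rw [hdist]; exact hw)

end complexTaylor

/-- The Blaschke factor of the unit disc with a real zero `w`. -/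
def realBlaschke (w : ℝ) (z : ℂ) : ℂ := (z - w) / (1 - w * z)

section realBlaschke

variable {w : ℝ} {z : ℂ}

theorem one_sub_ofReal_mul_ne_zero (hw : |w| < 1) (hz : ‖z‖ < 1) : 1 - (w : ℂ) * z ≠ 0 := by
  intro h
  have h1 : (w : ℂ) * z = 1 := (sub_eq_zero.1 h).symm
  have h2 : |w| * ‖z‖ = 1 := by
    rw [← Real.norm_eq_abs, ← Complex.norm_real, ← norm_mul, h1, norm_one]
  nlinarith [abs_nonneg w, norm_nonneg z]

theorem norm_realBlaschke_lt_one (hw : |w| < 1) (hz : ‖z‖ < 1) : ‖realBlaschke w z‖ < 1 := by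
  have h0 := one_sub_ofReal_mul_ne_zero hw hz
  rw [realBlaschke, norm_div, div_lt_one (norm_pos_iff.2 h0)]
  refine lt_of_pow_lt_pow_left₀ 2 (norm_nonneg _) ?_
  have hz2 : ‖z‖ ^ 2 < 1 := by nlinarith [norm_nonneg z]
  have hw2 : w ^ 2 < 1 := by nlinarith [sq_abs w, abs_nonneg w]
  rw [← Complex.normSq_eq_norm_sq, Complex.normSq_apply] at hz2
  rw [← Complex.normSq_eq_norm_sq, ← Complex.normSq_eq_norm_sq, Complex.normSq_apply,
    Complex.normSq_apply]
  simp
  nlinarith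

theorem differentiableAt_realBlaschke (hw : |w| < 1) (hz : ‖z‖ < 1) :
    DifferentiableAt ℂ (realBlaschke w) z := by
  unfold realBlaschke
  exact (by fun_prop : DifferentiableAt ℂ (fun z : ℂ => z - w) z).div (by fun_prop)
    (one_sub_ofReal_mul_ne_zero hw hz)

theorem realBlaschke_neg_comp (hw : |w| < 1) (hz : ‖z‖ < 1) :
    realBlaschke (-w) (realBlaschke w z) = z := by
  have h0 := one_sub_ofReal_mul_ne_zero hw hz
  have h1 := one_sub_ofReal_mul_ne_zero (w := -w) (by simpa using hw)
    (norm_realBlaschke_lt_one hw hz)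
  have hb : realBlaschke w z * (1 - w * z) = z - w := div_mul_cancel₀ _ h0
  rw [realBlaschke, div_eq_iff h1]
  push_cast
  linear_combination hb

theorem deriv_realBlaschke_self (hw : |w| < 1) : deriv (realBlaschke w) w ≠ 0 := by
  have h0 := one_sub_ofReal_mul_ne_zero (z := w) hw (by simpa using hw)
  have h : HasDerivAt (realBlaschke w) ((1 * (1 - (w : ℂ) * w) - (w - w) * (-(w * 1))) /
      (1 - (w : ℂ) * w) ^ 2) w := by
    unfold realBlaschke
    refine HasDerivAt.div ((hasDerivAt_id _).sub_const _) ?_ h0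
    exact ((hasDerivAt_id _).const_mul _).const_sub 1
  rw [h.deriv]
  simp [h0]

end realBlaschke

/-- A bounded holomorphic function on the disc with a zero at `w` is divisible by the Blaschke
factor of `w`, without increasing the bound. -/
theorem exists_eq_realBlaschke_mul {F : ℂ → ℂ} {M w : ℝ}
    (hF : DifferentiableOn ℂ F (Metric.ball 0 1)) (hM : ∀ z ∈ Metric.ball (0 : ℂ) 1, ‖F z‖ ≤ M)
    (hw : |w| < 1) (h0 : F w = 0) :
    ∃ G : ℂ → ℂ, DifferentiableOn ℂ G (Metric.ball 0 1) ∧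
      (∀ z ∈ Metric.ball (0 : ℂ) 1, ‖G z‖ ≤ M) ∧
      ∀ z ∈ Metric.ball (0 : ℂ) 1, F z = realBlaschke w z * G z := by
  have hw' : |-w| < 1 := by simpa using hw
  have hmaps : ∀ {v : ℝ}, |v| < 1 →
      Set.MapsTo (realBlaschke v) (Metric.ball 0 1) (Metric.ball 0 1) := fun hv z hz => by
    rw [mem_ball_zero_iff] at hz ⊢
    exact norm_realBlaschke_lt_one hv hz
  have hdiff : ∀ {v : ℝ}, |v| < 1 →
      DifferentiableOn ℂ (realBlaschke v) (Metric.ball 0 1) := fun hv z hz =>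
    (differentiableAt_realBlaschke hv (mem_ball_zero_iff.1 hz)).differentiableWithinAt
  set H : ℂ → ℂ := F ∘ realBlaschke (-w)
  have hH : DifferentiableOn ℂ H (Metric.ball 0 1) := hF.comp (hdiff hw') (hmaps hw')
  have hH0 : H 0 = 0 := by simp [H, realBlaschke, h0]
  have hHM : Set.MapsTo H (Metric.ball 0 1) (Metric.closedBall (H 0) M) := fun z hz => by
    rw [hH0, mem_closedBall_zero_iff]
    exact hM _ (hmaps hw' hz)
  refine ⟨dslope H 0 ∘ realBlaschke w, ?_, fun z hz => ?_, fun z hz => ?_⟩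
  · exact ((Complex.differentiableOn_dslope (Metric.ball_mem_nhds _ one_pos)).2 hH).comp
      (hdiff hw) (hmaps hw)
  · have := Complex.norm_dslope_le_div_of_mapsTo_ball hH hHM (hmaps hw hz)
    simpa using this
  · have h1 := sub_smul_dslope H 0 (realBlaschke w z)
    rw [hH0, sub_zero, sub_zero, smul_eq_mul] at h1
    rw [Function.comp_apply, h1]
    simp only [H, Function.comp_apply]
    rw [realBlaschke_neg_comp hw (mem_ball_zero_iff.1 hz)]

/-- Jensen-type bound: a bounded holomorphic function on the disc is small at the origin if it
has many real zeros, counted with multiplicity. -/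
theorem norm_apply_zero_le_of_zeros {M a : ℝ} (ha : a < 1) (s : Multiset ℝ)
    (hs : ∀ w ∈ s, |w| ≤ a) :
    ∀ {F : ℂ → ℂ}, DifferentiableOn ℂ F (Metric.ball 0 1) →
      (∀ z ∈ Metric.ball (0 : ℂ) 1, ‖F z‖ ≤ M) →
      (∀ w ∈ s, (s.count w : ℕ∞) ≤ analyticOrderAt F w) → ‖F 0‖ ≤ M * a ^ s.card := by
  induction s using Multiset.induction_on with
  | empty =>
    intro F hF hM _
    simpa using hM 0 (by simp)
  | cons w s ih =>
    intro F hF hM ho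
    have hwa : |w| ≤ a := hs w (by simp)
    have hw : |w| < 1 := hwa.trans_lt ha
    have hmem : ∀ {v : ℝ}, |v| ≤ a → (v : ℂ) ∈ Metric.ball (0 : ℂ) 1 := fun hv => by
      rw [mem_ball_zero_iff, Complex.norm_real]; exact hv.trans_lt ha
    have h0 : F w = 0 := by
      refine apply_eq_zero_of_analyticOrderAt_ne_zero (ne_of_gt (lt_of_lt_of_le ?_ (ho w (by simp))))
      simp
    obtain ⟨G, hG, hGM, hFG⟩ := exists_eq_realBlaschke_mul hF hM hw h0
    have hGan : ∀ {v : ℝ}, |v| ≤ a → AnalyticAt ℂ G v := fun hv =>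
      hG.analyticAt (Metric.isOpen_ball.mem_nhds (hmem hv))
    have hBan : ∀ {v : ℝ}, |v| ≤ a → AnalyticAt ℂ (realBlaschke w) v := fun hv => by
      refine DifferentiableOn.analyticAt (s := Metric.ball 0 1) (fun z hz => ?_)
        (Metric.isOpen_ball.mem_nhds (hmem hv))
      exact (differentiableAt_realBlaschke hw (mem_ball_zero_iff.1 hz)).differentiableWithinAt
    have hord : ∀ {v : ℝ}, |v| ≤ a →
        analyticOrderAt F v = analyticOrderAt (realBlaschke w) v + analyticOrderAt G v := by
      intro v hv
      rw [← analyticOrderAt_mul (hBan hv) (hGan hv)]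
      refine analyticOrderAt_congr ?_
      filter_upwards [Metric.isOpen_ball.mem_nhds (hmem hv)] with z hz using hFG z hz
    have hG0 := ih (fun v hv => hs v (Multiset.mem_cons_of_mem hv)) hG hGM (by
      intro v hv
      have hva := hs v (Multiset.mem_cons_of_mem hv)
      have h1 := ho v (Multiset.mem_cons_of_mem hv)
      rw [hord hva] at h1
      by_cases hvw : v = w
      · subst hvw
        have hone : analyticOrderAt (realBlaschke v) v = 1 :=
          (hBan hva).analyticOrderAt_eq_one_of_zero_deriv_ne_zero (by simp [realBlaschke])
            (deriv_realBlaschke_self hw)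
        rw [hone, Multiset.count_cons_self, Nat.cast_add, Nat.cast_one, add_comm] at h1
        exact (ENat.add_le_add_iff_left (by simp)).1 h1
      · have hzero : analyticOrderAt (realBlaschke w) v = 0 := by
          rw [(hBan hva).analyticOrderAt_eq_zero, realBlaschke]
          refine div_ne_zero ?_ (one_sub_ofReal_mul_ne_zero hw (by
            rw [Complex.norm_real]; exact hva.trans_lt ha))
          rw [sub_ne_zero]
          exact_mod_cast hvw
        rwa [hzero, zero_add, Multiset.count_cons_of_ne hvw] at h1)
    have h0M : 0 ≤ M := (norm_nonneg _).trans (hM 0 (by simp))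
    have ha0 : 0 ≤ a := (abs_nonneg w).trans hwa
    rw [hFG 0 (by simp), norm_mul, Multiset.card_cons, pow_succ]
    calc ‖realBlaschke w 0‖ * ‖G 0‖ ≤ a * (M * a ^ s.card) := by
          gcongr
          simpa [realBlaschke] using hwa
      _ = M * (a ^ s.card * a) := by ring

/-- The conformal map of the unit disc onto the strip `|Im| < ρ`, sending `0` to `x₀`. -/
def discToStrip (x₀ ρ : ℝ) (w : ℂ) : ℂ :=
  x₀ + (2 * ρ / π : ℝ) * Complex.log ((1 + w) / (1 - w))

section discToStrip

variable {w : ℂ} {x₀ ρ : ℝ}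

theorem one_sub_ne_zero_of_norm_lt_one (hw : ‖w‖ < 1) : 1 - w ≠ 0 := by
  rintro h
  rw [← sub_eq_zero.1 h] at hw
  simp at hw

theorem re_one_add_div_one_sub_pos (hw : ‖w‖ < 1) : 0 < ((1 + w) / (1 - w)).re := by
  have h0 := Complex.normSq_pos.2 (one_sub_ne_zero_of_norm_lt_one hw)
  have hw2 : ‖w‖ ^ 2 < 1 := by nlinarith [norm_nonneg w]
  rw [← Complex.normSq_eq_norm_sq, Complex.normSq_apply] at hw2
  rw [Complex.div_re, ← add_div]
  refine div_pos ?_ h0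
  simp
  nlinarith

theorem discToStrip_im_lt (hρ : 0 < ρ) (hw : ‖w‖ < 1) : |(discToStrip x₀ ρ w).im| < ρ := by
  have h1 := Complex.abs_arg_lt_pi_div_two_iff.2 (Or.inl (re_one_add_div_one_sub_pos hw))
  rw [discToStrip, Complex.add_im, Complex.ofReal_im, zero_add, Complex.im_ofReal_mul,
    Complex.log_im, abs_mul, abs_of_pos (by positivity)]
  calc 2 * ρ / π * |((1 + w) / (1 - w)).arg| < 2 * ρ / π * (π / 2) := by gcongr
    _ = ρ := by field_simp

theorem hasDerivAt_discToStrip (hw : ‖w‖ < 1) :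
    HasDerivAt (discToStrip x₀ ρ)
      ((2 * ρ / π : ℝ) * (((1 * (1 - w) - (1 + w) * (-1)) / (1 - w) ^ 2) /
        ((1 + w) / (1 - w)))) w := by
  refine HasDerivAt.const_add _ (HasDerivAt.const_mul _ (HasDerivAt.clog ?_ ?_))
  · exact ((hasDerivAt_id w).const_add 1).div ((hasDerivAt_id w).const_sub 1)
      (one_sub_ne_zero_of_norm_lt_one hw)
  · exact Or.inl (re_one_add_div_one_sub_pos hw)

theorem deriv_discToStrip_ne_zero (hρ : 0 < ρ) (hw : ‖w‖ < 1) :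
    deriv (discToStrip x₀ ρ) w ≠ 0 := by
  rw [(hasDerivAt_discToStrip hw).deriv]
  have h1 := one_sub_ne_zero_of_norm_lt_one hw
  have h2 : (1 + w) / (1 - w) ≠ 0 := fun h => by
    have := re_one_add_div_one_sub_pos hw
    simp [h] at this
  have h3 : 1 * (1 - w) - (1 + w) * (-1) = 2 := by ring
  rw [h3]
  refine mul_ne_zero (by exact_mod_cast (by positivity : 2 * ρ / π ≠ 0)) ?_
  exact div_ne_zero (div_ne_zero two_ne_zero (pow_ne_zero 2 h1)) h2

/-- The real inverse of `discToStrip` on the real axis. -/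
def stripToDiscReal (x₀ ρ p : ℝ) : ℝ :=
  (Real.exp (π * (p - x₀) / (2 * ρ)) - 1) / (Real.exp (π * (p - x₀) / (2 * ρ)) + 1)

theorem discToStrip_stripToDiscReal (hρ : 0 < ρ) (p : ℝ) :
    discToStrip x₀ ρ (stripToDiscReal x₀ ρ p) = p := by
  set e := Real.exp (π * (p - x₀) / (2 * ρ)) with he
  have hepos : 0 < e := Real.exp_pos _
  have h1 : (1 + stripToDiscReal x₀ ρ p) / (1 - stripToDiscReal x₀ ρ p) = e := by
    rw [stripToDiscReal, ← he, one_add_div (by positivity), one_sub_div (by positivity),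
      div_div_div_cancel_right₀ (by positivity)]
    field_simp
    ring
  have h2 : (1 + (stripToDiscReal x₀ ρ p : ℂ)) / (1 - stripToDiscReal x₀ ρ p) = (e : ℝ) := by
    exact_mod_cast congrArg (fun x : ℝ => (x : ℂ)) h1
  rw [discToStrip, h2, ← Complex.ofReal_log hepos.le, he, Real.log_exp, ← Complex.ofReal_mul,
    ← Complex.ofReal_add]
  congr 1
  field_simp
  ring

theorem stripToDiscReal_mem {ℓ p : ℝ} (hρ : 0 < ρ) (hp : p ∈ Set.Icc x₀ (x₀ + ℓ)) :
    |stripToDiscReal x₀ ρ p| ≤ 1 - 2 / (Real.exp (π * ℓ / (2 * ρ)) + 1) := by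
  set e := Real.exp (π * (p - x₀) / (2 * ρ)) with he
  have he1 : 1 ≤ e := Real.one_le_exp (by
    have := sub_nonneg.2 hp.1
    positivity)
  have hle : e ≤ Real.exp (π * ℓ / (2 * ρ)) := by
    refine Real.exp_le_exp.2 ?_
    have : p - x₀ ≤ ℓ := by linarith [hp.2]
    gcongr
  have h1 : stripToDiscReal x₀ ρ p = 1 - 2 / (e + 1) := by
    rw [stripToDiscReal, ← he]
    field_simp
    ring
  have h2 : 2 / (Real.exp (π * ℓ / (2 * ρ)) + 1) ≤ 2 / (e + 1) := by gcongr
  have h3 : 2 / (e + 1) ≤ 1 := by rw [div_le_one (by linarith)]; linarith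
  rw [h1, abs_of_nonneg (by linarith)]
  linarith

end discToStrip

/-- Zero count in a strip: a bounded holomorphic function with `n` real zeros (with multiplicity)
within distance `ℓ` of `x₀` is exponentially small in `n` at `x₀`. -/
theorem exists_norm_apply_le_of_real_zeros {ρ ℓ : ℝ} (hρ : 0 < ρ) :
    ∃ a : ℝ, 0 < a ∧ a < 1 ∧ ∀ (U : ℂ → ℂ) (M x₀ : ℝ),
      DifferentiableOn ℂ U {w | |w.im| < ρ} → (∀ w : ℂ, |w.im| < ρ → ‖U w‖ ≤ M) →
      ∀ s : Multiset ℝ, (∀ p ∈ s, p ∈ Set.Icc x₀ (x₀ + ℓ)) →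
        (∀ p ∈ s, (s.count p : ℕ∞) ≤ analyticOrderAt U p) → ‖U x₀‖ ≤ M * a ^ s.card := by
  set E := Real.exp (π * ℓ / (2 * ρ)) with hE
  have hEpos : 0 < E := Real.exp_pos _
  set a₀ := 1 - 2 / (E + 1) with ha₀
  have ha₀1 : a₀ < 1 := by rw [ha₀]; linarith [show 0 < 2 / (E + 1) by positivity]
  refine ⟨max a₀ (1 / 2), by positivity, max_lt ha₀1 (by norm_num), ?_⟩
  intro U M x₀ hU hM s hs ho
  have hinj : Function.Injective (stripToDiscReal x₀ ρ) := fun p p' h => by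
    have h1 := discToStrip_stripToDiscReal (x₀ := x₀) hρ p
    rw [h, discToStrip_stripToDiscReal hρ] at h1
    exact_mod_cast h1.symm
  have hmaps : Set.MapsTo (discToStrip x₀ ρ) (Metric.ball 0 1) {w | |w.im| < ρ} := fun w hw =>
    discToStrip_im_lt hρ (mem_ball_zero_iff.1 hw)
  have hdiff : DifferentiableOn ℂ (discToStrip x₀ ρ) (Metric.ball 0 1) := fun w hw =>
    (hasDerivAt_discToStrip (mem_ball_zero_iff.1 hw)).differentiableAt.differentiableWithinAt
  have hle : ∀ p ∈ s, |stripToDiscReal x₀ ρ p| ≤ max a₀ (1 / 2) := fun p hp =>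
    (stripToDiscReal_mem hρ (hs p hp)).trans (le_max_left _ _)
  have hlt : max a₀ (1 / 2) < 1 := max_lt ha₀1 (by norm_num)
  have key := norm_apply_zero_le_of_zeros (M := M) hlt
    (s.map (stripToDiscReal x₀ ρ)) (by simpa using hle) (F := U ∘ discToStrip x₀ ρ)
    (hU.comp hdiff hmaps) (fun z hz => hM _ (hmaps hz)) (by
      intro w hw
      obtain ⟨p, hp, rfl⟩ := Multiset.mem_map.1 hw
      have hn : ‖(stripToDiscReal x₀ ρ p : ℂ)‖ < 1 := by
        rw [Complex.norm_real]; exact (hle p hp).trans_lt hlt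
      rw [Multiset.count_map_eq_count' _ _ hinj, analyticOrderAt_comp_of_deriv_ne_zero
        (hdiff.analyticAt (Metric.isOpen_ball.mem_nhds (mem_ball_zero_iff.2 hn)))
        (deriv_discToStrip_ne_zero hρ hn), discToStrip_stripToDiscReal hρ]
      exact ho p hp)
  simpa [discToStrip] using key

/-- The open horizontal strip `|Im w| < r`. -/
def hStrip (r : ℝ) : Set ℂ := {w | |w.im| < r}

section hStrip

theorem isOpen_hStrip (r : ℝ) : IsOpen (hStrip r) :=
  isOpen_lt (by fun_prop) continuous_const

theorem convex_im_Ioo (a b : ℝ) : Convex ℝ {w : ℂ | w.im ∈ Set.Ioo a b} :=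
  (convex_Ioo a b).linear_preimage Complex.imLm

theorem hStrip_eq (r : ℝ) : hStrip r = {w : ℂ | w.im ∈ Set.Ioo (-r) r} := by
  ext w; simp [hStrip, abs_lt]

theorem isPreconnected_hStrip (r : ℝ) : IsPreconnected (hStrip r) := by
  rw [hStrip_eq]; exact (convex_im_Ioo _ _).isPreconnected

theorem ofReal_mem_hStrip {r : ℝ} (hr : 0 < r) (x : ℝ) : (x : ℂ) ∈ hStrip r := by
  simpa [hStrip] using hr

theorem hStrip_mono {r r' : ℝ} (h : r ≤ r') : hStrip r ⊆ hStrip r' := fun _ hw => lt_of_lt_of_le hw h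

theorem add_real_mem_hStrip {r : ℝ} {w : ℂ} (hw : w ∈ hStrip r) (x : ℝ) : w + x ∈ hStrip r := by
  simpa [hStrip] using hw

theorem hStrip_eqOn {F G : ℂ → ℂ} {r : ℝ} (hr : 0 < r) (hF : DifferentiableOn ℂ F (hStrip r))
    (hG : DifferentiableOn ℂ G (hStrip r)) (h : ∀ x : ℝ, F x = G x) :
    Set.EqOn F G (hStrip r) := by
  have h2 : Filter.Tendsto (fun t : ℝ => (t : ℂ)) (nhdsWithin 0 {0}ᶜ)
      (nhdsWithin (0 : ℂ) {(0 : ℂ)}ᶜ) := by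
    refine tendsto_nhdsWithin_iff.2 ⟨?_, ?_⟩
    · exact (Complex.continuous_ofReal.tendsto' 0 0 (by simp)).mono_left nhdsWithin_le_nhds
    · filter_upwards [self_mem_nhdsWithin] with t ht
      simpa using ht
  refine (hF.analyticOnNhd (isOpen_hStrip r)).eqOn_of_preconnected_of_frequently_eq
    (hG.analyticOnNhd (isOpen_hStrip r)) (isPreconnected_hStrip r) (z₀ := 0)
    (by simpa using ofReal_mem_hStrip hr 0) (h2.frequently (Filter.Frequently.of_forall h))

theorem exists_int_add_mem_Ico {ℓ : ℝ} (hℓ : 0 < ℓ) (w : ℂ) :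
    ∃ n : ℤ, (w + n * ℓ).re ∈ Set.Ico 0 ℓ := by
  obtain ⟨n, hn, -⟩ := existsUnique_add_zsmul_mem_Ico hℓ w.re 0
  refine ⟨n, ?_⟩
  simpa using hn

theorem dist_re_eq (w : ℂ) : dist w (w.re : ℂ) = |w.im| := by
  have e : w - (w.re : ℂ) = (w.im : ℂ) * Complex.I := by
    apply Complex.ext <;> simp
  rw [Complex.dist_eq, e, norm_mul, Complex.norm_I, mul_one, Complex.norm_real, Real.norm_eq_abs]

theorem periodic_int {Q : ℂ → ℂ} {r ℓ : ℝ} (h : ∀ w ∈ hStrip r, Q (w + ℓ) = Q w) (n : ℤ) :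
    ∀ w ∈ hStrip r, Q (w + n * ℓ) = Q w := by
  induction n using Int.induction_on with
  | zero => intro w _; simp
  | succ k ih =>
    intro w hw
    have := h (w + k * ℓ) (by simpa using add_real_mem_hStrip hw (k * ℓ))
    rw [Int.cast_natCast] at ih
    rw [ih w hw] at this
    rw [← this]; congr 1; push_cast; ring
  | pred k ih =>
    intro w hw
    have := h (w + (-k - 1) * ℓ) (by simpa using add_real_mem_hStrip hw ((-k - 1) * ℓ))
    rw [← ih w hw]
    push_cast at this ⊢
    rw [← this]
    congr 1
    ring

end hStrip

/-- A holomorphic collar of the boundary of a planar domain. -/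
structure Collar (D : Set ℂ) where
  ε : ℝ
  ℓ : ℝ
  Q : ℂ → ℂ
  ε_pos : 0 < ε
  ℓ_pos : 0 < ℓ
  diff : DifferentiableOn ℂ Q (hStrip ε)
  periodic : ∀ w ∈ hStrip ε, Q (w + ℓ) = Q w
  inj : ∀ w ∈ hStrip ε, ∀ w' ∈ hStrip ε, Q w = Q w' → ∃ n : ℤ, w' = w + n * ℓ
  le_deriv : ∀ w ∈ hStrip ε, 1 / 2 ≤ ‖deriv Q w‖
  deriv_le : ∀ w ∈ hStrip ε, ‖deriv Q w‖ ≤ 2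
  real_mem : ∀ x : ℝ, Q x ∈ frontier D
  surj : ∀ z ∈ frontier D, ∃ x : ℝ, Q x = z
  inside : ∀ w : ℂ, w.im ∈ Set.Ioo 0 ε → Q w ∈ D
  outside : ∀ w : ℂ, w.im ∈ Set.Ioo (-ε) 0 → Q w ∉ closure D

theorem exists_hStrip_deriv_bounds {G : ℂ → ℂ} {r ℓ : ℝ} (hr : 0 < r) (hℓ : 0 < ℓ)
    (hG : DifferentiableOn ℂ G (hStrip r)) (hper : ∀ w ∈ hStrip r, G (w + ℓ) = G w)
    (hder : ∀ x : ℝ, ‖deriv G x‖ = 1) :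
    ∃ ε, 0 < ε ∧ ε ≤ r ∧ ∀ w ∈ hStrip ε, 1 / 2 ≤ ‖deriv G w‖ ∧ ‖deriv G w‖ ≤ 2 := by
  have hder' : ContinuousOn (fun w => ‖deriv G w‖) (hStrip r) :=
    ((hG.deriv (isOpen_hStrip r)).continuousOn).norm
  have hO : IsOpen (hStrip r ∩ (fun w => ‖deriv G w‖) ⁻¹' Set.Ioo (1 / 2) 2) :=
    hder'.isOpen_inter_preimage (isOpen_hStrip r) isOpen_Ioo
  have hK : IsCompact ((fun x : ℝ => (x : ℂ)) '' Set.Icc 0 ℓ) :=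
    isCompact_Icc.image Complex.continuous_ofReal
  obtain ⟨δ, hδ, hsub⟩ := hK.exists_thickening_subset_open hO (by
    rintro _ ⟨x, _, rfl⟩
    exact ⟨ofReal_mem_hStrip hr x, by simp [hder x]; norm_num⟩)
  refine ⟨min δ r, lt_min hδ hr, min_le_right _ _, fun w hw => ?_⟩
  have hwr : w ∈ hStrip r := hStrip_mono (min_le_right _ _) hw
  obtain ⟨n, hn⟩ := exists_int_add_mem_Ico hℓ w
  have hd : deriv G (w + n * ℓ) = deriv G w := by
    rw [← deriv_comp_add_const]
    refine Filter.EventuallyEq.deriv_eq ?_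
    filter_upwards [(isOpen_hStrip r).mem_nhds hwr] with z hz using periodic_int hper n z hz
  have hmem : w + n * ℓ ∈ Metric.thickening δ ((fun x : ℝ => (x : ℂ)) '' Set.Icc 0 ℓ) := by
    refine Metric.mem_thickening_iff.2 ⟨_, ⟨_, Set.Ico_subset_Icc_self hn, rfl⟩, ?_⟩
    rw [dist_re_eq]
    simpa using lt_of_lt_of_le hw (min_le_left _ _)
  have := (hsub hmem).2
  rw [Set.mem_preimage, hd] at this
  exact ⟨this.1.le, this.2.le⟩

theorem exists_hStrip_injective {G : ℂ → ℂ} {r ℓ : ℝ} (hr : 0 < r) (hℓ : 0 < ℓ)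
    (hG : DifferentiableOn ℂ G (hStrip r)) (hper : ∀ w ∈ hStrip r, G (w + ℓ) = G w)
    (hder : ∀ x : ℝ, deriv G x ≠ 0) (hinj : Set.InjOn (fun x : ℝ => G x) (Set.Ico 0 ℓ)) :
    ∃ ε, 0 < ε ∧ ε ≤ r ∧
      ∀ w ∈ hStrip ε, ∀ w' ∈ hStrip ε, G w = G w' → ∃ n : ℤ, w' = w + n * ℓ := by
  set P : ℂ × ℂ → Prop := fun p => G p.1 = G p.2 → ∃ n : ℤ, p.2 = p.1 + n * ℓ with hP
  have hinj' : ∀ x y : ℝ, G x = G y → ∃ n : ℤ, (y : ℂ) = x + n * ℓ := by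
    intro x y hxy
    obtain ⟨n, hn⟩ := exists_int_add_mem_Ico hℓ (x : ℂ)
    obtain ⟨m, hm⟩ := exists_int_add_mem_Ico hℓ (y : ℂ)
    have e1 := periodic_int hper n x (ofReal_mem_hStrip hr x)
    have e2 := periodic_int hper m y (ofReal_mem_hStrip hr y)
    have := hinj (x₁ := x + n * ℓ) (x₂ := y + m * ℓ) (by simpa using hn) (by simpa using hm)
      (by push_cast; rw [e1, e2, hxy])
    refine ⟨n - m, ?_⟩
    have h2 : y = x + (n - m) * ℓ := by linarith
    rw [h2]; push_cast; ring
  have hloc : ∀ x y : ℝ, ∀ᶠ p in nhds ((x : ℂ), (y : ℂ)), P p := by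
    intro x y
    have hcont : ∀ z : ℝ, ContinuousAt G z := fun z =>
      (hG.differentiableAt ((isOpen_hStrip r).mem_nhds (ofReal_mem_hStrip hr z))).continuousAt
    by_cases hxy : G x = G y
    · obtain ⟨n, hn⟩ := hinj' x y hxy
      have han : AnalyticAt ℂ G x :=
        hG.analyticAt ((isOpen_hStrip r).mem_nhds (ofReal_mem_hStrip hr x))
      obtain ⟨s, hs, hsinj⟩ : ∃ s ∈ nhds (x : ℂ), Set.InjOn G s :=
        ⟨_, ((han.hasStrictDerivAt.hasStrictFDerivAt_equiv (hder x)).toOpenPartialHomeomorph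
          G).open_source.mem_nhds (HasStrictFDerivAt.mem_toOpenPartialHomeomorph_source _),
          ((han.hasStrictDerivAt.hasStrictFDerivAt_equiv (hder x)).toOpenPartialHomeomorph
          G).injOn⟩
      have ht : Filter.Tendsto (fun p : ℂ × ℂ => p.2 - n * ℓ) (nhds ((x : ℂ), (y : ℂ)))
          (nhds (x : ℂ)) := by
        refine Continuous.tendsto' (by fun_prop) _ _ ?_
        simp [hn]
      filter_upwards [ht hs, continuous_fst.tendsto ((x : ℂ), (y : ℂ)) hs,
        continuous_snd.tendsto ((x : ℂ), (y : ℂ))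
          ((isOpen_hStrip r).mem_nhds (ofReal_mem_hStrip hr y))] with p h1 h2 h3 h4
      refine ⟨n, ?_⟩
      have h5 := hsinj h2 h1 (by
        rw [h4]
        have := periodic_int hper (-n) p.2 h3
        rw [← this]; congr 1; push_cast; ring)
      rw [h5]; ring
    · have h1 : Filter.Tendsto (fun p : ℂ × ℂ => G p.1) (nhds ((x : ℂ), (y : ℂ))) (nhds (G x)) :=
        (hcont x).tendsto.comp (continuous_fst.tendsto ((x : ℂ), (y : ℂ)))
      have h2 : Filter.Tendsto (fun p : ℂ × ℂ => G p.2) (nhds ((x : ℂ), (y : ℂ))) (nhds (G y)) :=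
        (hcont y).tendsto.comp (continuous_snd.tendsto ((x : ℂ), (y : ℂ)))
      filter_upwards [(h1.sub h2).eventually_ne (sub_ne_zero.2 hxy)] with p hp h
      exact absurd (sub_eq_zero.2 h) hp
  have hK : IsCompact (((fun x : ℝ => (x : ℂ)) '' Set.Icc 0 ℓ) ×ˢ
      ((fun x : ℝ => (x : ℂ)) '' Set.Icc 0 ℓ)) :=
    (isCompact_Icc.image Complex.continuous_ofReal).prod
      (isCompact_Icc.image Complex.continuous_ofReal)
  have hO : IsOpen {p : ℂ × ℂ | ∀ᶠ p' in nhds p, P p'} := isOpen_setOfPred_eventually_nhds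
  obtain ⟨δ, hδ, hsub⟩ := hK.exists_thickening_subset_open hO (by
    rintro ⟨_, _⟩ ⟨⟨x, _, rfl⟩, ⟨y, _, rfl⟩⟩
    exact hloc x y)
  refine ⟨min δ r, lt_min hδ hr, min_le_right _ _, fun w hw w' hw' h => ?_⟩
  obtain ⟨n, hn⟩ := exists_int_add_mem_Ico hℓ w
  obtain ⟨m, hm⟩ := exists_int_add_mem_Ico hℓ w'
  have hmem : (w + n * ℓ, w' + m * ℓ) ∈ Metric.thickening δ
      (((fun x : ℝ => (x : ℂ)) '' Set.Icc 0 ℓ) ×ˢ ((fun x : ℝ => (x : ℂ)) '' Set.Icc 0 ℓ)) := by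
    refine Metric.mem_thickening_iff.2 ⟨(((w + n * ℓ).re : ℝ), ((w' + m * ℓ).re : ℝ)),
      ⟨⟨_, Set.Ico_subset_Icc_self hn, rfl⟩, ⟨_, Set.Ico_subset_Icc_self hm, rfl⟩⟩, ?_⟩
    rw [Prod.dist_eq, dist_re_eq, dist_re_eq]
    refine max_lt ?_ ?_
    · simpa using lt_of_lt_of_le hw (min_le_left _ _)
    · simpa using lt_of_lt_of_le hw' (min_le_left _ _)
  have hPp : P (w + n * ℓ, w' + m * ℓ) := Filter.Eventually.self_of_nhds (hsub hmem)
  obtain ⟨k, hk⟩ := hPp (by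
    simp only
    rw [periodic_int hper n w (hStrip_mono (min_le_right _ _) hw),
      periodic_int hper m w' (hStrip_mono (min_le_right _ _) hw'), h])
  refine ⟨k + n - m, ?_⟩
  simp only at hk
  push_cast
  linear_combination hk

theorem isPreconnected_subset_or_subset_compl_closure {X : Type*} [TopologicalSpace X]
    {D S : Set X} (hD : IsOpen D) (hS : IsPreconnected S) (h : Disjoint S (frontier D)) :
    S ⊆ D ∨ S ⊆ (closure D)ᶜ := by
  have hu : S ⊆ D ∪ (closure D)ᶜ := fun x hx => by
    by_cases hxc : x ∈ closure D
    · left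
      by_contra hxD
      exact Set.disjoint_left.1 h hx (by rw [hD.frontier_eq]; exact ⟨hxc, hxD⟩)
    · exact Or.inr hxc
  have hdisj : S ∩ (D ∩ (closure D)ᶜ) = ∅ := by
    rw [Set.eq_empty_iff_forall_notMem]
    exact fun x hx => hx.2.2 (subset_closure hx.2.1)
  exact (isPreconnected_iff_subset_of_disjoint.1 hS) D _ hD isClosed_closure.isOpen_compl hu hdisj

theorem exists_collar {D : Set ℂ} (hD : IsOpen D) (hb : Bornology.IsBounded D)
    (q : ℝ → ℂ) {ℓ : ℝ} (hℓ : 0 < ℓ) (hq : AnalyticOnNhd ℝ q Set.univ)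
    (hper : Function.Periodic q ℓ) (hinj : Set.InjOn q (Set.Ico 0 ℓ))
    (hspeed : ∀ s, ‖deriv q s‖ = 1) (hrange : Set.range q = frontier D) :
    ∃ 𝒞 : Collar D, 𝒞.ℓ = ℓ := by
  obtain ⟨M, hM, r, hr, hb'⟩ := exists_norm_iteratedDeriv_le_of_periodic hq hℓ hper
  obtain ⟨G, hG, hGq, -⟩ := exists_strip_extension hq hr hb'
  change DifferentiableOn ℂ G (hStrip r) at hG
  have hGper : ∀ w ∈ hStrip r, G (w + ℓ) = G w := by
    refine hStrip_eqOn (F := fun w => G (w + ℓ)) hr ?_ hG fun x => ?_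
    · exact hG.comp (by fun_prop) fun w hw => add_real_mem_hStrip hw ℓ
    · rw [← Complex.ofReal_add, hGq, hGq, hper x]
  have hGd : ∀ w ∈ hStrip r, DifferentiableAt ℂ G w := fun w hw =>
    hG.differentiableAt ((isOpen_hStrip r).mem_nhds hw)
  have hder : ∀ x : ℝ, ‖deriv G x‖ = 1 := fun x => by
    have h1 := (hGd x (ofReal_mem_hStrip hr x)).hasDerivAt.comp_ofReal
    have h2 : (fun y : ℝ => G y) = q := funext hGq
    rw [h2] at h1
    rw [← h1.deriv, hspeed]
  have hder0 : ∀ x : ℝ, deriv G x ≠ 0 := fun x h => by simpa [h] using hder x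
  obtain ⟨ε₁, hε₁, hε₁r, hbd⟩ := exists_hStrip_deriv_bounds hr hℓ hG hGper hder
  obtain ⟨ε₂, hε₂, hε₂r, hGinj⟩ := exists_hStrip_injective hr hℓ hG hGper hder0 (by
    rwa [show (fun x : ℝ => G x) = q from funext hGq])
  set ε := min ε₁ ε₂
  have hε : 0 < ε := lt_min hε₁ hε₂
  have hsub1 : hStrip ε ⊆ hStrip ε₁ := hStrip_mono (min_le_left _ _)
  have hsub2 : hStrip ε ⊆ hStrip ε₂ := hStrip_mono (min_le_right _ _)
  have hsubr : hStrip ε ⊆ hStrip r := hsub1.trans (hStrip_mono hε₁r)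
  have hoff : ∀ w ∈ hStrip ε, G w ∈ frontier D → w.im = 0 := by
    intro w hw hwD
    rw [← hrange] at hwD
    obtain ⟨x, hx⟩ := hwD
    rw [← hGq] at hx
    obtain ⟨n, hn⟩ := hGinj x (ofReal_mem_hStrip hε₂ x) w (hsub2 hw) hx
    rw [hn]; simp
  have hside : ∀ a b : ℝ, -ε ≤ a → b ≤ ε → 0 ∉ Set.Ioo a b →
      G '' {w | w.im ∈ Set.Ioo a b} ⊆ D ∨ G '' {w | w.im ∈ Set.Ioo a b} ⊆ (closure D)ᶜ := by
    intro a b ha hb hab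
    have hsub : {w : ℂ | w.im ∈ Set.Ioo a b} ⊆ hStrip ε := fun w hw => by
      rw [hStrip_eq]; exact ⟨ha.trans_lt hw.1, hw.2.trans_le hb⟩
    refine isPreconnected_subset_or_subset_compl_closure hD
      (((convex_im_Ioo a b).isPreconnected).image G ((hG.mono (hsub.trans hsubr)).continuousOn)) ?_
    rw [Set.disjoint_left]
    rintro _ ⟨w, hw, rfl⟩ hwD
    rw [Set.mem_ofPred_eq, hoff w (hsub hw) hwD] at hw
    exact hab hw
  have hup := hside 0 ε (by linarith) le_rfl (by simp)
  have hlow := hside (-ε) 0 le_rfl hε.le (by simp)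
  have hreal : ∀ x : ℝ, G x ∈ frontier D := fun x => by
    rw [hGq, ← hrange]; exact Set.mem_range_self x
  have hsurj : ∀ z ∈ frontier D, ∃ x : ℝ, G x = z := fun z hz => by
    rw [← hrange] at hz
    obtain ⟨x, hx⟩ := hz
    exact ⟨x, by rw [hGq, hx]⟩
  have hopen : ∀ w ∈ hStrip ε, G '' hStrip ε ∈ nhds (G w) := by
    intro w hw
    have hd : deriv G w ≠ 0 := fun h => by
      have := (hbd w (hsub1 hw)).1
      rw [h, norm_zero] at this
      norm_num at this
    have h1 := (hG.analyticAt
      ((isOpen_hStrip r).mem_nhds (hsubr hw))).hasStrictDerivAt.map_nhds_eq hd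
    rw [← h1]
    exact Filter.image_mem_map ((isOpen_hStrip ε).mem_nhds hw)
  have hsplit : ∀ w ∈ hStrip ε, w.im = 0 ∨ w.im ∈ Set.Ioo 0 ε ∨ w.im ∈ Set.Ioo (-ε) 0 := by
    intro w hw
    rw [hStrip_eq] at hw
    rcases lt_trichotomy w.im 0 with h | h | h
    · exact Or.inr (Or.inr ⟨hw.1, h⟩)
    · exact Or.inl h
    · exact Or.inr (Or.inl ⟨h, hw.2⟩)
  have hreal' : ∀ w : ℂ, w.im = 0 → G w ∈ frontier D := fun w hw => by
    have : w = (w.re : ℂ) := by apply Complex.ext <;> simp [hw]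
    rw [this]; exact hreal _
  have hsides : (G '' {w | w.im ∈ Set.Ioo 0 ε} ⊆ D ∧
      G '' {w | w.im ∈ Set.Ioo (-ε) 0} ⊆ (closure D)ᶜ) ∨
      (G '' {w | w.im ∈ Set.Ioo 0 ε} ⊆ (closure D)ᶜ ∧ G '' {w | w.im ∈ Set.Ioo (-ε) 0} ⊆ D) := by
    rcases hup with hu | hu <;> rcases hlow with hl | hl
    · exfalso
      have hsubD : G '' hStrip ε ⊆ closure D := by
        rintro _ ⟨w, hw, rfl⟩
        rcases hsplit w hw with h | h | h
        · exact frontier_subset_closure (hreal' w h)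
        · exact subset_closure (hu ⟨w, h, rfl⟩)
        · exact subset_closure (hl ⟨w, h, rfl⟩)
      have hcl : IsClopen (closure D) := by
        refine ⟨isClosed_closure, isOpen_iff_mem_nhds.2 fun z hz => ?_⟩
        by_cases hzD : z ∈ D
        · exact Filter.mem_of_superset (hD.mem_nhds hzD) subset_closure
        · obtain ⟨x, rfl⟩ := hsurj z (by rw [hD.frontier_eq]; exact ⟨hz, hzD⟩)
          exact Filter.mem_of_superset (hopen x (ofReal_mem_hStrip hε x)) hsubD
      rcases isClopen_iff.1 hcl with h | h
      · have := frontier_subset_closure (hreal 0)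
        rw [h] at this
        exact this
      · have hbc := hb.closure
        rw [h] at hbc
        exact NormedSpace.unbounded_univ ℝ ℂ hbc
    · exact Or.inl ⟨hu, hl⟩
    · exact Or.inr ⟨hu, hl⟩
    · exfalso
      have h0 := frontier_subset_closure (hreal 0)
      obtain ⟨_, ⟨w, hw, rfl⟩, hwD⟩ :=
        mem_closure_iff_nhds.1 h0 _ (hopen (0 : ℝ) (ofReal_mem_hStrip hε 0))
      rcases hsplit w hw with h | h | h
      · have := hreal' w h
        rw [hD.frontier_eq] at this
        exact this.2 hwD
      · exact hu ⟨w, h, rfl⟩ (subset_closure hwD)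
      · exact hl ⟨w, h, rfl⟩ (subset_closure hwD)
  rcases hsides with ⟨hu, hl⟩ | ⟨hu, hl⟩
  · exact ⟨⟨ε, ℓ, G, hε, hℓ, hG.mono hsubr, fun w hw => hGper w (hsubr hw),
      fun w hw w' hw' => hGinj w (hsub2 hw) w' (hsub2 hw'), fun w hw => (hbd w (hsub1 hw)).1,
      fun w hw => (hbd w (hsub1 hw)).2, hreal, hsurj, fun w hw => hu ⟨w, hw, rfl⟩,
      fun w hw => hl ⟨w, hw, rfl⟩⟩, rfl⟩
  · have hneg : ∀ w ∈ hStrip ε, -w ∈ hStrip ε := fun w hw => by simpa [hStrip] using hw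
    have hdn : ∀ w, ‖deriv (fun w => G (-w)) w‖ = ‖deriv G (-w)‖ := fun w => by
      rw [deriv_comp_neg, norm_neg]
    refine ⟨⟨ε, ℓ, fun w => G (-w), hε, hℓ, ?_, fun w hw => ?_, fun w hw w' hw' h => ?_,
      fun w hw => ?_, fun w hw => ?_, fun x => ?_, fun z hz => ?_, fun w hw => ?_,
      fun w hw => ?_⟩, rfl⟩
    · exact (hG.mono hsubr).comp (by fun_prop) fun w hw => hneg w hw
    · have h1 : -(w + (ℓ : ℂ)) ∈ hStrip r := by
        simpa [hStrip] using hsubr hw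
      have := hGper _ h1
      rw [← this]
      congr 1; ring
    · obtain ⟨n, hn⟩ := hGinj _ (hsub2 (hneg w hw)) _ (hsub2 (hneg w' hw')) h
      refine ⟨-n, ?_⟩
      push_cast
      linear_combination -hn
    · rw [hdn]; exact (hbd _ (hsub1 (hneg w hw))).1
    · rw [hdn]; exact (hbd _ (hsub1 (hneg w hw))).2
    · have := hreal (-x)
      push_cast at this
      exact this
    · obtain ⟨x, hx⟩ := hsurj z hz
      exact ⟨-x, by simpa using hx⟩
    · refine hl ⟨-w, ?_, rfl⟩
      have h1 := hw.1
      have h2 := hw.2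
      simp only [Set.mem_ofPred_eq, Complex.neg_im, Set.mem_Ioo]
      constructor <;> linarith
    · refine hu ⟨-w, ?_, rfl⟩
      have h1 := hw.1
      have h2 := hw.2
      simp only [Set.mem_ofPred_eq, Complex.neg_im, Set.mem_Ioo]
      constructor <;> linarith

/-- The closed rectangle `[0, ℓ] × [0, β]`. -/
abbrev rect (ℓ β : ℝ) : Set (ℝ × ℝ) := Set.Icc (0, 0) (ℓ, β)

/-- `g` is differentiable at `p` with partial derivatives `a` and `b`. -/
def HasPartials (g : ℝ × ℝ → ℝ) (a b : ℝ) (p : ℝ × ℝ) : Prop :=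
  HasFDerivAt g (a • ContinuousLinearMap.fst ℝ ℝ ℝ + b • ContinuousLinearMap.snd ℝ ℝ ℝ) p

section HasPartials

variable {g h : ℝ × ℝ → ℝ} {a b c d : ℝ} {p : ℝ × ℝ}

theorem HasPartials.mul (hg : HasPartials g a b p) (hh : HasPartials h c d p) :
    HasPartials (fun p => g p * h p) (a * h p + g p * c) (b * h p + g p * d) p := by
  refine (HasFDerivAt.mul hg hh).congr_fderiv ?_
  ext <;> simp <;> ring

theorem hasPartials_weight (β : ℝ) (k : ℕ) (p : ℝ × ℝ) :
    HasPartials (fun p => (β - p.2) ^ (k + 1)) 0 (-((k + 1 : ℕ) * (β - p.2) ^ k)) p := by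
  have h := ((hasFDerivAt_snd (𝕜 := ℝ) (p := p)).const_sub β).pow (k + 1)
  refine h.congr_fderiv ?_
  ext <;> simp

theorem integral_divergence_rectangle {ℓ β : ℝ} (hℓ : 0 ≤ ℓ) (hβ : 0 ≤ β)
    {f fs ft g gs gt : ℝ × ℝ → ℝ}
    (hf : ∀ p ∈ rect ℓ β, HasPartials f (fs p) (ft p) p)
    (hg : ∀ p ∈ rect ℓ β, HasPartials g (gs p) (gt p) p)
    (hfs : ContinuousOn fs (rect ℓ β))
    (hgt : ContinuousOn gt (rect ℓ β))
    (hper : ∀ t, f (ℓ, t) = f (0, t)) (htop : ∀ s, g (s, β) = 0) :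
    ∫ p in rect ℓ β, (fs p + gt p) = -∫ s in (0 : ℝ)..ℓ, g (s, 0) := by
  have hsub : Set.Ioo 0 ℓ ×ˢ Set.Ioo 0 β ⊆ rect ℓ β := fun p hp =>
    ⟨⟨hp.1.1.le, hp.2.1.le⟩, ⟨hp.1.2.le, hp.2.2.le⟩⟩
  have h := integral_divergence_prod_Icc_of_hasFDerivAt_of_le f g
    (fun p => fs p • ContinuousLinearMap.fst ℝ ℝ ℝ + ft p • ContinuousLinearMap.snd ℝ ℝ ℝ)
    (fun p => gs p • ContinuousLinearMap.fst ℝ ℝ ℝ + gt p • ContinuousLinearMap.snd ℝ ℝ ℝ)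
    (0, 0) (ℓ, β) ⟨hℓ, hβ⟩ (fun p hp => (hf p hp).continuousAt.continuousWithinAt)
    (fun p hp => (hg p hp).continuousAt.continuousWithinAt)
    (fun p hp => hf p (hsub hp)) (fun p hp => hg p (hsub hp)) (by
      have h := (hfs.add hgt).integrableOn_compact (μ := volume) isCompact_Icc
      simpa [Pi.add_def] using h)
  simp only [add_apply, smul_apply,
    ContinuousLinearMap.coe_fst', ContinuousLinearMap.coe_snd', smul_eq_mul, mul_one, mul_zero,
    add_zero, zero_add, htop, hper, intervalIntegral.integral_zero] at h
  rw [h]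
  ring

end HasPartials

/-- The Leibniz sum `∑ (n choose j) V_j w_{n-j}`. -/
def leibnizSum (V w : ℕ → ℝ × ℝ → ℝ) (n : ℕ) (p : ℝ × ℝ) : ℝ :=
  ∑ j ∈ Finset.range (n + 1), (n.choose j : ℝ) * V j p * w (n - j) p

/-- The tangential derivatives `w n` of a solution of `Δv = -lam² V v` on a periodic rectangle,
together with their normal derivatives `wt n`, where `v` vanishes on the bottom side and the
coefficient `V` has analytic tangential derivatives. -/
structure TangentialChain (ℓ β lam C₀ ρ : ℝ) (w wt V : ℕ → ℝ × ℝ → ℝ) : Prop where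
  hasPartials : ∀ n, ∀ p ∈ rect ℓ β,
    HasPartials (w n) (w (n + 1) p) (wt n p) p
  hasPartials' : ∀ n, ∀ p ∈ rect ℓ β,
    HasPartials (wt n) (wt (n + 1) p) (-w (n + 2) p - lam ^ 2 * leibnizSum V w n p) p
  continuousOn_V : ∀ n, ContinuousOn (V n) (rect ℓ β)
  abs_V_le : ∀ n, ∀ p ∈ rect ℓ β, |V n p| ≤ C₀ * n.factorial / ρ ^ n
  periodic : ∀ n t, w n (ℓ, t) = w n (0, t)
  dirichlet : ∀ n s, w n (s, 0) = 0

namespace TangentialChain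

variable {ℓ β lam C₀ ρ : ℝ} {w wt V : ℕ → ℝ × ℝ → ℝ}

theorem continuousOn (h : TangentialChain ℓ β lam C₀ ρ w wt V) (n : ℕ) :
    ContinuousOn (w n) (rect ℓ β) := fun p hp => (h.hasPartials n p hp).continuousAt.continuousWithinAt

theorem continuousOn' (h : TangentialChain ℓ β lam C₀ ρ w wt V) (n : ℕ) :
    ContinuousOn (wt n) (rect ℓ β) :=
  fun p hp => (h.hasPartials' n p hp).continuousAt.continuousWithinAt

theorem continuousOn_leibnizSum (h : TangentialChain ℓ β lam C₀ ρ w wt V) (n : ℕ) :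
    ContinuousOn (leibnizSum V w n) (rect ℓ β) := by
  unfold leibnizSum
  exact continuousOn_finsetSum _ fun j _ =>
    (continuousOn_const.mul (h.continuousOn_V j)).mul (h.continuousOn _)

/-- The weighted `L²` energy of the `n`-th tangential derivative. -/
def energy (ℓ β : ℝ) (w : ℕ → ℝ × ℝ → ℝ) (n : ℕ) : ℝ :=
  ∫ p in rect ℓ β, (β - p.2) ^ (2 * n) * w n p ^ 2

/-- The weighted `L²` energy of the gradient of the `n`-th tangential derivative. -/
def gradEnergy (ℓ β : ℝ) (w wt : ℕ → ℝ × ℝ → ℝ) (n : ℕ) : ℝ :=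
  ∫ p in rect ℓ β, (β - p.2) ^ (2 * n + 2) * (w (n + 1) p ^ 2 + wt n p ^ 2)

theorem energy_nonneg (n : ℕ) : 0 ≤ energy ℓ β w n :=
  integral_nonneg fun p => by rw [pow_mul]; positivity

theorem gradEnergy_eq (h : TangentialChain ℓ β lam C₀ ρ w wt V) (hℓ : 0 ≤ ℓ) (hβ : 0 ≤ β)
    (n : ℕ) : ∫ p in rect ℓ β, ((β - p.2) ^ (2 * n + 2) * (w (n + 1) p ^ 2 + wt n p ^ 2) -
      lam ^ 2 * ((β - p.2) ^ (2 * n + 2) * (w n p * leibnizSum V w n p)) -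
      (2 * n + 2) * ((β - p.2) ^ (2 * n + 1) * (w n p * wt n p))) = 0 := by
  have c1 := h.continuousOn n
  have c2 := h.continuousOn (n + 1)
  have c3 := h.continuousOn (n + 2)
  have c4 := h.continuousOn' n
  have c5 := h.continuousOn_leibnizSum n
  have hd := integral_divergence_rectangle hℓ hβ
    (f := fun p => (β - p.2) ^ (2 * n + 1 + 1) * (w n p * w (n + 1) p))
    (g := fun p => (β - p.2) ^ (2 * n + 1 + 1) * (w n p * wt n p))
    (fun p hp => (hasPartials_weight β (2 * n + 1) p).mul
      ((h.hasPartials n p hp).mul (h.hasPartials (n + 1) p hp)))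
    (fun p hp => (hasPartials_weight β (2 * n + 1) p).mul
      ((h.hasPartials n p hp).mul (h.hasPartials' n p hp)))
    (by fun_prop) (by fun_prop)
    (fun t => by simp only [h.periodic]) (fun s => by simp)
  simp only [h.dirichlet, zero_mul, mul_zero, intervalIntegral.integral_zero, neg_zero] at hd
  refine Eq.trans (integral_congr_ae (Filter.Eventually.of_forall fun p => ?_)) hd
  push_cast
  ring

theorem gradEnergy_le (h : TangentialChain ℓ β lam C₀ ρ w wt V) (hℓ : 0 ≤ ℓ) (hβ : 0 ≤ β)
    (n : ℕ) : gradEnergy ℓ β w wt n ≤ 4 * (n + 1) ^ 2 * energy ℓ β w n +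
      2 * lam ^ 2 * ∫ p in rect ℓ β, (β - p.2) ^ (2 * n + 2) * (|w n p| * |leibnizSum V w n p|) := by
  have c1 := h.continuousOn n
  have c2 := h.continuousOn (n + 1)
  have c4 := h.continuousOn' n
  have c5 := h.continuousOn_leibnizSum n
  have heq := h.gradEnergy_eq hℓ hβ n
  have hint : ∀ {F : ℝ × ℝ → ℝ}, ContinuousOn F (rect ℓ β) → IntegrableOn F (rect ℓ β) := fun hF =>
    hF.integrableOn_compact isCompact_Icc
  have key : ∫ p in rect ℓ β, ((β - p.2) ^ (2 * n + 2) * (w (n + 1) p ^ 2 + wt n p ^ 2) -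
      2 * ((β - p.2) ^ (2 * n + 2) * (w (n + 1) p ^ 2 + wt n p ^ 2) -
      lam ^ 2 * ((β - p.2) ^ (2 * n + 2) * (w n p * leibnizSum V w n p)) -
      (2 * n + 2) * ((β - p.2) ^ (2 * n + 1) * (w n p * wt n p)))) ≤
      ∫ p in rect ℓ β, (4 * (n + 1) ^ 2 * ((β - p.2) ^ (2 * n) * w n p ^ 2) +
      2 * lam ^ 2 * ((β - p.2) ^ (2 * n + 2) * (|w n p| * |leibnizSum V w n p|))) := by
    refine setIntegral_mono_on (hint (by fun_prop)) (hint (by fun_prop)) measurableSet_Icc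
      fun p hp => ?_
    set σ := β - p.2
    have hσ : 0 ≤ σ := sub_nonneg.2 hp.2.2
    have e1 : σ ^ (2 * n + 2) = (σ ^ n * σ) ^ 2 := by ring
    have e2 : σ ^ (2 * n + 1) = σ ^ n * (σ ^ n * σ) := by ring
    have e3 : σ ^ (2 * n) = (σ ^ n) ^ 2 := by ring
    have habs : w n p * leibnizSum V w n p ≤ |w n p| * |leibnizSum V w n p| := by
      rw [← abs_mul]; exact le_abs_self _
    have h1 := mul_le_mul_of_nonneg_left habs (by positivity : 0 ≤ 2 * lam ^ 2 * (σ ^ n * σ) ^ 2)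
    rw [e1, e2, e3]
    nlinarith [sq_nonneg (σ ^ n * σ * wt n p - 2 * (n + 1) * (σ ^ n * w n p)),
      sq_nonneg (σ ^ n * σ * w (n + 1) p)]
  rw [integral_sub (hint (by fun_prop)) (hint (by fun_prop)), integral_const_mul, heq,
    integral_add (hint (by fun_prop)) (hint (by fun_prop)), integral_const_mul,
    integral_const_mul] at key
  rw [gradEnergy, energy]
  linarith

theorem energy_succ_le (h : TangentialChain ℓ β lam C₀ ρ w wt V) (n : ℕ) :
    energy ℓ β w (n + 1) ≤ gradEnergy ℓ β w wt n := by
  have c2 := h.continuousOn (n + 1)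
  have c4 := h.continuousOn' n
  have hint : ∀ {F : ℝ × ℝ → ℝ}, ContinuousOn F (rect ℓ β) → IntegrableOn F (rect ℓ β) := fun hF =>
    hF.integrableOn_compact isCompact_Icc
  refine setIntegral_mono_on (hint (by fun_prop)) (hint (by fun_prop)) measurableSet_Icc
    fun p hp => ?_
  have hσ : 0 ≤ β - p.2 := sub_nonneg.2 hp.2.2
  rw [show 2 * (n + 1) = 2 * n + 2 by ring]
  gcongr
  nlinarith [sq_nonneg (wt n p)]

theorem integral_mul_le (h : TangentialChain ℓ β lam C₀ ρ w wt V) {X μ : ℝ} (hμ : 0 < μ) {i j : ℕ}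
    (hi : energy ℓ β w i ≤ X * μ ^ (2 * i)) (hj : energy ℓ β w j ≤ X * μ ^ (2 * j)) :
    ∫ p in rect ℓ β, (β - p.2) ^ (i + j) * (|w i p| * |w j p|) ≤ X * μ ^ (i + j) := by
  have c1 := h.continuousOn i
  have c2 := h.continuousOn j
  have hint : ∀ {F : ℝ × ℝ → ℝ}, ContinuousOn F (rect ℓ β) → IntegrableOn F (rect ℓ β) := fun hF =>
    hF.integrableOn_compact isCompact_Icc
  have key : ∫ p in rect ℓ β, (β - p.2) ^ (i + j) * (|w i p| * |w j p|) ≤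
      ∫ p in rect ℓ β, (μ ^ j / μ ^ i / 2 * ((β - p.2) ^ (2 * i) * w i p ^ 2) +
        μ ^ i / μ ^ j / 2 * ((β - p.2) ^ (2 * j) * w j p ^ 2)) := by
    refine setIntegral_mono_on (hint (by fun_prop)) (hint (by fun_prop)) measurableSet_Icc
      fun p hp => ?_
    set σ := β - p.2
    have hσ : 0 ≤ σ := sub_nonneg.2 hp.2.2
    have e1 : σ ^ (2 * i) * w i p ^ 2 = (σ ^ i * |w i p|) ^ 2 := by rw [mul_pow, sq_abs]; ring
    have e2 : σ ^ (2 * j) * w j p ^ 2 = (σ ^ j * |w j p|) ^ 2 := by rw [mul_pow, sq_abs]; ring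
    have e3 : σ ^ (i + j) * (|w i p| * |w j p|) = (σ ^ i * |w i p|) * (σ ^ j * |w j p|) := by
      ring
    rw [e1, e2, e3]
    set A := σ ^ i * |w i p|
    set B := σ ^ j * |w j p|
    have hA : 0 < μ ^ i := by positivity
    have hB : 0 < μ ^ j := by positivity
    set a := μ ^ i
    set b := μ ^ j
    have e : b / a / 2 * A ^ 2 + a / b / 2 * B ^ 2 - A * B = (b * A - a * B) ^ 2 / (2 * a * b) := by
      field_simp
      ring
    have : 0 ≤ (b * A - a * B) ^ 2 / (2 * a * b) := by positivity
    linarith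
  rw [integral_add (hint (by fun_prop)) (hint (by fun_prop)), integral_const_mul,
    integral_const_mul] at key
  refine key.trans ?_
  rw [energy] at hi hj
  calc _ ≤ μ ^ j / μ ^ i / 2 * (X * μ ^ (2 * i)) + μ ^ i / μ ^ j / 2 * (X * μ ^ (2 * j)) := by
        gcongr
    _ = X * μ ^ (i + j) := by
        rw [pow_add, mul_comm 2 i, mul_comm 2 j, pow_mul, pow_mul]
        field_simp
        ring

end TangentialChain

namespace TangentialChain

variable {ℓ β lam C₀ ρ X μ : ℝ} {w wt V : ℕ → ℝ × ℝ → ℝ} {n : ℕ}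

theorem choose_mul_abs_le (h : TangentialChain ℓ β lam C₀ ρ w wt V) (hC : 0 ≤ C₀) (hρ : 0 < ρ)
    (hn : 2 * n ≤ ρ * μ) (j : ℕ) {p : ℝ × ℝ} (hp : p ∈ rect ℓ β) :
    (n.choose j : ℝ) * |V j p| ≤ C₀ * (μ / 2) ^ j := by
  have h1 : (n.choose j : ℝ) * j.factorial ≤ (n : ℝ) ^ j := by
    have := Nat.descFactorial_le_pow n j
    rw [Nat.descFactorial_eq_factorial_mul_choose, mul_comm] at this
    exact_mod_cast this
  have h2 : (n : ℝ) / ρ ≤ μ / 2 := by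
    rw [div_le_div_iff₀ hρ two_pos]; linarith
  calc (n.choose j : ℝ) * |V j p| ≤ n.choose j * (C₀ * j.factorial / ρ ^ j) := by
        gcongr; exact h.abs_V_le j p hp
    _ = C₀ * (n.choose j * j.factorial) / ρ ^ j := by ring
    _ ≤ C₀ * n ^ j / ρ ^ j := by gcongr
    _ = C₀ * (n / ρ) ^ j := by rw [div_pow]; ring
    _ ≤ C₀ * (μ / 2) ^ j := by gcongr

theorem abs_leibnizSum_le (h : TangentialChain ℓ β lam C₀ ρ w wt V) (hC : 0 ≤ C₀) (hρ : 0 < ρ)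
    (hn : 2 * n ≤ ρ * μ) {p : ℝ × ℝ} (hp : p ∈ rect ℓ β) :
    |leibnizSum V w n p| ≤
      ∑ j ∈ Finset.range (n + 1), C₀ * (μ / 2) ^ j * |w (n - j) p| := by
  refine (Finset.abs_sum_le_sum_abs _ _).trans (Finset.sum_le_sum fun j _ => ?_)
  rw [abs_mul, abs_mul, Nat.abs_cast]
  exact mul_le_mul_of_nonneg_right (h.choose_mul_abs_le hC hρ hn j hp) (abs_nonneg _)

theorem sum_half_pow_le (n : ℕ) : ∑ j ∈ Finset.range n, (1 / 2 : ℝ) ^ j ≤ 2 := by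
  refine (Summable.sum_le_tsum _ (fun j _ => by positivity) summable_geometric_two).trans ?_
  rw [tsum_geometric_two]

theorem integral_mul_leibnizSum_le (h : TangentialChain ℓ β lam C₀ ρ w wt V) (hβ : β ≤ 1)
    (hC : 0 ≤ C₀) (hρ : 0 < ρ) (hμ : 0 < μ) (hn : 2 * n ≤ ρ * μ)
    (hE : ∀ i ≤ n, energy ℓ β w i ≤ X * μ ^ (2 * i)) :
    ∫ p in rect ℓ β, (β - p.2) ^ (2 * n + 2) * (|w n p| * |leibnizSum V w n p|) ≤
      2 * C₀ * X * μ ^ (2 * n) := by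
  have hX : 0 ≤ X := (energy_nonneg 0).trans (by simpa using hE 0 (Nat.zero_le _))
  have c1 := h.continuousOn
  have c5 := h.continuousOn_leibnizSum n
  have hint : ∀ {F : ℝ × ℝ → ℝ}, ContinuousOn F (rect ℓ β) → IntegrableOn F (rect ℓ β) :=
    fun hF => hF.integrableOn_compact isCompact_Icc
  have hcj : ∀ j, ContinuousOn (fun p : ℝ × ℝ => C₀ * (μ / 2) ^ j *
      ((β - p.2) ^ (n + (n - j)) * (|w n p| * |w (n - j) p|))) (rect ℓ β) := fun j => by
    have := c1 n
    have := c1 (n - j)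
    fun_prop
  have key : ∫ p in rect ℓ β, (β - p.2) ^ (2 * n + 2) * (|w n p| * |leibnizSum V w n p|) ≤
      ∫ p in rect ℓ β, ∑ j ∈ Finset.range (n + 1), C₀ * (μ / 2) ^ j *
        ((β - p.2) ^ (n + (n - j)) * (|w n p| * |w (n - j) p|)) := by
    have := c1 n
    refine setIntegral_mono_on (hint (by fun_prop))
      (hint (continuousOn_finsetSum _ fun j _ => hcj j)) measurableSet_Icc fun p hp => ?_
    have hσ : 0 ≤ β - p.2 := sub_nonneg.2 hp.2.2
    have hσ1 : β - p.2 ≤ 1 := by linarith [hp.1.2]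
    set σ := β - p.2
    calc σ ^ (2 * n + 2) * (|w n p| * |leibnizSum V w n p|)
        ≤ σ ^ (2 * n + 2) * (|w n p| *
          ∑ j ∈ Finset.range (n + 1), C₀ * (μ / 2) ^ j * |w (n - j) p|) := by
          gcongr; exact h.abs_leibnizSum_le hC hρ hn hp
      _ = ∑ j ∈ Finset.range (n + 1), C₀ * (μ / 2) ^ j *
          (σ ^ (2 * n + 2) * (|w n p| * |w (n - j) p|)) := by
          rw [Finset.mul_sum, Finset.mul_sum]
          exact Finset.sum_congr rfl fun j _ => by ring
      _ ≤ _ := by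
          refine Finset.sum_le_sum fun j _ => ?_
          have : σ ^ (2 * n + 2) ≤ σ ^ (n + (n - j)) :=
            pow_le_pow_of_le_one hσ hσ1 (by omega)
          gcongr
  refine key.trans ?_
  rw [integral_finsetSum _ fun j _ => hint (hcj j)]
  simp only [integral_const_mul]
  calc ∑ j ∈ Finset.range (n + 1), C₀ * (μ / 2) ^ j *
        ∫ p in rect ℓ β, (β - p.2) ^ (n + (n - j)) * (|w n p| * |w (n - j) p|)
      ≤ ∑ j ∈ Finset.range (n + 1), C₀ * (μ / 2) ^ j * (X * μ ^ (n + (n - j))) := by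
        refine Finset.sum_le_sum fun j _ => ?_
        gcongr
        exact h.integral_mul_le hμ (hE n le_rfl) (hE _ (Nat.sub_le _ _))
    _ = C₀ * X * μ ^ (2 * n) * ∑ j ∈ Finset.range (n + 1), (1 / 2 : ℝ) ^ j := by
        rw [Finset.mul_sum]
        refine Finset.sum_congr rfl fun j hj => ?_
        have e : μ ^ (2 * n) = μ ^ j * μ ^ (n + (n - j)) := by
          rw [← pow_add]
          congr 1
          have := Finset.mem_range.1 hj
          omega
        rw [e, div_pow, div_pow, one_pow]
        ring
    _ ≤ C₀ * X * μ ^ (2 * n) * 2 := by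
        gcongr; exact sum_half_pow_le _
    _ = _ := by ring

theorem integral_leibnizSum_sq_le (h : TangentialChain ℓ β lam C₀ ρ w wt V) (hβ : β ≤ 1)
    (hC : 0 ≤ C₀) (hρ : 0 < ρ) (hμ : 0 < μ) (hn : 2 * n ≤ ρ * μ)
    (hE : ∀ i ≤ n, energy ℓ β w i ≤ X * μ ^ (2 * i)) :
    ∫ p in rect ℓ β, (β - p.2) ^ (2 * n) * leibnizSum V w n p ^ 2 ≤
      4 * C₀ ^ 2 * X * μ ^ (2 * n) := by
  have hX : 0 ≤ X := (energy_nonneg 0).trans (by simpa using hE 0 (Nat.zero_le _))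
  have c1 := h.continuousOn
  have c5 := h.continuousOn_leibnizSum n
  have hint : ∀ {F : ℝ × ℝ → ℝ}, ContinuousOn F (rect ℓ β) → IntegrableOn F (rect ℓ β) :=
    fun hF => hF.integrableOn_compact isCompact_Icc
  have hcj : ∀ j k, ContinuousOn (fun p : ℝ × ℝ => C₀ * (μ / 2) ^ j * (C₀ * (μ / 2) ^ k) *
      ((β - p.2) ^ ((n - j) + (n - k)) * (|w (n - j) p| * |w (n - k) p|))) (rect ℓ β) :=
    fun j k => by
      have := c1 (n - j)
      have := c1 (n - k)
      fun_prop
  have key : ∫ p in rect ℓ β, (β - p.2) ^ (2 * n) * leibnizSum V w n p ^ 2 ≤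
      ∫ p in rect ℓ β, ∑ j ∈ Finset.range (n + 1), ∑ k ∈ Finset.range (n + 1),
        C₀ * (μ / 2) ^ j * (C₀ * (μ / 2) ^ k) *
        ((β - p.2) ^ ((n - j) + (n - k)) * (|w (n - j) p| * |w (n - k) p|)) := by
    refine setIntegral_mono_on (hint (by fun_prop))
      (hint (continuousOn_finsetSum _ fun j _ => continuousOn_finsetSum _ fun k _ => hcj j k))
      measurableSet_Icc fun p hp => ?_
    have hσ : 0 ≤ β - p.2 := sub_nonneg.2 hp.2.2
    have hσ1 : β - p.2 ≤ 1 := by linarith [hp.1.2]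
    set σ := β - p.2
    calc σ ^ (2 * n) * leibnizSum V w n p ^ 2
        = σ ^ (2 * n) * (|leibnizSum V w n p| * |leibnizSum V w n p|) := by
          rw [← sq, sq_abs]
      _ ≤ σ ^ (2 * n) * ((∑ j ∈ Finset.range (n + 1), C₀ * (μ / 2) ^ j * |w (n - j) p|) *
          ∑ j ∈ Finset.range (n + 1), C₀ * (μ / 2) ^ j * |w (n - j) p|) := by
          have := h.abs_leibnizSum_le hC hρ hn hp
          gcongr
      _ = ∑ j ∈ Finset.range (n + 1), ∑ k ∈ Finset.range (n + 1),
          C₀ * (μ / 2) ^ j * (C₀ * (μ / 2) ^ k) *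
            (σ ^ (2 * n) * (|w (n - j) p| * |w (n - k) p|)) := by
          rw [Finset.sum_mul_sum, Finset.mul_sum]
          refine Finset.sum_congr rfl fun j _ => ?_
          rw [Finset.mul_sum]
          exact Finset.sum_congr rfl fun k _ => by ring
      _ ≤ _ := by
          refine Finset.sum_le_sum fun j _ => Finset.sum_le_sum fun k _ => ?_
          have : σ ^ (2 * n) ≤ σ ^ ((n - j) + (n - k)) :=
            pow_le_pow_of_le_one hσ hσ1 (by omega)
          gcongr
  refine key.trans ?_
  rw [integral_finsetSum _ fun j _ => hint (continuousOn_finsetSum _ fun k _ => hcj j k)]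
  simp only [integral_finsetSum _ fun k _ => hint (hcj _ k), integral_const_mul]
  calc ∑ j ∈ Finset.range (n + 1), ∑ k ∈ Finset.range (n + 1),
        C₀ * (μ / 2) ^ j * (C₀ * (μ / 2) ^ k) *
        ∫ p in rect ℓ β, (β - p.2) ^ ((n - j) + (n - k)) * (|w (n - j) p| * |w (n - k) p|)
      ≤ ∑ j ∈ Finset.range (n + 1), ∑ k ∈ Finset.range (n + 1),
        C₀ * (μ / 2) ^ j * (C₀ * (μ / 2) ^ k) * (X * μ ^ ((n - j) + (n - k))) := by
        refine Finset.sum_le_sum fun j _ => Finset.sum_le_sum fun k _ => ?_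
        gcongr
        exact h.integral_mul_le hμ (hE _ (Nat.sub_le _ _)) (hE _ (Nat.sub_le _ _))
    _ = C₀ ^ 2 * X * μ ^ (2 * n) * ((∑ j ∈ Finset.range (n + 1), (1 / 2 : ℝ) ^ j) *
          ∑ k ∈ Finset.range (n + 1), (1 / 2 : ℝ) ^ k) := by
        rw [Finset.sum_mul_sum, Finset.mul_sum]
        refine Finset.sum_congr rfl fun j hj => ?_
        rw [Finset.mul_sum]
        refine Finset.sum_congr rfl fun k hk => ?_
        have e : μ ^ (2 * n) = μ ^ j * μ ^ k * μ ^ ((n - j) + (n - k)) := by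
          rw [← pow_add, ← pow_add]
          congr 1
          have := Finset.mem_range.1 hj
          have := Finset.mem_range.1 hk
          omega
        rw [e, div_pow, div_pow, div_pow, div_pow, one_pow, one_pow]
        ring
    _ ≤ C₀ ^ 2 * X * μ ^ (2 * n) * (2 * 2) := by
        have := sum_half_pow_le (n + 1)
        have h0 : 0 ≤ ∑ j ∈ Finset.range (n + 1), (1 / 2 : ℝ) ^ j :=
          Finset.sum_nonneg fun j _ => by positivity
        gcongr
    _ = _ := by ring

theorem gradEnergy_le_of_energy_le (h : TangentialChain ℓ β lam C₀ ρ w wt V) (hℓ : 0 ≤ ℓ)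
    (hβ0 : 0 ≤ β) (hβ : β ≤ 1) (hC : 0 ≤ C₀) (hρ : 0 < ρ) (hμ : 0 < μ) (hn : 2 * n ≤ ρ * μ)
    (hμ2 : 4 * C₀ * lam ^ 2 + 4 * (n + 1) ^ 2 ≤ μ ^ 2)
    (hE : ∀ i ≤ n, energy ℓ β w i ≤ X * μ ^ (2 * i)) :
    gradEnergy ℓ β w wt n ≤ X * μ ^ (2 * (n + 1)) := by
  have hX : 0 ≤ X := (energy_nonneg 0).trans (by simpa using hE 0 (Nat.zero_le _))
  have h1 := h.gradEnergy_le hℓ hβ0 n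
  have h2 := h.integral_mul_leibnizSum_le hβ hC hρ hμ hn hE
  calc gradEnergy ℓ β w wt n ≤ 4 * (n + 1) ^ 2 * (X * μ ^ (2 * n)) +
        2 * lam ^ 2 * (2 * C₀ * X * μ ^ (2 * n)) := by
        refine h1.trans ?_
        gcongr
        exact hE n le_rfl
    _ = X * μ ^ (2 * n) * (4 * C₀ * lam ^ 2 + 4 * (n + 1) ^ 2) := by ring
    _ ≤ X * μ ^ (2 * n) * μ ^ 2 := by gcongr
    _ = _ := by ring

theorem energy_le (h : TangentialChain ℓ β lam C₀ ρ w wt V) (hℓ : 0 ≤ ℓ)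
    (hβ0 : 0 ≤ β) (hβ : β ≤ 1) (hC : 0 ≤ C₀) (hρ : 0 < ρ) (hμ : 0 < μ) {N : ℕ}
    (hN : 2 * N ≤ ρ * μ) (hμ2 : 4 * C₀ * lam ^ 2 + 4 * N ^ 2 ≤ μ ^ 2) :
    ∀ n ≤ N, energy ℓ β w n ≤ energy ℓ β w 0 * μ ^ (2 * n) := by
  intro n
  induction n using Nat.strong_induction_on with
  | _ n ih =>
    intro hn
    rcases n with _ | n
    · simp
    · refine (h.energy_succ_le n).trans ?_
      have hcast : (n + 1 : ℝ) ≤ N := by exact_mod_cast hn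
      refine h.gradEnergy_le_of_energy_le hℓ hβ0 hβ hC hρ hμ (by linarith) ?_
        fun i hi => ih i (by omega) (by omega)
      have : (n + 1 : ℝ) ^ 2 ≤ (N : ℝ) ^ 2 := by gcongr
      linarith

end TangentialChain

namespace TangentialChain

variable {ℓ β lam C₀ ρ X μ : ℝ} {w wt V : ℕ → ℝ × ℝ → ℝ} {n : ℕ}

/-- The `L²` norm squared of the normal derivative of the `n`-th tangential derivative on the
bottom side. -/
def traceEnergy (ℓ : ℝ) (wt : ℕ → ℝ × ℝ → ℝ) (n : ℕ) : ℝ :=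
  ∫ s in (0 : ℝ)..ℓ, wt n (s, 0) ^ 2

theorem traceEnergy_le (h : TangentialChain ℓ β lam C₀ ρ w wt V) (hℓ : 0 ≤ ℓ)
    (hβ0 : 0 ≤ β) (hβ : β ≤ 1) (n : ℕ) :
    β ^ (2 * n + 4) * traceEnergy ℓ wt n ≤ (2 * n + 5 + lam ^ 2) * gradEnergy ℓ β w wt n +
      energy ℓ β w (n + 2) +
      lam ^ 2 * ∫ p in rect ℓ β, (β - p.2) ^ (2 * n) * leibnizSum V w n p ^ 2 := by
  have c1 := h.continuousOn (n + 1)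
  have c3 := h.continuousOn (n + 2)
  have c4 := h.continuousOn' n
  have c6 := h.continuousOn' (n + 1)
  have c5 := h.continuousOn_leibnizSum n
  have hint : ∀ {F : ℝ × ℝ → ℝ}, ContinuousOn F (rect ℓ β) → IntegrableOn F (rect ℓ β) :=
    fun hF => hF.integrableOn_compact isCompact_Icc
  have hd := integral_divergence_rectangle hℓ hβ0
    (f := fun _ => (0 : ℝ)) (fs := fun _ => 0) (ft := fun _ => 0)
    (g := fun p => (β - p.2) ^ (2 * n + 3 + 1) * (wt n p * wt n p))
    (fun p hp => by simpa [HasPartials] using hasFDerivAt_const (0 : ℝ) p)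
    (fun p hp => (hasPartials_weight β (2 * n + 3) p).mul
      ((h.hasPartials' n p hp).mul (h.hasPartials' n p hp)))
    (by fun_prop) (by fun_prop) (fun t => rfl) (fun s => by simp)
  have hT : ∫ s in (0 : ℝ)..ℓ, (β - (s, (0 : ℝ)).2) ^ (2 * n + 3 + 1) *
      (wt n (s, 0) * wt n (s, 0)) = β ^ (2 * n + 4) * traceEnergy ℓ wt n := by
    rw [traceEnergy, ← intervalIntegral.integral_const_mul]
    refine intervalIntegral.integral_congr fun s _ => ?_
    simp only [sub_zero]
    ring
  rw [hT, ← neg_eq_iff_eq_neg] at hd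
  rw [← hd, ← integral_neg]
  have key : ∫ p in rect ℓ β, -(0 + (-(((2 * n + 3 + 1 : ℕ) : ℝ) * (β - p.2) ^ (2 * n + 3)) *
        (wt n p * wt n p) + (β - p.2) ^ (2 * n + 3 + 1) *
        ((-w (n + 2) p - lam ^ 2 * leibnizSum V w n p) * wt n p +
          wt n p * (-w (n + 2) p - lam ^ 2 * leibnizSum V w n p)))) ≤
      ∫ p in rect ℓ β, ((2 * n + 5 + lam ^ 2) *
        ((β - p.2) ^ (2 * n + 2) * (w (n + 1) p ^ 2 + wt n p ^ 2)) +
        (β - p.2) ^ (2 * (n + 2)) * w (n + 2) p ^ 2 +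
        lam ^ 2 * ((β - p.2) ^ (2 * n) * leibnizSum V w n p ^ 2)) := by
    refine setIntegral_mono_on (hint (by fun_prop)) (hint (by fun_prop)) measurableSet_Icc
      fun p hp => ?_
    have hσ : 0 ≤ β - p.2 := sub_nonneg.2 hp.2.2
    have hσ1 : β - p.2 ≤ 1 := by linarith [hp.1.2]
    set σ := β - p.2
    set a := wt n p
    set b := w (n + 2) p
    set r := leibnizSum V w n p
    set d := w (n + 1) p
    have e3 : σ ^ (2 * n + 3) ≤ σ ^ (2 * n + 2) := pow_le_pow_of_le_one hσ hσ1 (by omega)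
    have e4 : σ ^ (2 * n + 4) ≤ σ ^ (2 * n + 2) := pow_le_pow_of_le_one hσ hσ1 (by omega)
    have e5 : σ ^ (2 * n + 4) ≤ σ ^ (2 * n) := pow_le_pow_of_le_one hσ hσ1 (by omega)
    have p4 : 0 ≤ σ ^ (2 * n + 4) := by positivity
    have p2 : 0 ≤ σ ^ (2 * n + 2) := by positivity
    have q1 : 2 * a * b ≤ a ^ 2 + b ^ 2 := two_mul_le_add_sq a b
    have q2 : 2 * a * r ≤ a ^ 2 + r ^ 2 := two_mul_le_add_sq a r
    rw [show 2 * (n + 2) = 2 * n + 4 by ring, show 2 * n + 3 + 1 = 2 * n + 4 by ring]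
    push_cast
    calc _ = (2 * n + 4) * (σ ^ (2 * n + 3) * a ^ 2) + σ ^ (2 * n + 4) * (2 * a * b) +
          lam ^ 2 * (σ ^ (2 * n + 4) * (2 * a * r)) := by ring
      _ ≤ (2 * n + 4) * (σ ^ (2 * n + 2) * a ^ 2) + σ ^ (2 * n + 4) * (a ^ 2 + b ^ 2) +
          lam ^ 2 * (σ ^ (2 * n + 4) * (a ^ 2 + r ^ 2)) := by gcongr
      _ = (2 * n + 4) * (σ ^ (2 * n + 2) * a ^ 2) + σ ^ (2 * n + 4) * a ^ 2 +
          lam ^ 2 * (σ ^ (2 * n + 4) * a ^ 2) + σ ^ (2 * n + 4) * b ^ 2 +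
          lam ^ 2 * (σ ^ (2 * n + 4) * r ^ 2) := by ring
      _ ≤ (2 * n + 4) * (σ ^ (2 * n + 2) * a ^ 2) + σ ^ (2 * n + 2) * a ^ 2 +
          lam ^ 2 * (σ ^ (2 * n + 2) * a ^ 2) + σ ^ (2 * n + 4) * b ^ 2 +
          lam ^ 2 * (σ ^ (2 * n) * r ^ 2) := by gcongr
      _ = (2 * n + 5 + lam ^ 2) * (σ ^ (2 * n + 2) * (0 + a ^ 2)) + σ ^ (2 * n + 4) * b ^ 2 +
          lam ^ 2 * (σ ^ (2 * n) * r ^ 2) := by ring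
      _ ≤ _ := by
          gcongr
          positivity
  refine key.trans (le_of_eq ?_)
  rw [integral_add (hint (by fun_prop)) (hint (by fun_prop)),
    integral_add (hint (by fun_prop)) (hint (by fun_prop)), integral_const_mul,
    integral_const_mul]
  rfl

theorem traceEnergy_le_of_bound (h : TangentialChain ℓ β lam C₀ ρ w wt V) (hℓ : 0 ≤ ℓ)
    (hβ0 : 0 ≤ β) (hβ : β ≤ 1) (hC : 0 ≤ C₀) (hρ : 0 < ρ) (n : ℕ) (hμ : 1 ≤ μ)
    (hN : 2 * (n + 2) ≤ ρ * μ) (hμ2 : 4 * (C₀ + 1) * (lam + n + 2) ^ 2 ≤ μ ^ 2)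
    (hlam : 0 ≤ lam) :
    β ^ (2 * n + 4) * traceEnergy ℓ wt n ≤ 3 * energy ℓ β w 0 * μ ^ (2 * n + 4) := by
  have hμ0 : 0 < μ := by linarith
  have hN' : 2 * ((n + 2 : ℕ) : ℝ) ≤ ρ * μ := by push_cast; exact hN
  have n0 : (0 : ℝ) ≤ n := n.cast_nonneg
  have hq : 4 * C₀ * lam ^ 2 + 4 * ((n + 2 : ℕ) : ℝ) ^ 2 ≤ μ ^ 2 := by
    push_cast
    have : 0 ≤ C₀ * ((n + 2 : ℝ) ^ 2 + 2 * lam * (n + 2)) := by positivity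
    have : 0 ≤ lam ^ 2 + 2 * lam * (n + 2 : ℝ) := by positivity
    nlinarith
  have hE := h.energy_le hℓ hβ0 hβ hC hρ hμ0 hN' hq
  have hX : 0 ≤ energy ℓ β w 0 := energy_nonneg 0
  have hn : 2 * (n : ℝ) ≤ ρ * μ := by linarith
  have hG := h.gradEnergy_le_of_energy_le (n := n) hℓ hβ0 hβ hC hρ hμ0 hn (by
    refine le_trans ?_ hq
    push_cast
    have : (n + 1 : ℝ) ^ 2 ≤ (n + 2 : ℝ) ^ 2 := by gcongr; norm_num
    linarith) fun i hi => hE i (by omega)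
  have hR := h.integral_leibnizSum_sq_le (n := n) hβ hC hρ hμ0 hn fun i hi => hE i (by omega)
  have h2 := hE (n + 2) le_rfl
  have hlin : (2 * n + 5 + lam ^ 2 : ℝ) ≤ μ ^ 2 := by
    have : 0 ≤ C₀ * (lam + n + 2) ^ 2 := by positivity
    nlinarith [mul_nonneg hlam n0]
  have hμ3 : 4 * C₀ ^ 2 * lam ^ 2 ≤ μ ^ 4 := by
    have h1 : (lam + 1) ^ 2 ≤ (lam + n + 2) ^ 2 := by
      have : lam + 1 ≤ lam + n + 2 := by linarith
      gcongr
    have h2 : 4 * (C₀ + 1) * (lam + 1) ^ 2 ≤ μ ^ 2 := hμ2.trans' (by gcongr)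
    have h3 : C₀ * lam ≤ (C₀ + 1) * (lam + 1) ^ 2 := by
      gcongr <;> nlinarith
    calc 4 * C₀ ^ 2 * lam ^ 2 = 4 * (C₀ * lam) ^ 2 := by ring
      _ ≤ 4 * ((C₀ + 1) * (lam + 1) ^ 2) ^ 2 := by gcongr
      _ ≤ (4 * (C₀ + 1) * (lam + 1) ^ 2) ^ 2 := by
          nlinarith [sq_nonneg ((C₀ + 1) * (lam + 1) ^ 2)]
      _ ≤ (μ ^ 2) ^ 2 := by gcongr
      _ = μ ^ 4 := by ring
  have hG0 : 0 ≤ gradEnergy ℓ β w wt n := integral_nonneg fun p => by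
    rw [show 2 * n + 2 = 2 * (n + 1) by ring, pow_mul]
    positivity
  refine (h.traceEnergy_le hℓ hβ0 hβ n).trans ?_
  set E := energy ℓ β w 0
  calc _ ≤ μ ^ 2 * (E * μ ^ (2 * (n + 1))) + E * μ ^ (2 * (n + 2)) +
        lam ^ 2 * (4 * C₀ ^ 2 * E * μ ^ (2 * n)) := by
        gcongr
    _ = 2 * E * μ ^ (2 * n + 4) + E * μ ^ (2 * n) * (4 * C₀ ^ 2 * lam ^ 2) := by ring
    _ ≤ 2 * E * μ ^ (2 * n + 4) + E * μ ^ (2 * n) * μ ^ 4 := by gcongr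
    _ = _ := by ring

theorem sq_le_integral_of_hasDerivAt {g g' : ℝ → ℝ} (hℓ : 0 < ℓ)
    (hg : ∀ s ∈ Set.Icc 0 ℓ, HasDerivAt g (g' s) s) (hg' : ContinuousOn g' (Set.Icc 0 ℓ))
    {s : ℝ} (hs : s ∈ Set.Icc 0 ℓ) :
    g s ^ 2 ≤ (1 / ℓ + 1) * (∫ t in (0 : ℝ)..ℓ, g t ^ 2) + ∫ t in (0 : ℝ)..ℓ, g' t ^ 2 := by
  have hgc : ContinuousOn g (Set.Icc 0 ℓ) := fun t ht => (hg t ht).continuousAt.continuousWithinAt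
  have hint : ∀ {F : ℝ → ℝ}, ContinuousOn F (Set.Icc 0 ℓ) → IntervalIntegrable F volume 0 ℓ :=
    fun hF => ContinuousOn.intervalIntegrable (by rwa [Set.uIcc_of_le hℓ.le])
  set J := ∫ t in (0 : ℝ)..ℓ, (g t ^ 2 + g' t ^ 2) with hJ
  have hsub : ∀ t ∈ Set.Icc 0 ℓ, g s ^ 2 ≤ g t ^ 2 + J := fun t ht => by
    have hu : Set.uIcc t s ⊆ Set.Icc 0 ℓ := Set.uIcc_subset_Icc ht hs
    have h1 : ∫ x in t..s, 2 * g x * g' x = g s ^ 2 - g t ^ 2 := by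
      refine intervalIntegral.integral_eq_sub_of_hasDerivAt (f := fun x => g x ^ 2)
        (fun x hx => ?_) (ContinuousOn.intervalIntegrable ?_)
      · simpa [Pi.pow_def] using (hg x (hu hx)).pow 2
      · exact ((continuousOn_const.mul hgc).mul hg').mono hu
    have h2 := intervalIntegral.norm_integral_le_integral_norm_uIoc (f := fun x => 2 * g x * g' x)
      (a := t) (b := s) (μ := volume)
    have h3 : ∫ x in Set.uIoc t s, ‖2 * g x * g' x‖ ≤ ∫ x in Set.Ioc 0 ℓ, (g x ^ 2 + g' x ^ 2) := by
      have hI : IntegrableOn (fun x => g x ^ 2 + g' x ^ 2) (Set.Ioc 0 ℓ) :=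
        (intervalIntegrable_iff_integrableOn_Ioc_of_le hℓ.le).1 (hint (by fun_prop))
      have hss : Set.uIoc t s ⊆ Set.Ioc 0 ℓ :=
        Set.Ioc_subset_Ioc (le_min ht.1 hs.1) (max_le ht.2 hs.2)
      refine le_trans (setIntegral_mono_on ?_ (hI.mono_set hss) measurableSet_uIoc fun x _ => ?_)
        (setIntegral_mono_set hI (Filter.Eventually.of_forall fun x => by positivity)
          hss.eventuallyLE)
      · have : ContinuousOn (fun x => ‖2 * g x * g' x‖) (Set.Icc 0 ℓ) := by fun_prop
        exact (this.integrableOn_compact isCompact_Icc).mono_set (hss.trans Set.Ioc_subset_Icc_self)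
      · rw [Real.norm_eq_abs, abs_le]
        constructor <;> nlinarith [sq_nonneg (g x + g' x), sq_nonneg (g x - g' x)]
    rw [h1] at h2
    rw [← intervalIntegral.integral_of_le hℓ.le] at h3
    have := le_abs_self (g s ^ 2 - g t ^ 2)
    rw [Real.norm_eq_abs] at h2
    linarith
  have h4 : ∫ t in (0 : ℝ)..ℓ, g s ^ 2 ≤ ∫ t in (0 : ℝ)..ℓ, (g t ^ 2 + J) :=
    intervalIntegral.integral_mono_on hℓ.le (by simp) (hint (by fun_prop)) hsub
  have hJ' : J = (∫ t in (0 : ℝ)..ℓ, g t ^ 2) + ∫ t in (0 : ℝ)..ℓ, g' t ^ 2 :=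
    intervalIntegral.integral_add (hint (by fun_prop)) (hint (by fun_prop))
  rw [intervalIntegral.integral_add (hint (by fun_prop)) (by simp),
    intervalIntegral.integral_const, intervalIntegral.integral_const, sub_zero, smul_eq_mul,
    smul_eq_mul] at h4
  have : g s ^ 2 ≤ ((∫ t in (0 : ℝ)..ℓ, g t ^ 2) + ℓ * J) / ℓ := by
    rw [le_div_iff₀ hℓ]; linarith
  refine this.trans (le_of_eq ?_)
  rw [hJ']
  field_simp
  ring

theorem add_pow_le_factorial_mul_exp (hlam : 0 ≤ lam) (n : ℕ) :
    (n + 3 + lam) ^ (n + 3) ≤ n.factorial * (6 * (2 * exp 1) ^ (n + 3)) * exp lam := by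
  have h0 : (0 : ℝ) ≤ n + 3 + lam := by positivity
  have h1 := Real.pow_div_factorial_le_exp (n + 3 + lam) h0 (n + 3)
  have h2 : ((n + 3).factorial : ℝ) ≤ n.factorial * 6 * 2 ^ (n + 3) := by
    have e : (n + 3).choose n * n.factorial * Nat.factorial 3 = (n + 3).factorial := by
      have := Nat.choose_mul_factorial_mul_factorial (Nat.le_add_right n 3)
      simpa using this
    have := Nat.choose_le_two_pow (n + 3) n
    rw [← e]
    have h3 : (((n + 3).choose n : ℕ) : ℝ) ≤ 2 ^ (n + 3) := by exact_mod_cast this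
    push_cast
    rw [show (Nat.factorial 3 : ℝ) = 6 by norm_num [Nat.factorial]]
    have : (0 : ℝ) ≤ n.factorial := by positivity
    nlinarith
  rw [div_le_iff₀ (by positivity)] at h1
  have h3 : exp (n + 3 + lam) = exp 1 ^ (n + 3) * exp lam := by
    rw [exp_add, ← exp_nat_mul]
    push_cast
    ring_nf
  calc (n + 3 + lam) ^ (n + 3) ≤ exp (n + 3 + lam) * (n + 3).factorial := h1
    _ ≤ (exp 1 ^ (n + 3) * exp lam) * (n.factorial * 6 * 2 ^ (n + 3)) := by
        rw [h3]; gcongr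
    _ = _ := by rw [mul_pow]; ring


theorem abs_normal_derivative_le (h : TangentialChain ℓ β lam C₀ ρ w wt V) (hℓ : 0 < ℓ)
    (hβ0 : 0 < β) (hβ : β ≤ 1) (hC : 0 ≤ C₀) (hρ : 0 < ρ) (hlam : 0 ≤ lam) {L : ℝ}
    (hL1 : 2 * (C₀ + 1) ≤ L) (hL3 : 2 ≤ ρ * L) (n : ℕ) {s : ℝ} (hs : s ∈ Set.Icc 0 ℓ) :
    |wt n (s, 0)| ≤ √(energy ℓ β w 0) * √(3 * (1 / ℓ + 2)) * (L * (n + 3 + lam) / β) ^ (n + 3) := by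
  have hL2 : 2 ≤ L := by linarith
  have hL0 : 0 < L := by linarith
  have hE0 : 0 ≤ energy ℓ β w 0 := energy_nonneg 0
  generalize hE : energy ℓ β w 0 = E at *
  have hn0 : (0 : ℝ) ≤ n := n.cast_nonneg
  have hT : ∀ m : ℕ, traceEnergy ℓ wt m ≤ 3 * E * (L * (m + 2 + lam) / β) ^ (2 * m + 4) := by
    intro m
    have hm0 : (0 : ℝ) ≤ m := m.cast_nonneg
    have hpos : (2 : ℝ) ≤ m + 2 + lam := by linarith
    have := h.traceEnergy_le_of_bound hℓ.le hβ0.le hβ hC hρ m (μ := L * (m + 2 + lam))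
      (by nlinarith) (by
        have : 2 * (m + 2 + lam) ≤ ρ * L * (m + 2 + lam) := by gcongr
        linarith) (by
        rw [mul_pow, show lam + m + 2 = m + 2 + lam by ring]
        gcongr
        nlinarith) hlam
    rw [div_pow, mul_div_assoc', le_div_iff₀ (by positivity), ← hE]
    linarith
  have hB1 : 1 ≤ L * (n + 3 + lam) / β := by
    rw [le_div_iff₀ hβ0]
    nlinarith
  have hT0 : traceEnergy ℓ wt n ≤ 3 * E * (L * (n + 3 + lam) / β) ^ (2 * n + 6) := by
    refine (hT n).trans ?_
    calc _ ≤ 3 * E * (L * (n + 3 + lam) / β) ^ (2 * n + 4) := by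
          gcongr; norm_num
      _ ≤ _ := by gcongr; omega
  have hT1 : traceEnergy ℓ wt (n + 1) ≤ 3 * E * (L * (n + 3 + lam) / β) ^ (2 * n + 6) := by
    refine (hT (n + 1)).trans (le_of_eq ?_)
    push_cast
    rw [show (n : ℝ) + 1 + 2 + lam = n + 3 + lam by ring, show 2 * (n + 1) + 4 = 2 * n + 6 by ring]
  generalize L * (n + 3 + lam) / β = B at *
  have hder : ∀ t ∈ Set.Icc 0 ℓ, HasDerivAt (fun t => wt n (t, 0)) (wt (n + 1) (t, 0)) t := by
    intro t ht
    have h1 := h.hasPartials' n (t, 0) ⟨⟨ht.1, le_rfl⟩, ⟨ht.2, hβ0.le⟩⟩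
    have h2 := HasFDerivAt.comp_hasDerivAt (f := fun t : ℝ => (t, (0 : ℝ))) t h1
      ((hasDerivAt_id t).prodMk (hasDerivAt_const t (0 : ℝ)))
    simpa [Function.comp_def] using h2
  have hcont : ContinuousOn (fun t => wt (n + 1) (t, 0)) (Set.Icc 0 ℓ) := by
    refine (h.continuousOn' (n + 1)).comp (by fun_prop) fun t ht => ?_
    exact ⟨⟨ht.1, le_rfl⟩, ⟨ht.2, hβ0.le⟩⟩
  have hsup := sq_le_integral_of_hasDerivAt hℓ hder hcont hs
  have hsq : wt n (s, 0) ^ 2 ≤ (√E * √(3 * (1 / ℓ + 2)) * B ^ (n + 3)) ^ 2 := by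
    rw [mul_pow, mul_pow, sq_sqrt hE0, sq_sqrt (by positivity)]
    calc _ ≤ (1 / ℓ + 1) * traceEnergy ℓ wt n + traceEnergy ℓ wt (n + 1) := hsup
      _ ≤ (1 / ℓ + 1) * (3 * E * B ^ (2 * n + 6)) + 3 * E * B ^ (2 * n + 6) := by gcongr
      _ = _ := by ring
  exact abs_le_of_sq_le_sq hsq (by positivity)

end TangentialChain

open TangentialChain in
/-- Cauchy-type bounds for the tangential derivatives of the normal derivative on the bottom side
of a tangential chain. -/
theorem exists_abs_normal_derivative_le {ℓ β C₀ ρ : ℝ} (hℓ : 0 < ℓ) (hβ0 : 0 < β) (hβ : β ≤ 1)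
    (hC : 0 ≤ C₀) (hρ : 0 < ρ) :
    ∃ K > 0, ∃ A > 0, ∀ (lam : ℝ) (w wt V : ℕ → ℝ × ℝ → ℝ), 0 ≤ lam →
      TangentialChain ℓ β lam C₀ ρ w wt V → ∀ n, ∀ s ∈ Set.Icc 0 ℓ,
        |wt n (s, 0)| ≤ √(energy ℓ β w 0) * K * exp lam * n.factorial * A ^ n := by
  obtain ⟨L, hL1, hL3⟩ : ∃ L, 2 * (C₀ + 1) ≤ L ∧ 2 ≤ ρ * L := by
    refine ⟨2 / ρ + 2 * (C₀ + 1), by have : 0 < 2 / ρ := by positivity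
                                     linarith, ?_⟩
    rw [mul_add, mul_div_cancel₀ _ hρ.ne']
    have : 0 ≤ ρ * (2 * (C₀ + 1)) := by positivity
    linarith
  have hL0 : 0 < L := by linarith
  refine ⟨√(3 * (1 / ℓ + 2)) * 6 * (2 * exp 1 * (L / β)) ^ 3, by positivity,
    2 * exp 1 * (L / β), by positivity, fun lam w wt V hlam h n s hs => ?_⟩
  refine (h.abs_normal_derivative_le hℓ hβ0 hβ hC hρ hlam hL1 hL3 n hs).trans ?_
  have hf := add_pow_le_factorial_mul_exp hlam n
  have hR : 0 ≤ √(3 * (1 / ℓ + 2)) := sqrt_nonneg _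
  generalize √(3 * (1 / ℓ + 2)) = R at *
  calc √(energy ℓ β w 0) * R * (L * (n + 3 + lam) / β) ^ (n + 3)
      = √(energy ℓ β w 0) * R * ((L / β) ^ (n + 3) * (n + 3 + lam) ^ (n + 3)) := by
        rw [← mul_pow, mul_div_right_comm]
    _ ≤ √(energy ℓ β w 0) * R * ((L / β) ^ (n + 3) *
        (n.factorial * (6 * (2 * exp 1) ^ (n + 3)) * exp lam)) := by gcongr
    _ = _ := by
        rw [pow_add, pow_add, mul_pow _ (L / β), mul_pow _ (L / β)]
        ring

/-- The derivative of `g` in the constant direction `e`. -/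
def dir (e : ℂ) (g : ℂ → ℝ) (z : ℂ) : ℝ := fderiv ℝ g z e

section dir

variable {g h : ℂ → ℝ} {O : Set ℂ} {z : ℂ}

theorem AnalyticAt.dir (hg : AnalyticAt ℝ g z) (e : ℂ) : AnalyticAt ℝ (dir e g) z :=
  ((ContinuousLinearMap.apply ℝ ℝ e).analyticAt _).comp hg.fderiv

theorem AnalyticOnNhd.dir (hg : AnalyticOnNhd ℝ g O) (e : ℂ) : AnalyticOnNhd ℝ (dir e g) O :=
  fun z hz => (hg z hz).dir e

theorem AnalyticOnNhd.iterate_dir (hg : AnalyticOnNhd ℝ g O) (e : ℂ) (n : ℕ) :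
    AnalyticOnNhd ℝ ((_root_.dir e)^[n] g) O := by
  induction n with
  | zero => exact hg
  | succ n ih => rw [Function.iterate_succ_apply']; exact ih.dir e

theorem dir_congr (h' : g =ᶠ[nhds z] h) (e : ℂ) : dir e g z = dir e h z := by
  rw [dir, dir, h'.fderiv_eq]

theorem dir_eventuallyEq (h' : g =ᶠ[nhds z] h) (e : ℂ) : dir e g =ᶠ[nhds z] dir e h := by
  filter_upwards [h'.eventuallyEq_nhds] with w hw using dir_congr hw e

theorem dir_dir (hg : AnalyticAt ℝ g z) (e e' : ℂ) :
    dir e (dir e' g) z = fderiv ℝ (fderiv ℝ g) z e e' := by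
  have h := fderiv_clm_apply hg.fderiv.differentiableAt (differentiableAt_const (x := z) e')
  change fderiv ℝ (fun y => fderiv ℝ g y e') z e = _
  rw [h]
  simp

theorem dir_comm (hg : AnalyticAt ℝ g z) (e e' : ℂ) :
    dir e (dir e' g) z = dir e' (dir e g) z := by
  rw [dir_dir hg, dir_dir hg]
  exact (hg.contDiffAt (n := 2)).isSymmSndFDerivAt (by simp) e e'

theorem dir_sub (hg : DifferentiableAt ℝ g z) (hh : DifferentiableAt ℝ h z) (e : ℂ) :
    dir e (fun z => g z - h z) z = dir e g z - dir e h z := by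
  rw [dir, fderiv_fun_sub hg hh]
  simp [dir]

theorem dir_const_mul (hg : DifferentiableAt ℝ g z) (c : ℝ) (e : ℂ) :
    dir e (fun z => c * g z) z = c * dir e g z := by
  rw [dir, fderiv_const_mul hg]
  simp [dir]

theorem fderiv_eq_dir (g : ℂ → ℝ) (z a : ℂ) :
    fderiv ℝ g z a = a.re * dir 1 g z + a.im * dir Complex.I g z := by
  have h : a = a.re • (1 : ℂ) + a.im • Complex.I := by simp [Complex.re_add_im]
  calc fderiv ℝ g z a = fderiv ℝ g z (a.re • (1 : ℂ) + a.im • Complex.I) := by rw [← h]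
    _ = _ := by rw [map_add, map_smul, map_smul]; rfl

theorem dir_periodic {c : ℂ} (hper : ∀ z, g (z + c) = g z) (e z : ℂ) :
    dir e g (z + c) = dir e g z := by
  rw [dir, ← fderiv_comp_add_right, dir]
  simp only [hper]

theorem iterate_dir_periodic {c : ℂ} (hper : ∀ z, g (z + c) = g z) (e : ℂ) (n : ℕ) (z : ℂ) :
    (dir e)^[n] g (z + c) = (dir e)^[n] g z := by
  induction n generalizing z with
  | zero => exact hper z
  | succ n ih => rw [Function.iterate_succ_apply']; exact dir_periodic ih e z

theorem hasDerivAt_line (hg : DifferentiableAt ℝ g z) (x : ℝ) {e : ℂ} {y : ℂ} (hy : y + x * e = z) :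
    HasDerivAt (fun t : ℝ => g (y + t * e)) (dir e g z) x := by
  have h1 : HasDerivAt (fun t : ℝ => y + t * e) e x := by
    simpa using (((hasDerivAt_id x).ofReal_comp).mul_const e).const_add y
  have h2 : HasFDerivAt g (fderiv ℝ g z) (y + x * e) := by rw [hy]; exact hg.hasFDerivAt
  exact h2.comp_hasDerivAt x h1

theorem iteratedDeriv_line (hO : IsOpen O) (hg : AnalyticOnNhd ℝ g O) (z : ℂ) (n : ℕ) :
    ∀ x : ℝ, z + x ∈ O → iteratedDeriv n (fun t : ℝ => g (z + t)) x = (dir 1)^[n] g (z + x) := by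
  induction n with
  | zero => simp
  | succ n ih =>
    intro x hx
    have hev : ∀ᶠ t : ℝ in nhds x, z + t ∈ O :=
      (Continuous.continuousAt (by fun_prop)).eventually_mem (hO.mem_nhds hx)
    rw [iteratedDeriv_succ, Filter.EventuallyEq.deriv_eq (hev.mono fun t ht => ih t ht),
      Function.iterate_succ_apply']
    have := hasDerivAt_line (e := 1) ((hg.iterate_dir 1 n) _ hx).differentiableAt x (y := z)
      (by simp)
    simpa using this.deriv

theorem iteratedDeriv_ofReal_line (hO : IsOpen O) (hg : AnalyticOnNhd ℝ g O) (z : ℂ) (n : ℕ) :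
    ∀ x : ℝ, z + x ∈ O → iteratedDeriv n (fun t : ℝ => ((g (z + t) : ℝ) : ℂ)) x =
      ((dir 1)^[n] g (z + x) : ℝ) := by
  induction n with
  | zero => simp
  | succ n ih =>
    intro x hx
    have hev : ∀ᶠ t : ℝ in nhds x, z + t ∈ O :=
      (Continuous.continuousAt (by fun_prop)).eventually_mem (hO.mem_nhds hx)
    rw [iteratedDeriv_succ, Filter.EventuallyEq.deriv_eq (hev.mono fun t ht => ih t ht),
      Function.iterate_succ_apply']
    have := hasDerivAt_line (e := 1) ((hg.iterate_dir 1 n) _ hx).differentiableAt x (y := z)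
      (by simp)
    simpa using this.ofReal_comp.deriv

theorem iterate_dir_mul (hO : IsOpen O) (hg : AnalyticOnNhd ℝ g O) (hh : AnalyticOnNhd ℝ h O)
    (n : ℕ) (hz : z ∈ O) : (dir 1)^[n] (fun z => g z * h z) z =
      ∑ j ∈ Finset.range (n + 1), (n.choose j : ℝ) * (dir 1)^[j] g z * (dir 1)^[n - j] h z := by
  have hz' : z + (0 : ℝ) ∈ O := by simpa using hz
  have hline : AnalyticAt ℝ (fun t : ℝ => z + (t : ℂ)) 0 :=
    analyticAt_const.add (Complex.ofRealCLM.analyticAt 0)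
  have h1 := iteratedDeriv_line hO (hg.mul hh) z n 0 hz'
  have cg : ContDiffAt ℝ n (fun t : ℝ => g (z + t)) 0 :=
    ((hg _ hz').comp_of_eq hline rfl).contDiffAt
  have ch : ContDiffAt ℝ n (fun t : ℝ => h (z + t)) 0 :=
    ((hh _ hz').comp_of_eq hline rfl).contDiffAt
  have h2 := iteratedDeriv_fun_mul cg ch
  erw [h1] at h2
  simp only [iteratedDeriv_line hO hg z _ 0 hz', iteratedDeriv_line hO hh z _ 0 hz'] at h2
  simpa using h2

theorem iterate_dir_eventuallyEq (h' : g =ᶠ[nhds z] h) (e : ℂ) (n : ℕ) :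
    (dir e)^[n] g =ᶠ[nhds z] (dir e)^[n] h := by
  induction n with
  | zero => exact h'
  | succ n ih => simp only [Function.iterate_succ_apply']; exact dir_eventuallyEq ih e

theorem iterate_dir_comm (hO : IsOpen O) (hg : AnalyticOnNhd ℝ g O) (e e' : ℂ) (n : ℕ) :
    ∀ z ∈ O, dir e' ((dir e)^[n] g) z = (dir e)^[n] (dir e' g) z := by
  induction n with
  | zero => simp
  | succ n ih =>
    intro z hz
    rw [Function.iterate_succ_apply', Function.iterate_succ_apply',
      dir_comm (hg.iterate_dir e n z hz)]
    exact dir_congr (Filter.eventually_of_mem (hO.mem_nhds hz) ih) e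

theorem iterate_dir_const_mul_sub (hO : IsOpen O) (hg : AnalyticOnNhd ℝ g O)
    (hh : AnalyticOnNhd ℝ h O) (c : ℝ) (e : ℂ) (n : ℕ) :
    ∀ z ∈ O, (dir e)^[n] (fun z => c * g z - h z) z = c * (dir e)^[n] g z - (dir e)^[n] h z := by
  induction n with
  | zero => simp
  | succ n ih =>
    intro z hz
    have h1 := (hg.iterate_dir e n z hz).differentiableAt
    have h2 := (hh.iterate_dir e n z hz).differentiableAt
    rw [Function.iterate_succ_apply', dir_congr (Filter.eventually_of_mem (hO.mem_nhds hz) ih),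
      dir_sub (h1.const_mul c) h2, dir_const_mul h1, Function.iterate_succ_apply',
      Function.iterate_succ_apply']

end dir

/-- A solution of `Δf = -lam² f` on `D ⊆ ℂ`, real-analytic on a neighbourhood `U` of the closure
and vanishing on the frontier. -/
structure PlaneEigen (D : Set ℂ) (lam : ℝ) (f : ℂ → ℝ) (U : Set ℂ) : Prop where
  isOpen_U : IsOpen U
  closure_subset : closure D ⊆ U
  analytic : AnalyticOnNhd ℝ f U
  pde : ∀ z ∈ D, dir 1 (dir 1 f) z + dir Complex.I (dir Complex.I f) z = -lam ^ 2 * f z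
  dirichlet : ∀ z ∈ frontier D, f z = 0

/-- The weight `|Q'|²` of a conformal change of variables. -/
def confWeight (Q : ℂ → ℂ) (z : ℂ) : ℝ := Complex.normSq (deriv Q z)

theorem analyticOnNhd_confWeight {Q : ℂ → ℂ} {O : Set ℂ} (hO : IsOpen O)
    (hQ : DifferentiableOn ℂ Q O) : AnalyticOnNhd ℝ (confWeight Q) O := by
  have h : AnalyticOnNhd ℝ (deriv Q) O :=
    ((hQ.analyticOnNhd hO).deriv).restrictScalars
  have hre : AnalyticOnNhd ℝ (fun z => (deriv Q z).re) O :=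
    (Complex.reCLM.analyticOnNhd Set.univ).comp h fun _ _ => trivial
  have him : AnalyticOnNhd ℝ (fun z => (deriv Q z).im) O :=
    (Complex.imCLM.analyticOnNhd Set.univ).comp h fun _ _ => trivial
  exact (hre.mul hre).add (him.mul him)

theorem fderiv_comp_conformal {f : ℂ → ℝ} {Q : ℂ → ℂ} {z : ℂ} (hf : DifferentiableAt ℝ f (Q z))
    (hQ : DifferentiableAt ℂ Q z) (e : ℂ) :
    fderiv ℝ (fun z => f (Q z)) z e = fderiv ℝ f (Q z) (deriv Q z * e) := by
  have h1 : HasFDerivAt Q ((ContinuousLinearMap.toSpanSingleton ℂ (deriv Q z)).restrictScalars ℝ) z :=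
    hQ.hasDerivAt.hasFDerivAt.restrictScalars ℝ
  rw [show fderiv ℝ (fun z => f (Q z)) z = _ from (hf.hasFDerivAt.comp z h1).fderiv]
  simp [mul_comm]

theorem dir_dir_comp_conformal {f : ℂ → ℝ} {Q : ℂ → ℂ} {z : ℂ} (hf : AnalyticAt ℝ f (Q z))
    (hQ : AnalyticAt ℂ Q z) (e : ℂ) :
    dir e (dir e (fun z => f (Q z))) z =
      fderiv ℝ (fderiv ℝ f) (Q z) (deriv Q z * e) (deriv Q z * e) +
        fderiv ℝ f (Q z) (deriv (deriv Q) z * e * e) := by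
  have hev : dir e (fun z => f (Q z)) =ᶠ[nhds z] fun z => fderiv ℝ f (Q z) (deriv Q z * e) := by
    filter_upwards [hQ.continuousAt.eventually hf.eventually_analyticAt,
      hQ.eventually_analyticAt] with w hw hw'
    exact fderiv_comp_conformal hw.differentiableAt hw'.differentiableAt e
  have h1 : HasFDerivAt Q ((ContinuousLinearMap.toSpanSingleton ℂ (deriv Q z)).restrictScalars ℝ) z :=
    hQ.differentiableAt.hasDerivAt.hasFDerivAt.restrictScalars ℝ
  have h2 : HasFDerivAt (fun z => deriv Q z * e)
      ((ContinuousLinearMap.toSpanSingleton ℂ (deriv (deriv Q) z * e)).restrictScalars ℝ) z :=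
    (hQ.deriv.differentiableAt.hasDerivAt.mul_const e).hasFDerivAt.restrictScalars ℝ
  have h3 : HasFDerivAt (fun z => fderiv ℝ f (Q z)) _ z :=
    hf.fderiv.differentiableAt.hasFDerivAt.comp z h1
  rw [dir_congr hev, dir, (h3.clm_apply h2).fderiv]
  simp [mul_comm, add_comm]

theorem laplacian_comp_conformal {f : ℂ → ℝ} {Q : ℂ → ℂ} {z : ℂ} (hf : AnalyticAt ℝ f (Q z))
    (hQ : AnalyticAt ℂ Q z) :
    dir 1 (dir 1 (fun z => f (Q z))) z + dir Complex.I (dir Complex.I (fun z => f (Q z))) z =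
      confWeight Q z * (dir 1 (dir 1 f) (Q z) + dir Complex.I (dir Complex.I f) (Q z)) := by
  rw [dir_dir_comp_conformal hf hQ, dir_dir_comp_conformal hf hQ, dir_dir hf, dir_dir hf,
    confWeight, Complex.normSq_apply]
  have e1 : deriv (deriv Q) z * Complex.I * Complex.I = -(deriv (deriv Q) z * 1 * 1) := by
    rw [mul_assoc, Complex.I_mul_I]; ring
  rw [e1, map_neg]
  generalize deriv Q z = a
  have h1 : a * 1 = a.re • (1 : ℂ) + a.im • Complex.I := by simp [Complex.re_add_im]
  have h2 : a * Complex.I = a.re • Complex.I + (-a.im) • (1 : ℂ) := by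
    apply Complex.ext <;> simp
  rw [h1, h2]
  simp only [map_add, map_smul, add_apply, smul_apply, smul_eq_mul]
  ring

theorem eq_of_eqOn_upper {g h : ℂ → ℝ} {ε : ℝ} {z : ℂ} (h0 : 0 ≤ z.im) (h1 : z.im < ε)
    (hg : ContinuousAt g z) (hh : ContinuousAt h z)
    (heq : ∀ w : ℂ, w.im ∈ Set.Ioo 0 ε → g w = h w) : g z = h z := by
  have ht : Filter.Tendsto (fun t : ℝ => z + t * Complex.I) (nhdsWithin 0 (Set.Ioi 0)) (nhds z) := by
    have : ContinuousAt (fun t : ℝ => z + t * Complex.I) 0 := by fun_prop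
    simpa [ContinuousAt] using this.tendsto.mono_left nhdsWithin_le_nhds
  refine tendsto_nhds_unique (hg.tendsto.comp ht) ((hh.tendsto.comp ht).congr' ?_)
  filter_upwards [Ioo_mem_nhdsGT (sub_pos.2 h1)] with t ht
  refine (heq _ ?_).symm
  simp only [Complex.add_im, Complex.mul_im, Complex.ofReal_re, Complex.I_im, mul_one,
    Complex.ofReal_im, Complex.I_re, mul_zero, add_zero, Set.mem_Ioo]
  constructor <;> linarith [ht.1, ht.2]

namespace Collar

variable {D U : Set ℂ} (𝒞 : Collar D) {lam : ℝ} {f : ℂ → ℝ} {z : ℂ}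

/-- The pullback of a function to the collar, extended by zero. -/
def pull (f : ℂ → ℝ) : ℂ → ℝ := (hStrip 𝒞.ε).indicator fun w => f (𝒞.Q w)

/-- The part of the strip which the collar map sends to `U`. -/
def preim (U : Set ℂ) : Set ℂ := hStrip 𝒞.ε ∩ 𝒞.Q ⁻¹' U

theorem pull_eq (hz : z ∈ hStrip 𝒞.ε) : 𝒞.pull f z = f (𝒞.Q z) := Set.indicator_of_mem hz _

theorem pull_eventuallyEq (hz : z ∈ hStrip 𝒞.ε) :
    𝒞.pull f =ᶠ[nhds z] fun w => f (𝒞.Q w) :=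
  Filter.eventually_of_mem ((isOpen_hStrip _).mem_nhds hz) fun _ hw => 𝒞.pull_eq hw

theorem pull_periodic (f : ℂ → ℝ) (z : ℂ) : 𝒞.pull f (z + 𝒞.ℓ) = 𝒞.pull f z := by
  by_cases hz : z ∈ hStrip 𝒞.ε
  · have hz' : z + 𝒞.ℓ ∈ hStrip 𝒞.ε := by simpa [hStrip] using hz
    rw [𝒞.pull_eq hz, 𝒞.pull_eq hz', 𝒞.periodic z hz]
  · have hz' : z + 𝒞.ℓ ∉ hStrip 𝒞.ε := by simpa [hStrip] using hz
    rw [pull, Set.indicator_of_notMem hz, Set.indicator_of_notMem hz']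

theorem isOpen_preim (hU : IsOpen U) : IsOpen (𝒞.preim U) :=
  𝒞.diff.continuousOn.isOpen_inter_preimage (isOpen_hStrip _) hU

theorem mem_preim (hU : closure D ⊆ U) (h0 : 0 ≤ z.im) (h1 : z.im < 𝒞.ε) : z ∈ 𝒞.preim U := by
  refine ⟨by rw [hStrip, Set.mem_ofPred_eq, abs_of_nonneg h0]; exact h1, hU ?_⟩
  rcases h0.eq_or_lt with h | h
  · have : z = (z.re : ℂ) := Complex.ext rfl (by simpa using h.symm)
    rw [this]
    exact frontier_subset_closure (𝒞.real_mem _)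
  · exact subset_closure (𝒞.inside z ⟨h, h1⟩)

theorem analyticAt_Q (hz : z ∈ hStrip 𝒞.ε) : AnalyticAt ℂ 𝒞.Q z :=
  𝒞.diff.analyticAt ((isOpen_hStrip _).mem_nhds hz)

theorem analyticOnNhd_pull (hf : AnalyticOnNhd ℝ f U) :
    AnalyticOnNhd ℝ (𝒞.pull f) (𝒞.preim U) := fun _ hz =>
  ((hf _ hz.2).comp (𝒞.analyticAt_Q hz.1).restrictScalars).congr (𝒞.pull_eventuallyEq hz.1).symm

theorem pull_pde (hf : PlaneEigen D lam f U) (hz : z.im ∈ Set.Ioo 0 𝒞.ε) :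
    dir 1 (dir 1 (𝒞.pull f)) z + dir Complex.I (dir Complex.I (𝒞.pull f)) z =
      -lam ^ 2 * (confWeight 𝒞.Q z * 𝒞.pull f z) := by
  have hz' := 𝒞.mem_preim hf.closure_subset hz.1.le hz.2
  rw [dir_congr (dir_eventuallyEq (𝒞.pull_eventuallyEq hz'.1) _),
    dir_congr (dir_eventuallyEq (𝒞.pull_eventuallyEq hz'.1) _),
    laplacian_comp_conformal (hf.analytic _ hz'.2) (𝒞.analyticAt_Q hz'.1),
    hf.pde _ (𝒞.inside z hz), 𝒞.pull_eq hz'.1]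
  ring

/-- Points of the rectangle seen as complex numbers. -/
def toC (p : ℝ × ℝ) : ℂ := p.1 + p.2 * Complex.I

theorem toC_im (p : ℝ × ℝ) : (toC p).im = p.2 := by simp [toC]

theorem hasPartials_toC {g : ℂ → ℝ} {p : ℝ × ℝ} (hg : DifferentiableAt ℝ g (toC p)) :
    HasPartials (fun p => g (toC p)) (dir 1 g (toC p)) (dir Complex.I g (toC p)) p := by
  have h1 : HasFDerivAt toC ((Complex.ofRealCLM.comp (ContinuousLinearMap.fst ℝ ℝ ℝ)) +
      (ContinuousLinearMap.mul ℝ ℂ).flip Complex.I ∘L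
        (Complex.ofRealCLM.comp (ContinuousLinearMap.snd ℝ ℝ ℝ))) p :=
    ContinuousLinearMap.hasFDerivAt (((Complex.ofRealCLM.comp (ContinuousLinearMap.fst ℝ ℝ ℝ)) +
      (ContinuousLinearMap.mul ℝ ℂ).flip Complex.I ∘L
        (Complex.ofRealCLM.comp (ContinuousLinearMap.snd ℝ ℝ ℝ))))
  refine (hg.hasFDerivAt.comp p h1).congr_fderiv ?_
  ext <;> simp [dir]

theorem iterate_dir_pde (hf : PlaneEigen D lam f U) (n : ℕ) (h0 : 0 ≤ z.im) (h1 : z.im < 𝒞.ε) :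
    dir Complex.I (dir Complex.I ((dir 1)^[n] (𝒞.pull f))) z =
      -(dir 1)^[n + 2] (𝒞.pull f) z - lam ^ 2 * ∑ j ∈ Finset.range (n + 1),
        (n.choose j : ℝ) * (dir 1)^[j] (confWeight 𝒞.Q) z * (dir 1)^[n - j] (𝒞.pull f) z := by
  have hO := 𝒞.isOpen_preim hf.isOpen_U
  have hv := 𝒞.analyticOnNhd_pull hf.analytic
  have hV := analyticOnNhd_confWeight (isOpen_hStrip _) 𝒞.diff
  have hV' : AnalyticOnNhd ℝ (confWeight 𝒞.Q) (𝒞.preim U) := hV.mono Set.inter_subset_left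
  have hS : IsOpen {z : ℂ | z.im ∈ Set.Ioo 0 𝒞.ε} := isOpen_Ioo.preimage Complex.continuous_im
  have hin : ∀ z : ℂ, z.im ∈ Set.Ioo 0 𝒞.ε → dir Complex.I (dir Complex.I ((dir 1)^[n] (𝒞.pull f))) z =
      -(dir 1)^[n + 2] (𝒞.pull f) z - lam ^ 2 * ∑ j ∈ Finset.range (n + 1),
        (n.choose j : ℝ) * (dir 1)^[j] (confWeight 𝒞.Q) z * (dir 1)^[n - j] (𝒞.pull f) z := by
    intro z hz
    have hz' := 𝒞.mem_preim hf.closure_subset hz.1.le hz.2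
    rw [← iterate_dir_mul hO hV' hv n hz',
      dir_congr (Filter.eventually_of_mem (hO.mem_nhds hz') (iterate_dir_comm hO hv 1 Complex.I n)),
      iterate_dir_comm hO (hv.dir Complex.I) 1 Complex.I n z hz',
      (iterate_dir_eventuallyEq (Filter.eventually_of_mem (hS.mem_nhds hz) fun w hw =>
        eq_sub_of_add_eq' (𝒞.pull_pde hf hw)) 1 n).eq_of_nhds]
    rw [iterate_dir_const_mul_sub hO (hV'.mul hv) ((hv.dir 1).dir 1) _ 1 n z hz',
      Function.iterate_add_apply]
    simp only [Function.iterate_succ_apply, Function.iterate_zero, id_eq]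
    ring
  have hz' := 𝒞.mem_preim hf.closure_subset h0 h1
  refine eq_of_eqOn_upper h0 h1 (((hv.iterate_dir 1 n).dir _).dir _ z hz').continuousAt ?_ hin
  have hsum : ContinuousAt (fun z => ∑ j ∈ Finset.range (n + 1), (n.choose j : ℝ) *
      (dir 1)^[j] (confWeight 𝒞.Q) z * (dir 1)^[n - j] (𝒞.pull f) z) z :=
    tendsto_finsetSum _ fun j _ => ((continuousAt_const.mul
      (hV'.iterate_dir 1 j z hz').continuousAt).mul (hv.iterate_dir 1 _ z hz').continuousAt)
  exact (hv.iterate_dir 1 _ z hz').continuousAt.neg.sub (continuousAt_const.mul hsum)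

end Collar

namespace Collar

variable {D U : Set ℂ} (𝒞 : Collar D) {lam : ℝ} {f : ℂ → ℝ} {z : ℂ}

theorem real_mem_preim (hU : closure D ⊆ U) (x : ℝ) : (x : ℂ) ∈ 𝒞.preim U :=
  𝒞.mem_preim hU (by simp) (by simpa using 𝒞.ε_pos)

theorem iterate_dir_pull_real (hf : PlaneEigen D lam f U) (n : ℕ) (x : ℝ) :
    (dir 1)^[n] (𝒞.pull f) x = 0 := by
  have hz := 𝒞.real_mem_preim hf.closure_subset x
  have h := iteratedDeriv_line (𝒞.isOpen_preim hf.isOpen_U) (𝒞.analyticOnNhd_pull hf.analytic) 0 n x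
    (by simpa using hz)
  have h0 : (fun t : ℝ => 𝒞.pull f (0 + t)) = fun _ => 0 := by
    funext t
    rw [zero_add, 𝒞.pull_eq (ofReal_mem_hStrip 𝒞.ε_pos t)]
    exact hf.dirichlet _ (𝒞.real_mem t)
  rw [h0] at h
  simpa [iteratedDeriv_const] using h.symm

theorem abs_iterate_dir_confWeight_le (n : ℕ) (h0 : 0 ≤ z.im) (h1 : z.im ≤ 𝒞.ε / 2) :
    |(dir 1)^[n] (confWeight 𝒞.Q) z| ≤ 4 * n.factorial / (𝒞.ε / 4) ^ n := by
  have hε := 𝒞.ε_pos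
  set H : ℂ → ℂ := fun w => deriv 𝒞.Q (z + w) *
    (starRingEnd ℂ) (deriv 𝒞.Q (z + (starRingEnd ℂ) w)) with hH
  have hstrip : ∀ w ∈ hStrip (𝒞.ε / 2), z + w ∈ hStrip 𝒞.ε := fun w hw => by
    have hw' := abs_lt.1 (show |w.im| < 𝒞.ε / 2 from hw)
    rw [hStrip, Set.mem_ofPred_eq, Complex.add_im, abs_lt]
    constructor <;> linarith
  have hconj : ∀ w ∈ hStrip (𝒞.ε / 2), (starRingEnd ℂ) w ∈ hStrip (𝒞.ε / 2) := fun w hw => by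
    simpa [hStrip] using hw
  have hd : DifferentiableOn ℂ (fun w => deriv 𝒞.Q (z + w)) (hStrip (𝒞.ε / 2)) :=
    (𝒞.diff.deriv (isOpen_hStrip _)).comp (by fun_prop) hstrip
  have hO := isOpen_hStrip (𝒞.ε / 2)
  have hd' : DifferentiableOn ℂ H (hStrip (𝒞.ε / 2)) := by
    refine hd.mul fun w hw => ?_
    have h1 := (hd.differentiableAt (hO.mem_nhds (hconj w hw))).star_star
    simp only [RCLike.star_def, Complex.conj_conj] at h1
    exact h1.differentiableWithinAt
  have hb : ∀ w ∈ Metric.sphere (0 : ℂ) (𝒞.ε / 4), ‖H w‖ ≤ 4 := fun w hw => by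
    have hw' : w ∈ hStrip (𝒞.ε / 2) := by
      have := Complex.abs_im_le_norm w
      rw [mem_sphere_zero_iff_norm] at hw
      rw [hStrip, Set.mem_ofPred_eq]
      linarith
    rw [hH]
    simp only [norm_mul, RCLike.norm_conj]
    have e1 := 𝒞.deriv_le _ (hstrip w hw')
    have e2 := 𝒞.deriv_le _ (hstrip _ (hconj w hw'))
    nlinarith [norm_nonneg (deriv 𝒞.Q (z + w))]
  have hsub : Metric.closedBall (0 : ℂ) (𝒞.ε / 4) ⊆ hStrip (𝒞.ε / 2) := fun w hw => by
    have := Complex.abs_im_le_norm w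
    rw [mem_closedBall_zero_iff] at hw
    rw [hStrip, Set.mem_ofPred_eq]
    linarith
  have hc := Complex.norm_iteratedDeriv_le_of_forall_mem_sphere_norm_le (c := (0 : ℂ))
    (R := 𝒞.ε / 4) (C := 4) (f := H) n (by positivity)
    ((hd'.mono hsub).diffContOnCl_ball subset_rfl) hb
  have h0' : ((0 : ℝ) : ℂ) ∈ hStrip (𝒞.ε / 2) := ofReal_mem_hStrip (by linarith) 0
  have hz' : z + (0 : ℝ) ∈ hStrip 𝒞.ε := hstrip _ h0'
  have e1 := iteratedDeriv_comp_ofReal hO hd' n 0 h0'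
  have e2 := iteratedDeriv_ofReal_line (isOpen_hStrip _)
    (analyticOnNhd_confWeight (isOpen_hStrip _) 𝒞.diff) z n 0 hz'
  have e3 : (fun t : ℝ => H t) = fun t : ℝ => ((confWeight 𝒞.Q (z + t) : ℝ) : ℂ) := by
    funext t
    simp only [hH, Complex.conj_ofReal, confWeight, Complex.mul_conj]
  rw [e3, e2] at e1
  simp only [Complex.ofReal_zero, add_zero] at e1
  rw [← e1, Complex.norm_real, Real.norm_eq_abs] at hc
  rwa [mul_comm (4 : ℝ)]

theorem tangentialChain (hf : PlaneEigen D lam f U) {β : ℝ} (hβ : β ≤ 𝒞.ε / 2) :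
    TangentialChain 𝒞.ℓ β lam 4 (𝒞.ε / 4) (fun n p => (dir 1)^[n] (𝒞.pull f) (toC p))
      (fun n p => dir Complex.I ((dir 1)^[n] (𝒞.pull f)) (toC p))
      (fun n p => (dir 1)^[n] (confWeight 𝒞.Q) (toC p)) := by
  have hε := 𝒞.ε_pos
  have hv := 𝒞.analyticOnNhd_pull hf.analytic
  have him : ∀ p ∈ rect 𝒞.ℓ β, 0 ≤ (toC p).im ∧ (toC p).im ≤ 𝒞.ε / 2 := fun p hp => by
    rw [toC_im]
    exact ⟨hp.1.2, hp.2.2.trans hβ⟩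
  have hmem : ∀ p ∈ rect 𝒞.ℓ β, toC p ∈ 𝒞.preim U := fun p hp =>
    𝒞.mem_preim hf.closure_subset (him p hp).1 (by linarith [(him p hp).2])
  constructor
  · intro n p hp
    have h := hasPartials_toC (hv.iterate_dir 1 n _ (hmem p hp)).differentiableAt
    simpa only [Function.iterate_succ_apply'] using h
  · intro n p hp
    have h := hasPartials_toC ((hv.iterate_dir 1 n).dir Complex.I _ (hmem p hp)).differentiableAt
    rw [𝒞.iterate_dir_pde hf n (him p hp).1 (by linarith [(him p hp).2]),
      dir_comm (hv.iterate_dir 1 n _ (hmem p hp))] at h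
    simpa only [Function.iterate_succ_apply', leibnizSum] using h
  · intro n p hp
    have h := hasPartials_toC ((analyticOnNhd_confWeight (isOpen_hStrip _) 𝒞.diff).iterate_dir 1 n _
      (hmem p hp).1).differentiableAt
    exact h.continuousAt.continuousWithinAt
  · intro n p hp
    exact 𝒞.abs_iterate_dir_confWeight_le n (him p hp).1 (him p hp).2
  · intro n t
    have e : toC (𝒞.ℓ, t) = toC (0, t) + 𝒞.ℓ := by simp [toC, add_comm]
    simp only [e]
    exact iterate_dir_periodic (𝒞.pull_periodic f) 1 n _
  · intro n s
    have := 𝒞.iterate_dir_pull_real hf n s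
    simpa [toC] using this

/-- The normal derivative of the pullback on the boundary. -/
def normalDeriv (f : ℂ → ℝ) (s : ℝ) : ℝ := dir Complex.I (𝒞.pull f) s

theorem normalDeriv_periodic : Function.Periodic (𝒞.normalDeriv f) 𝒞.ℓ := fun s => by
  have := dir_periodic (𝒞.pull_periodic f) Complex.I s
  simpa [normalDeriv] using this

theorem iteratedDeriv_normalDeriv (hf : PlaneEigen D lam f U) (n : ℕ) (x : ℝ) :
    iteratedDeriv n (𝒞.normalDeriv f) x = dir Complex.I ((dir 1)^[n] (𝒞.pull f)) x ∧
      iteratedDeriv n (fun s => (𝒞.normalDeriv f s : ℂ)) x =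
        (dir Complex.I ((dir 1)^[n] (𝒞.pull f)) x : ℝ) := by
  have hO := 𝒞.isOpen_preim hf.isOpen_U
  have hv := 𝒞.analyticOnNhd_pull hf.analytic
  have hz : (0 : ℂ) + x ∈ 𝒞.preim U := by simpa using 𝒞.real_mem_preim hf.closure_subset x
  have h1 := iteratedDeriv_line hO (hv.dir Complex.I) 0 n x hz
  have h2 := iteratedDeriv_ofReal_line hO (hv.dir Complex.I) 0 n x hz
  rw [← iterate_dir_comm hO hv 1 Complex.I n _ hz] at h1 h2
  simp only [zero_add] at h1 h2
  exact ⟨h1, h2⟩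

theorem analyticOnNhd_normalDeriv (hf : PlaneEigen D lam f U) :
    AnalyticOnNhd ℝ (fun s => (𝒞.normalDeriv f s : ℂ)) Set.univ := fun x _ =>
  (Complex.ofRealCLM.analyticAt _).comp
    (((𝒞.analyticOnNhd_pull hf.analytic).dir Complex.I _
      (𝒞.real_mem_preim hf.closure_subset x)).comp (Complex.ofRealCLM.analyticAt x))

/-- Cauchy bounds for the normal derivative in terms of the `L²` norm on the collar. -/
theorem exists_iteratedDeriv_normalDeriv_le : ∃ β, 0 < β ∧ β < 𝒞.ε ∧ ∃ K > 0, ∃ r > 0,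
    ∀ (lam : ℝ) (f : ℂ → ℝ) (U : Set ℂ), 0 ≤ lam → PlaneEigen D lam f U → ∀ n y,
      ‖iteratedDeriv n (fun s => (𝒞.normalDeriv f s : ℂ)) y‖ ≤
        √(∫ p in rect 𝒞.ℓ β, 𝒞.pull f (toC p) ^ 2) * K * exp lam * n.factorial / r ^ n := by
  have hε := 𝒞.ε_pos
  have hβ0 : 0 < min 1 (𝒞.ε / 2) := by positivity
  obtain ⟨K, hK, A, hA, h⟩ := exists_abs_normal_derivative_le (C₀ := 4) 𝒞.ℓ_pos hβ0
    (min_le_left _ _) (by norm_num) (by positivity : 0 < 𝒞.ε / 4)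
  refine ⟨min 1 (𝒞.ε / 2), hβ0, (min_le_right _ _).trans_lt (by linarith), K, hK, A⁻¹,
    inv_pos.2 hA, fun lam f U hlam hf n y => ?_⟩
  have hc := 𝒞.tangentialChain hf (min_le_right 1 (𝒞.ε / 2))
  obtain ⟨s, hs, hsy⟩ := (show Function.Periodic (fun y : ℝ =>
      dir Complex.I ((dir 1)^[n] (𝒞.pull f)) y) 𝒞.ℓ from fun y => by
    have := dir_periodic (iterate_dir_periodic (𝒞.pull_periodic f) 1 n) Complex.I y
    simpa using this).exists_mem_Ico₀ 𝒞.ℓ_pos y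
  have h1 := h lam _ _ _ hlam hc n s ⟨hs.1, hs.2.le⟩
  rw [(𝒞.iteratedDeriv_normalDeriv hf n y).2, hsy, Complex.norm_real, Real.norm_eq_abs]
  simp only [TangentialChain.energy, mul_zero, pow_zero, one_mul, Function.iterate_zero, id_eq] at h1
  rw [inv_pow, div_inv_eq_mul]
  simpa [toC] using h1

end Collar

namespace Collar

variable {D U : Set ℂ} (𝒞 : Collar D)

theorem norm_Q_sub_le (x y : ℝ) : ‖𝒞.Q y - 𝒞.Q x‖ ≤ 2 * |y - x| := by
  have := (convex_im_Ioo (-𝒞.ε) 𝒞.ε).norm_image_sub_le_of_norm_deriv_le (f := 𝒞.Q) (C := 2)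
    (x := (x : ℂ)) (y := (y : ℂ)) (fun w hw => (𝒞.analyticAt_Q (by rwa [hStrip_eq])).differentiableAt)
    (fun w hw => 𝒞.deriv_le w (by rwa [hStrip_eq])) (by simpa using 𝒞.ε_pos)
    (by simpa using 𝒞.ε_pos)
  rwa [← Complex.ofReal_sub, Complex.norm_real] at this

theorem exists_Ico_eq {z : ℂ} (hz : z ∈ frontier D) : ∃ x ∈ Set.Ico 0 𝒞.ℓ, 𝒞.Q (x : ℝ) = z := by
  obtain ⟨x, rfl⟩ := 𝒞.surj z hz
  obtain ⟨n, hn⟩ := exists_int_add_mem_Ico 𝒞.ℓ_pos (x : ℂ)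
  refine ⟨x + n * 𝒞.ℓ, by simpa using hn, ?_⟩
  have := periodic_int 𝒞.periodic n x (ofReal_mem_hStrip 𝒞.ε_pos x)
  push_cast
  exact this

theorem isCompact_frontier (𝒞 : Collar D) : IsCompact (frontier D) := by
  have : frontier D = (fun x : ℝ => 𝒞.Q x) '' Set.Icc 0 𝒞.ℓ := by
    ext z
    constructor
    · intro hz
      obtain ⟨x, hx, rfl⟩ := 𝒞.exists_Ico_eq hz
      exact ⟨x, Set.Ico_subset_Icc_self hx, rfl⟩
    · rintro ⟨x, -, rfl⟩
      exact 𝒞.real_mem x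
  rw [this]
  refine isCompact_Icc.image ?_
  refine continuous_iff_continuousAt.2 fun x => ?_
  exact (𝒞.analyticAt_Q (ofReal_mem_hStrip 𝒞.ε_pos x)).continuousAt.comp
    Complex.continuous_ofReal.continuousAt

theorem volume_cthickening_frontier_le (𝒞 : Collar D) {h : ℝ} (h0 : 0 < h) (h1 : h ≤ 1) :
    volume.real (Metric.cthickening h (frontier D)) ≤ 9 * π * (𝒞.ℓ + 1) * h := by
  set N := ⌊𝒞.ℓ / h⌋₊ + 1 with hN
  have hsub : Metric.cthickening h (frontier D) ⊆
      ⋃ k ∈ Finset.range N, Metric.closedBall (𝒞.Q ((k * h : ℝ) : ℂ)) (3 * h) := by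
    rw [𝒞.isCompact_frontier.cthickening_eq_biUnion_closedBall h0.le]
    refine Set.iUnion₂_subset fun z hz w hw => ?_
    obtain ⟨x, hx, rfl⟩ := 𝒞.exists_Ico_eq hz
    refine Set.mem_iUnion₂.2 ⟨⌊x / h⌋₊, ?_, ?_⟩
    · rw [Finset.mem_range, hN, Nat.lt_succ_iff]
      exact Nat.floor_le_floor (by gcongr; exact hx.2.le)
    · have a1 := Nat.floor_le (div_nonneg hx.1 h0.le)
      have a2 := Nat.lt_floor_add_one (x / h)
      rw [le_div_iff₀ h0] at a1
      rw [div_lt_iff₀ h0] at a2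
      have := 𝒞.norm_Q_sub_le (⌊x / h⌋₊ * h) x
      rw [abs_of_nonneg (by linarith)] at this
      rw [Metric.mem_closedBall] at hw ⊢
      calc dist w _ ≤ dist w (𝒞.Q x) + dist (𝒞.Q x) _ := dist_triangle _ _ _
        _ ≤ h + 2 * (x - ⌊x / h⌋₊ * h) := by rw [dist_eq_norm (𝒞.Q x)]; gcongr
        _ ≤ 3 * h := by nlinarith
  have hball : ∀ k : ℕ, volume.real (Metric.closedBall (𝒞.Q ((k * h : ℝ) : ℂ)) (3 * h)) =
      9 * π * h ^ 2 := by
    intro k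
    rw [Measure.real, Complex.volume_closedBall, ENNReal.toReal_mul, ENNReal.toReal_pow,
      ENNReal.toReal_ofReal (by positivity : 0 ≤ 3 * h)]
    simp only [ENNReal.coe_toReal, NNReal.coe_real_pi]
    ring
  calc volume.real (Metric.cthickening h (frontier D))
      ≤ volume.real (⋃ k ∈ Finset.range N, Metric.closedBall (𝒞.Q ((k * h : ℝ) : ℂ)) (3 * h)) := by
        refine measureReal_mono hsub (ne_of_lt ?_)
        refine (measure_biUnion_lt_top (Finset.finite_toSet _) fun k _ => ?_)
        exact (isCompact_closedBall _ _).measure_lt_top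
    _ ≤ ∑ k ∈ Finset.range N, volume.real (Metric.closedBall (𝒞.Q ((k * h : ℝ) : ℂ)) (3 * h)) :=
        measureReal_biUnion_finset_le _ _
    _ = N * (9 * π * h ^ 2) := by rw [Finset.sum_congr rfl fun k _ => hball k]; simp
    _ ≤ (𝒞.ℓ / h + 1) * (9 * π * h ^ 2) := by
        gcongr
        rw [hN]; push_cast
        have := Nat.floor_le (div_nonneg 𝒞.ℓ_pos.le h0.le)
        gcongr
    _ = 9 * π * (𝒞.ℓ + h) * h := by field_simp
    _ ≤ _ := by gcongr

end Collar

theorem IsPreconnected.subset_or_subset_compl_of_frontier {X : Type*} [TopologicalSpace X]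
    {s D : Set X} (hs : IsPreconnected s) (h : Disjoint s (frontier D)) :
    s ⊆ interior D ∨ s ⊆ (closure D)ᶜ := by
  refine isPreconnected_iff_subset_of_disjoint.1 hs _ _ isOpen_interior isClosed_closure.isOpen_compl
    (fun x hx => ?_) ?_
  · have := Set.disjoint_left.1 h hx
    rw [frontier, Set.mem_sdiff] at this
    by_cases hx' : x ∈ closure D
    · exact Or.inl (not_not.1 fun h' => this ⟨hx', h'⟩)
    · exact Or.inr hx'
  · rw [Set.eq_empty_iff_forall_notMem]
    exact fun x hx => hx.2.2 (interior_subset_closure hx.2.1)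

theorem segment_subset_of_notMem_cthickening {D : Set ℂ} {z v : ℂ} {h : ℝ}
    (hz : z ∉ Metric.cthickening h (frontier D)) (hv : ‖v‖ ≤ h) :
    segment ℝ z (z + v) ⊆ D ∨ segment ℝ z (z + v) ⊆ Dᶜ := by
  refine (IsPreconnected.subset_or_subset_compl_of_frontier (convex_segment z (z + v)).isPreconnected
    (Set.disjoint_left.2 fun y hy hyf => hz ?_)).imp (fun h' => h'.trans interior_subset)
    (fun h' => h'.trans (Set.compl_subset_compl.2 subset_closure))
  refine Metric.mem_cthickening_of_dist_le _ _ _ _ hyf ?_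
  have := norm_sub_le_of_mem_segment hy
  rw [add_sub_cancel_left] at this
  rw [dist_comm, dist_eq_norm]
  exact this.trans hv

section DiffQuotient

variable {D U : Set ℂ} {g : ℂ → ℝ} {e : ℂ}

/-- The difference quotient of `g` extended by zero, away from the boundary layer of width `h`. -/
def innerQuotient (D : Set ℂ) (g : ℂ → ℝ) (e : ℂ) (h : ℝ) : ℂ → ℝ :=
  (Metric.cthickening h (frontier D))ᶜ.indicator
    fun z => h⁻¹ * (D.indicator g (z + h * e) - D.indicator g z)

theorem integrable_indicator (hD : IsOpen D) (hb : Bornology.IsBounded D) (hU : closure D ⊆ U)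
    (hg : ContinuousOn g U) : Integrable (D.indicator g) := by
  rw [integrable_indicator_iff hD.measurableSet]
  exact ((hg.mono hU).integrableOn_compact hb.isCompact_closure).mono_set subset_closure

theorem abs_integral_innerQuotient_le (hD : IsOpen D) (hb : Bornology.IsBounded D)
    (hU : closure D ⊆ U) (hg : ContinuousOn g U) (he : ‖e‖ = 1) {h S : ℝ} (h0 : 0 < h)
    (hS : ∀ z ∈ D, z ∈ Metric.cthickening (2 * h) (frontier D) → |g z| ≤ S) (hS0 : 0 ≤ S) :
    |∫ z, innerQuotient D g e h z| ≤
      h⁻¹ * (2 * S) * volume.real (Metric.cthickening h (frontier D)) := by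
  set L := Metric.cthickening h (frontier D) with hL
  have hLm : MeasurableSet L := Metric.isClosed_cthickening.measurableSet
  have hLfin : volume L < ⊤ :=
    (hb.isCompact_closure.of_isClosed_subset isClosed_frontier
      frontier_subset_closure).cthickening.measure_lt_top
  have hG := integrable_indicator hD hb hU hg
  set q : ℂ → ℝ := fun z => h⁻¹ * (D.indicator g (z + h * e) - D.indicator g z) with hq
  have hqi : Integrable q := ((hG.comp_add_right _).sub hG).const_mul _
  have hq0 : ∫ z, q z = 0 := by
    rw [hq, integral_const_mul, integral_sub (hG.comp_add_right _) hG,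
      integral_add_right_eq_self (fun z => D.indicator g z), sub_self, mul_zero]
  have hsplit := integral_add_compl hLm hqi
  have hI : ∫ z, innerQuotient D g e h z = -∫ z in L, q z := by
    rw [innerQuotient, integral_indicator hLm.compl]
    linarith
  have hGS : ∀ z ∈ Metric.cthickening (2 * h) (frontier D), |D.indicator g z| ≤ S := by
    intro z hz
    by_cases hzD : z ∈ D
    · rw [Set.indicator_of_mem hzD]; exact hS z hzD hz
    · rw [Set.indicator_of_notMem hzD, abs_zero]; exact hS0
  rw [hI, abs_neg]
  refine norm_setIntegral_le_of_norm_le_const (f := q) (μ := volume) hLfin fun z hz => ?_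
  rw [hq, Real.norm_eq_abs, abs_mul, abs_of_pos (inv_pos.2 h0)]
  gcongr
  have h1 := hGS z (Metric.cthickening_mono (by linarith) _ hz)
  have h2 : |D.indicator g (z + h * e)| ≤ S := by
    refine hGS _ ?_
    have h3 : z + h * e ∈ Metric.cthickening h L := by
      refine Metric.mem_cthickening_of_dist_le _ z _ _ hz ?_
      rw [dist_eq_norm, add_sub_cancel_left, norm_mul, he, mul_one, Complex.norm_real,
        Real.norm_eq_abs, abs_of_pos h0]
    have := Metric.cthickening_cthickening_subset h0.le h0.le (frontier D) h3
    rwa [← two_mul] at this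
  calc _ ≤ |D.indicator g (z + h * e)| + |D.indicator g z| := abs_sub _ _
    _ ≤ 2 * S := by linarith

theorem innerQuotient_bound (hU : closure D ⊆ U) (hg : AnalyticOnNhd ℝ g U) (he : ‖e‖ = 1)
    {M h : ℝ} (hM : ∀ z ∈ closure D, ‖fderiv ℝ g z‖ ≤ M) (h0 : 0 < h) (z : ℂ) :
    ‖innerQuotient D g e h z‖ ≤ D.indicator (fun _ => M) z := by
  by_cases hz : z ∈ Metric.cthickening h (frontier D)
  · rw [innerQuotient, Set.indicator_of_notMem (by simpa using hz), norm_zero]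
    refine Set.indicator_nonneg (fun w hw => ?_) _
    exact (norm_nonneg _).trans (hM w (subset_closure hw))
  have hv : ‖(h : ℂ) * e‖ = h := by
    rw [norm_mul, he, mul_one, Complex.norm_real, Real.norm_eq_abs, abs_of_pos h0]
  rw [innerQuotient, Set.indicator_of_mem (by simpa using hz)]
  rcases segment_subset_of_notMem_cthickening hz hv.le with hs | hs
  · have h1 := hs (left_mem_segment ℝ z (z + h * e))
    have h2 := hs (right_mem_segment ℝ z (z + h * e))
    rw [Set.indicator_of_mem h1, Set.indicator_of_mem h1, Set.indicator_of_mem h2]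
    have := (convex_segment z (z + h * e)).norm_image_sub_le_of_norm_fderiv_le (𝕜 := ℝ) (f := g)
      (C := M)
      (fun w hw => (hg w (hU (subset_closure (hs hw)))).differentiableAt)
      (fun w hw => hM w (subset_closure (hs hw))) (left_mem_segment ℝ z (z + h * e))
      (right_mem_segment ℝ z (z + h * e))
    rw [add_sub_cancel_left, hv] at this
    rw [norm_mul, Real.norm_eq_abs, abs_of_pos (inv_pos.2 h0), inv_mul_le_iff₀ h0]
    linarith
  · have h1 : z ∉ D := hs (left_mem_segment ℝ z (z + h * e))
    have h2 : z + h * e ∉ D := hs (right_mem_segment ℝ z (z + h * e))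
    rw [Set.indicator_of_notMem h1, Set.indicator_of_notMem h1, Set.indicator_of_notMem h2]
    simp

theorem tendsto_innerQuotient (hD : IsOpen D) (hU : closure D ⊆ U) (hg : AnalyticOnNhd ℝ g U)
    (he : ‖e‖ = 1) (z : ℂ) :
    Filter.Tendsto (fun h => innerQuotient D g e h z) (nhdsWithin 0 (Set.Ioi 0))
      (nhds (D.indicator (dir e g) z)) := by
  by_cases hz : z ∈ D
  · obtain ⟨r, hr, hball⟩ := Metric.isOpen_iff.1 hD z hz
    rw [Set.indicator_of_mem hz]
    have hl := (hasDerivAt_line (hg z (hU (subset_closure hz))).differentiableAt 0 (e := e) (y := z)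
      (by simp)).tendsto_slope_zero_right
    refine hl.congr' ?_
    filter_upwards [Ioo_mem_nhdsGT hr] with h hh
    have hnot : z ∉ Metric.cthickening h (frontier D) := by
      intro hcon
      rw [Metric.mem_cthickening_iff] at hcon
      obtain ⟨y, hy, hzy⟩ := Metric.infEDist_lt_iff.1 (lt_of_le_of_lt hcon
        ((ENNReal.ofReal_lt_ofReal_iff hr).2 hh.2))
      rw [edist_dist, ENNReal.ofReal_lt_ofReal_iff hr] at hzy
      have hyD : y ∈ D := hball (by rwa [Metric.mem_ball, dist_comm])
      rw [hD.frontier_eq] at hy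
      exact hy.2 hyD
    have hmem : z + h * e ∈ D := by
      refine hball ?_
      rw [Metric.mem_ball, dist_eq_norm, add_sub_cancel_left, norm_mul, he, mul_one,
        Complex.norm_real, Real.norm_eq_abs, abs_of_pos hh.1]
      exact hh.2
    rw [innerQuotient, Set.indicator_of_mem (by simpa using hnot), Set.indicator_of_mem hz,
      Set.indicator_of_mem hmem]
    simp
  · rw [Set.indicator_of_notMem hz]
    refine tendsto_const_nhds.congr' ?_
    filter_upwards [self_mem_nhdsWithin] with h hh
    by_cases hz' : z ∈ Metric.cthickening h (frontier D)
    · rw [innerQuotient, Set.indicator_of_notMem (by simpa using hz')]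
    · rw [innerQuotient, Set.indicator_of_mem (by simpa using hz')]
      rcases segment_subset_of_notMem_cthickening hz' (v := h * e) (by
        rw [norm_mul, he, mul_one, Complex.norm_real, Real.norm_eq_abs, abs_of_pos hh]) with hs | hs
      · exact absurd (hs (left_mem_segment ℝ z (z + h * e))) hz
      · have h2 : z + h * e ∉ D := hs (right_mem_segment ℝ z (z + h * e))
        rw [Set.indicator_of_notMem hz, Set.indicator_of_notMem h2]
        simp

theorem Collar.abs_integral_dir_le (𝒞 : Collar D) (hD : IsOpen D) (hb : Bornology.IsBounded D)
    (hUo : IsOpen U) (hU : closure D ⊆ U) (hg : AnalyticOnNhd ℝ g U) (he : ‖e‖ = 1) {B : ℝ}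
    (hB0 : 0 ≤ B) (hB : ∀ z ∈ frontier D, |g z| ≤ B) :
    |∫ z in D, dir e g z| ≤ 18 * π * (𝒞.ℓ + 1) * B := by
  have hcpt := hb.isCompact_closure
  obtain ⟨M, hM⟩ := hcpt.exists_bound_of_continuousOn (f := fderiv ℝ g)
    (fun z hz => (hg z (hU hz)).fderiv.continuousAt.continuousWithinAt)
  have hlim : Filter.Tendsto (fun h => ∫ z, innerQuotient D g e h z) (nhdsWithin 0 (Set.Ioi 0))
      (nhds (∫ z, D.indicator (dir e g) z)) := by
    refine tendsto_integral_filter_of_dominated_convergence (D.indicator fun _ => M) ?_ ?_ ?_ ?_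
    · refine Filter.Eventually.of_forall fun h => ?_
      have hG := integrable_indicator hD hb hU hg.continuousOn
      exact ((((hG.comp_add_right (h * e)).sub hG).const_mul h⁻¹).indicator
        Metric.isClosed_cthickening.measurableSet.compl).aestronglyMeasurable
    · filter_upwards [self_mem_nhdsWithin] with h hh
      exact Filter.Eventually.of_forall fun z => innerQuotient_bound hU hg he hM hh z
    · exact integrable_indicator hD hb (subset_refl _) continuousOn_const
    · exact Filter.Eventually.of_forall fun z => tendsto_innerQuotient hD hU hg he z
  rw [integral_indicator hD.measurableSet] at hlim
  have key : ∀ η > 0, |∫ z in D, dir e g z| ≤ 18 * π * (𝒞.ℓ + 1) * (B + η) := by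
    intro η hη
    have hO : IsOpen (U ∩ (fun z => |g z|) ⁻¹' Set.Iio (B + η)) :=
      (continuous_abs.comp_continuousOn hg.continuousOn).isOpen_inter_preimage hUo isOpen_Iio
    obtain ⟨δ, hδ, hsub⟩ := 𝒞.isCompact_frontier.exists_cthickening_subset_open hO fun z hz =>
      ⟨hU (frontier_subset_closure hz), lt_of_le_of_lt (hB z hz) (by linarith)⟩
    refine le_of_tendsto hlim.abs ?_
    filter_upwards [Ioo_mem_nhdsGT (lt_min (half_pos hδ) one_pos)] with h hh
    have hh1 : h ≤ 1 := hh.2.le.trans (min_le_right _ _)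
    have hh2 : 2 * h ≤ δ := by have := hh.2.le.trans (min_le_left _ _); linarith
    refine (abs_integral_innerQuotient_le hD hb hU hg.continuousOn he hh.1 (S := B + η)
      (fun z _ hz => (hsub (Metric.cthickening_mono hh2 _ hz)).2.le) (by linarith)).trans ?_
    calc _ ≤ h⁻¹ * (2 * (B + η)) * (9 * π * (𝒞.ℓ + 1) * h) := by
          have := 𝒞.volume_cthickening_frontier_le hh.1 hh1
          have := inv_pos.2 hh.1
          gcongr
      _ = _ := by have := hh.1.ne'; field_simp; ring
  have h3 : Filter.Tendsto (fun η => 18 * π * (𝒞.ℓ + 1) * (B + η)) (nhdsWithin 0 (Set.Ioi 0))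
      (nhds (18 * π * (𝒞.ℓ + 1) * (B + 0))) := by
    refine Filter.Tendsto.mono_left ?_ nhdsWithin_le_nhds
    exact (by fun_prop : Continuous fun η : ℝ => 18 * π * (𝒞.ℓ + 1) * (B + η)).tendsto 0
  rw [add_zero] at h3
  refine ge_of_tendsto h3 ?_
  filter_upwards [self_mem_nhdsWithin] with η hη using key η hη

end DiffQuotient

section Rellich

variable {D U : Set ℂ} {f : ℂ → ℝ} {lam : ℝ}

/-- A component of the vector field `2 (z·∇f) ∇f - |∇f|² z + lam² f² z`; `c` and `e` select the
component. -/
def rellichField (lam : ℝ) (f : ℂ → ℝ) (L : ℂ →L[ℝ] ℝ) (e z : ℂ) : ℝ :=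
  2 * (z.re * dir 1 f z + z.im * dir Complex.I f z) * dir e f z -
    (dir 1 f z ^ 2 + dir Complex.I f z ^ 2) * L z + lam ^ 2 * f z ^ 2 * L z

theorem analyticOnNhd_rellichField (hf : AnalyticOnNhd ℝ f U) (L : ℂ →L[ℝ] ℝ) (e : ℂ) :
    AnalyticOnNhd ℝ (rellichField lam f L e) U := by
  have hre : AnalyticOnNhd ℝ (fun z : ℂ => z.re) U := Complex.reCLM.analyticOnNhd _
  have him : AnalyticOnNhd ℝ (fun z : ℂ => z.im) U := Complex.imCLM.analyticOnNhd _
  have hL : AnalyticOnNhd ℝ (fun z : ℂ => L z) U := L.analyticOnNhd _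
  exact (((analyticOnNhd_const.mul ((hre.mul (hf.dir 1)).add (him.mul (hf.dir _)))).mul
    (hf.dir e)).sub ((((hf.dir 1).pow 2).add ((hf.dir _).pow 2)).mul hL)).add
    ((analyticOnNhd_const.mul (hf.pow 2)).mul hL)

theorem dir_rellichField {z : ℂ} (hf : AnalyticAt ℝ f z) (L : ℂ →L[ℝ] ℝ) (e a : ℂ) :
    dir a (rellichField lam f L e) z =
      2 * (a.re * dir 1 f z + z.re * dir a (dir 1 f) z + (a.im * dir Complex.I f z +
        z.im * dir a (dir Complex.I f) z)) * dir e f z +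
      2 * (z.re * dir 1 f z + z.im * dir Complex.I f z) * dir a (dir e f) z -
      (2 * dir 1 f z * dir a (dir 1 f) z + 2 * dir Complex.I f z * dir a (dir Complex.I f) z) * L z -
      (dir 1 f z ^ 2 + dir Complex.I f z ^ 2) * L a +
      2 * lam ^ 2 * f z * dir a f z * L z + lam ^ 2 * f z ^ 2 * L a := by
  have hre : HasFDerivAt (fun z : ℂ => z.re) Complex.reCLM z := Complex.reCLM.hasFDerivAt
  have him : HasFDerivAt (fun z : ℂ => z.im) Complex.imCLM z := Complex.imCLM.hasFDerivAt
  have hL : HasFDerivAt (fun z : ℂ => L z) L z := L.hasFDerivAt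
  have h1 := (hf.dir 1).differentiableAt.hasFDerivAt
  have hI := (hf.dir Complex.I).differentiableAt.hasFDerivAt
  have he := (hf.dir e).differentiableAt.hasFDerivAt
  have h0 := hf.differentiableAt.hasFDerivAt
  have H : HasFDerivAt (rellichField lam f L e) _ z :=
    (((((hre.mul h1).add (him.mul hI)).const_mul 2).mul he).sub
      ((((h1.pow 2).add (hI.pow 2))).mul hL)).add (((h0.pow 2).const_mul (lam ^ 2)).mul hL)
  rw [dir, H.fderiv]
  simp only [add_apply, sub_apply, smul_apply, smul_eq_mul, Complex.reCLM_apply, Complex.imCLM_apply,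
    Pi.add_apply, Pi.mul_apply]
  simp only [← dir.eq_1]
  simp
  ring

theorem PlaneEigen.div_rellichField (hf : PlaneEigen D lam f U) {z : ℂ} (hz : z ∈ D) :
    dir 1 (rellichField lam f Complex.reCLM 1) z +
      dir Complex.I (rellichField lam f Complex.imCLM Complex.I) z = 2 * lam ^ 2 * f z ^ 2 := by
  have ha := hf.analytic z (hf.closure_subset (subset_closure hz))
  rw [dir_rellichField ha, dir_rellichField ha]
  have hc := dir_comm ha 1 Complex.I
  have hp := hf.pde z hz
  simp only [Complex.reCLM_apply, Complex.imCLM_apply, Complex.one_re, Complex.one_im,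
    Complex.I_re, Complex.I_im]
  rw [← hc] at *
  linear_combination 2 * (z.re * dir 1 f z + z.im * dir Complex.I f z) * hp

theorem abs_rellichField_le {z e : ℂ} {L : ℂ →L[ℝ] ℝ} {R m : ℝ} (hz : ‖z‖ ≤ R) (hL : |L z| ≤ R)
    (h0 : f z = 0) (h1 : |dir 1 f z| ≤ m) (hI : |dir Complex.I f z| ≤ m) (he : |dir e f z| ≤ m) :
    |rellichField lam f L e z| ≤ 6 * R * m ^ 2 := by
  have hm : 0 ≤ m := (abs_nonneg _).trans h1
  have hR : 0 ≤ R := (norm_nonneg _).trans hz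
  have hx := (Complex.abs_re_le_norm z).trans hz
  have hy := (Complex.abs_im_le_norm z).trans hz
  rw [rellichField, h0]
  have e1 : |z.re * dir 1 f z| ≤ R * m := by rw [abs_mul]; gcongr
  have e2 : |z.im * dir Complex.I f z| ≤ R * m := by rw [abs_mul]; gcongr
  have e3 : |2 * (z.re * dir 1 f z + z.im * dir Complex.I f z) * dir e f z| ≤ (2 * (R * m + R * m)) * m := by
    rw [abs_mul, abs_mul, abs_two]
    have := (abs_add_le (z.re * dir 1 f z) (z.im * dir Complex.I f z)).trans (add_le_add e1 e2)
    gcongr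
  have e4 : |(dir 1 f z ^ 2 + dir Complex.I f z ^ 2) * L z| ≤ (m ^ 2 + m ^ 2) * R := by
    rw [abs_mul, abs_of_nonneg (by positivity)]
    have := pow_le_pow_left₀ (abs_nonneg _) h1 2
    have := pow_le_pow_left₀ (abs_nonneg _) hI 2
    rw [sq_abs] at *
    gcongr
  have := abs_sub (2 * (z.re * dir 1 f z + z.im * dir Complex.I f z) * dir e f z)
    ((dir 1 f z ^ 2 + dir Complex.I f z ^ 2) * L z)
  have e5 : ∀ s : ℝ, s + lam ^ 2 * 0 ^ 2 * L z = s := fun s => by ring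
  rw [e5]
  linarith

theorem Collar.abs_dir_frontier_le (𝒞 : Collar D) (hf : PlaneEigen D lam f U) {e : ℂ} (he : ‖e‖ = 1)
    (x : ℝ) : |dir e f (𝒞.Q x)| ≤ 2 * |𝒞.normalDeriv f x| := by
  have hx := ofReal_mem_hStrip 𝒞.ε_pos x
  have hne : deriv 𝒞.Q x ≠ 0 := by
    have := 𝒞.le_deriv x hx
    intro h; rw [h, norm_zero] at this; norm_num at this
  have hfx : AnalyticAt ℝ f (𝒞.Q x) :=
    hf.analytic _ (hf.closure_subset (frontier_subset_closure (𝒞.real_mem x)))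
  have h1 : dir e f (𝒞.Q x) = (e / deriv 𝒞.Q x).im * 𝒞.normalDeriv f x := by
    have h2 := fderiv_comp_conformal hfx.differentiableAt (𝒞.analyticAt_Q hx).differentiableAt
      (e / deriv 𝒞.Q x)
    rw [mul_div_cancel₀ _ hne, ← (𝒞.pull_eventuallyEq hx).fderiv_eq] at h2
    rw [dir, ← h2, fderiv_eq_dir]
    have h3 : dir 1 (𝒞.pull f) x = 0 := 𝒞.iterate_dir_pull_real hf 1 x
    rw [h3, mul_zero, zero_add]
    rfl
  rw [h1, abs_mul]
  gcongr
  refine (Complex.abs_im_le_norm _).trans ?_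
  rw [norm_div, he, div_le_iff₀ (norm_pos_iff.2 hne)]
  linarith [𝒞.le_deriv x hx]

/-- Rellich's identity bounds the mass of an eigenfunction by its normal derivative. -/
theorem Collar.exists_rellich_le (𝒞 : Collar D) (hD : IsOpen D) (hb : Bornology.IsBounded D) :
    ∃ C > 0, ∀ lam f U, PlaneEigen D lam f U → ∀ m, (∀ x, |𝒞.normalDeriv f x| ≤ m) →
      lam ^ 2 * ∫ z in D, f z ^ 2 ≤ C * m ^ 2 := by
  obtain ⟨R, hR0, hR⟩ := hb.closure.exists_pos_norm_le
  refine ⟨18 * π * (𝒞.ℓ + 1) * (6 * R * 4), by have := 𝒞.ℓ_pos; positivity, ?_⟩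
  intro lam f U hf m hm
  have hbd : ∀ {e : ℂ}, ‖e‖ = 1 → ∀ z ∈ frontier D, |dir e f z| ≤ 2 * m := by
    intro e he z hz
    obtain ⟨x, rfl⟩ := 𝒞.surj z hz
    exact (𝒞.abs_dir_frontier_le hf he x).trans (by linarith [hm x])
  have hI : ‖Complex.I‖ = 1 := Complex.norm_I
  have h1 : ‖(1 : ℂ)‖ = 1 := norm_one
  have hF1 := analyticOnNhd_rellichField (lam := lam) hf.analytic Complex.reCLM 1
  have hF2 := analyticOnNhd_rellichField (lam := lam) hf.analytic Complex.imCLM Complex.I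
  have i1 := 𝒞.abs_integral_dir_le hD hb hf.isOpen_U hf.closure_subset hF1 h1
    (B := 6 * R * (2 * m) ^ 2) (by positivity) fun z hz => by
      have hz' := hR z (frontier_subset_closure hz)
      exact abs_rellichField_le hz' ((Complex.abs_re_le_norm z).trans hz') (hf.dirichlet z hz)
        (hbd h1 z hz) (hbd hI z hz) (hbd h1 z hz)
  have i2 := 𝒞.abs_integral_dir_le hD hb hf.isOpen_U hf.closure_subset hF2 hI
    (B := 6 * R * (2 * m) ^ 2) (by positivity) fun z hz => by
      have hz' := hR z (frontier_subset_closure hz)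
      exact abs_rellichField_le hz' ((Complex.abs_im_le_norm z).trans hz') (hf.dirichlet z hz)
        (hbd h1 z hz) (hbd hI z hz) (hbd hI z hz)
  have hint : ∀ {g : ℂ → ℝ}, AnalyticOnNhd ℝ g U → IntegrableOn g D := fun hg =>
    ((hg.continuousOn.mono hf.closure_subset).integrableOn_compact hb.isCompact_closure).mono_set
      subset_closure
  have hsum : ∫ z in D, 2 * lam ^ 2 * f z ^ 2 =
      (∫ z in D, dir 1 (rellichField lam f Complex.reCLM 1) z) +
      ∫ z in D, dir Complex.I (rellichField lam f Complex.imCLM Complex.I) z := by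
    rw [← integral_add (hint (hF1.dir 1)) (hint (hF2.dir _))]
    exact setIntegral_congr_fun hD.measurableSet fun z hz => (hf.div_rellichField hz).symm
  rw [integral_const_mul] at hsum
  have := le_abs_self (∫ z in D, dir 1 (rellichField lam f Complex.reCLM 1) z)
  have := le_abs_self (∫ z in D, dir Complex.I (rellichField lam f Complex.imCLM Complex.I) z)
  nlinarith

end Rellich

theorem det_restrictScalars_toSpanSingleton (a : ℂ) :
    ((ContinuousLinearMap.toSpanSingleton ℂ a).restrictScalars ℝ).det = Complex.normSq a := by
  have h : (((ContinuousLinearMap.toSpanSingleton ℂ a).restrictScalars ℝ : ℂ →L[ℝ] ℂ) : ℂ →ₗ[ℝ] ℂ) =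
      (LinearMap.mul ℝ ℂ) a := by
    ext
    all_goals simp [mul_comm]
  rw [ContinuousLinearMap.det, h, ← LinearMap.det_toMatrix Complex.basisOneI,
    Matrix.det_fin_two]
  simp [LinearMap.toMatrix_apply, Complex.normSq_apply]

theorem setIntegral_rect_toC (h : ℂ → ℝ) (ℓ β : ℝ) :
    ∫ p in rect ℓ β, h (Collar.toC p) =
      ∫ w in {w : ℂ | w.re ∈ Set.Ioo 0 ℓ ∧ w.im ∈ Set.Ioo 0 β}, h w := by
  have hrect : rect ℓ β =ᵐ[volume] Set.Ioo (0 : ℝ) ℓ ×ˢ Set.Ioo (0 : ℝ) β := by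
    have : rect ℓ β = Set.Icc (0 : ℝ) ℓ ×ˢ Set.Icc (0 : ℝ) β := (Set.Icc_prod_Icc _ _ _ _).symm
    rw [this]
    exact Measure.set_prod_ae_eq Ioo_ae_eq_Icc.symm Ioo_ae_eq_Icc.symm
  rw [setIntegral_congr_set hrect, ← Complex.volume_preserving_equiv_real_prod.setIntegral_preimage_emb
    Complex.measurableEquivRealProd.measurableEmbedding]
  refine setIntegral_congr_fun ?_ fun w _ => ?_
  · exact Complex.measurableEquivRealProd.measurable (measurableSet_Ioo.prod measurableSet_Ioo)
  · simp [Collar.toC, Complex.measurableEquivRealProd_apply, Complex.re_add_im]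

namespace Collar

variable {D U : Set ℂ} {f : ℂ → ℝ} {lam : ℝ} {β : ℝ}

theorem integral_pull_sq_le (𝒞 : Collar D) (hb : Bornology.IsBounded D)
    (hβ : β < 𝒞.ε) (hf : PlaneEigen D lam f U) :
    ∫ p in rect 𝒞.ℓ β, 𝒞.pull f (toC p) ^ 2 ≤ 4 * ∫ z in D, f z ^ 2 := by
  set S : Set ℂ := {w : ℂ | w.re ∈ Set.Ioo 0 𝒞.ℓ ∧ w.im ∈ Set.Ioo 0 β} with hS
  have hSo : IsOpen S :=
    (isOpen_Ioo.preimage Complex.continuous_re).inter (isOpen_Ioo.preimage Complex.continuous_im)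
  have hSε : ∀ w ∈ S, w.im ∈ Set.Ioo 0 𝒞.ε := fun w hw => ⟨hw.2.1, hw.2.2.trans hβ⟩
  have hSs : ∀ w ∈ S, w ∈ hStrip 𝒞.ε := fun w hw =>
    (𝒞.mem_preim subset_rfl (hSε w hw).1.le (hSε w hw).2).1
  have hmaps : 𝒞.Q '' S ⊆ D := by
    rintro _ ⟨w, hw, rfl⟩
    exact 𝒞.inside w (hSε w hw)
  have hinj : Set.InjOn 𝒞.Q S := by
    intro w hw w' hw' h
    obtain ⟨n, hn⟩ := 𝒞.inj w (hSs w hw) w' (hSs w' hw') h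
    have hre : w'.re = w.re + n * 𝒞.ℓ := by rw [hn]; simp
    have h1 : (n : ℝ) * 𝒞.ℓ < 1 * 𝒞.ℓ := by linarith [hw.1.1, hw'.1.2]
    have h2 : (-1) * 𝒞.ℓ < (n : ℝ) * 𝒞.ℓ := by linarith [hw.1.2, hw'.1.1]
    have h3 : n < 1 := by exact_mod_cast lt_of_mul_lt_mul_right h1 𝒞.ℓ_pos.le
    have h4 : -1 < n := by exact_mod_cast lt_of_mul_lt_mul_right h2 𝒞.ℓ_pos.le
    have : n = 0 := by omega
    rw [hn, this]; simp
  have hder : ∀ w ∈ S, HasFDerivWithinAt 𝒞.Q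
      ((ContinuousLinearMap.toSpanSingleton ℂ (deriv 𝒞.Q w)).restrictScalars ℝ) S w := fun w hw =>
    ((𝒞.analyticAt_Q (hSs w hw)).differentiableAt.hasDerivAt.hasFDerivAt.restrictScalars
      ℝ).hasFDerivWithinAt
  have hfi : IntegrableOn (fun z => f z ^ 2) D :=
    (((hf.analytic.pow 2).continuousOn.mono hf.closure_subset).integrableOn_compact
      hb.isCompact_closure).mono_set subset_closure
  have hcv := integral_image_eq_integral_abs_det_fderiv_smul volume hSo.measurableSet hder hinj
    (fun z => f z ^ 2)
  have hint := (integrableOn_image_iff_integrableOn_abs_det_fderiv_smul volume hSo.measurableSet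
    hder hinj (fun z => f z ^ 2)).1 (hfi.mono_set hmaps)
  simp only [det_restrictScalars_toSpanSingleton, smul_eq_mul] at hcv hint
  rw [setIntegral_rect_toC (fun w => 𝒞.pull f w ^ 2)]
  calc ∫ w in S, 𝒞.pull f w ^ 2
      ≤ ∫ w in S, 4 * (|Complex.normSq (deriv 𝒞.Q w)| * f (𝒞.Q w) ^ 2) := by
        refine setIntegral_mono_on₀ ?_ (hint.const_mul 4) hSo.measurableSet.nullMeasurableSet ?_
        · have hK : IsCompact (Set.Icc (0 : ℝ) 𝒞.ℓ ×ℂ Set.Icc (0 : ℝ) β) :=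
            isCompact_Icc.reProdIm isCompact_Icc
          refine (ContinuousOn.integrableOn_compact (K := Set.Icc (0 : ℝ) 𝒞.ℓ ×ℂ Set.Icc (0 : ℝ) β)
            hK fun w hw => ?_).mono_set
            fun w hw => ⟨Set.Ioo_subset_Icc_self hw.1, Set.Ioo_subset_Icc_self hw.2⟩
          have hw' : w ∈ 𝒞.preim U := 𝒞.mem_preim hf.closure_subset hw.2.1 (hw.2.2.trans_lt hβ)
          exact ((𝒞.analyticOnNhd_pull hf.analytic).pow 2 w hw').continuousAt.continuousWithinAt
        · intro w hw
          rw [𝒞.pull_eq (hSs w hw), abs_of_nonneg (Complex.normSq_nonneg _),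
            Complex.normSq_eq_norm_sq]
          have := 𝒞.le_deriv w (hSs w hw)
          nlinarith [sq_nonneg (f (𝒞.Q w)), mul_nonneg
            (by nlinarith : 0 ≤ 4 * ‖deriv 𝒞.Q w‖ ^ 2 - 1) (sq_nonneg (f (𝒞.Q w)))]
    _ = 4 * ∫ z in 𝒞.Q '' S, f z ^ 2 := by rw [integral_const_mul, hcv]
    _ ≤ 4 * ∫ z in D, f z ^ 2 := by
        refine mul_le_mul_of_nonneg_left (setIntegral_mono_set hfi ?_ hmaps.eventuallyLE)
          (by norm_num)
        exact Filter.Eventually.of_forall fun z => sq_nonneg _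

end Collar

section LowerBound

variable {D U : Set ℂ} {f : ℂ → ℝ} {lam : ℝ}

theorem PlaneEigen.integrableOn (hf : PlaneEigen D lam f U) (hb : Bornology.IsBounded D)
    {g : ℂ → ℝ} (hg : AnalyticOnNhd ℝ g U) : IntegrableOn g D :=
  ((hg.continuousOn.mono hf.closure_subset).integrableOn_compact hb.isCompact_closure).mono_set
    subset_closure

theorem PlaneEigen.integral_sq_pos (hf : PlaneEigen D lam f U) (hD : IsOpen D)
    (hb : Bornology.IsBounded D) {z : ℂ} (hz : z ∈ D) (hne : f z ≠ 0) : 0 < ∫ z in D, f z ^ 2 := by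
  rw [setIntegral_pos_iff_support_of_nonneg_ae (Filter.Eventually.of_forall fun z => sq_nonneg _)
    (hf.integrableOn hb (hf.analytic.pow 2))]
  have hcont : ContinuousOn f D := hf.analytic.continuousOn.mono
    (subset_closure.trans hf.closure_subset)
  have ho : IsOpen (D ∩ f ⁻¹' {0}ᶜ) := hcont.isOpen_inter_preimage hD isOpen_compl_singleton
  refine (ho.measure_pos volume ⟨z, hz, hne⟩).trans_le (measure_mono fun w hw => ⟨?_, hw.1⟩)
  exact pow_ne_zero 2 hw.2

theorem Collar.exists_eigenvalue_lower_bound (𝒞 : Collar D) (hD : IsOpen D)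
    (hb : Bornology.IsBounded D) :
    ∃ c > 0, ∀ lam f U, 0 < lam → PlaneEigen D lam f U → (∃ z ∈ D, f z ≠ 0) → c ≤ lam := by
  obtain ⟨R, hR0, hR⟩ := hb.closure.exists_pos_norm_le
  refine ⟨1 / (3 * R), by positivity, fun lam f U hlam hf ⟨z₀, hz₀, hne⟩ => ?_⟩
  by_contra! hlt
  have hpos := hf.integral_sq_pos hD hb hz₀ hne
  set g1 : ℂ → ℝ := fun z => z.re * f z ^ 2 + 4 * R ^ 2 * (f z * dir 1 f z) with hg1
  set gI : ℂ → ℝ := fun z => f z * dir Complex.I f z with hgI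
  have hre : AnalyticOnNhd ℝ (fun z : ℂ => z.re) U := Complex.reCLM.analyticOnNhd _
  have a1 : AnalyticOnNhd ℝ g1 U := (hre.mul (hf.analytic.pow 2)).add
    (analyticOnNhd_const.mul (hf.analytic.mul (hf.analytic.dir 1)))
  have aI : AnalyticOnNhd ℝ gI U := hf.analytic.mul (hf.analytic.dir _)
  have i1 := 𝒞.abs_integral_dir_le hD hb hf.isOpen_U hf.closure_subset a1 norm_one le_rfl
    (fun z hz => by simp [hg1, hf.dirichlet z hz])
  have iI := 𝒞.abs_integral_dir_le hD hb hf.isOpen_U hf.closure_subset aI Complex.norm_I le_rfl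
    (fun z hz => by simp [hgI, hf.dirichlet z hz])
  rw [mul_zero] at i1 iI
  have i1' := abs_nonpos_iff.1 i1
  have iI' := abs_nonpos_iff.1 iI
  have hdiv : ∀ z ∈ D, (1 / 2 - 4 * R ^ 2 * lam ^ 2) * f z ^ 2 ≤
      dir 1 g1 z + 4 * R ^ 2 * dir Complex.I gI z := by
    intro z hz
    have ha := hf.analytic z (hf.closure_subset (subset_closure hz))
    have h0 := ha.differentiableAt.hasFDerivAt
    have h1 := (ha.dir 1).differentiableAt.hasFDerivAt
    have hI := (ha.dir Complex.I).differentiableAt.hasFDerivAt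
    have hx : HasFDerivAt (fun z : ℂ => z.re) Complex.reCLM z := Complex.reCLM.hasFDerivAt
    have H1 : HasFDerivAt g1 _ z := (hx.mul (h0.pow 2)).add ((h0.mul h1).const_mul (4 * R ^ 2))
    have HI : HasFDerivAt gI _ z := h0.mul hI
    have e1 : dir 1 g1 z = f z ^ 2 + 2 * z.re * f z * dir 1 f z +
        4 * R ^ 2 * (dir 1 f z ^ 2 + f z * dir 1 (dir 1 f) z) := by
      rw [dir, H1.fderiv]
      simp only [add_apply, smul_apply, smul_eq_mul, Complex.reCLM_apply]
      simp only [← dir.eq_1]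
      simp
      ring
    have eI : dir Complex.I gI z = dir Complex.I f z ^ 2 + f z * dir Complex.I (dir Complex.I f) z := by
      rw [dir, HI.fderiv]
      simp only [add_apply, smul_apply, smul_eq_mul]
      simp only [← dir.eq_1]
      ring
    have hp := hf.pde z hz
    have hxR := (Complex.abs_re_le_norm z).trans (hR z (subset_closure hz))
    have hx2 : z.re ^ 2 ≤ R ^ 2 := by rw [← sq_abs]; gcongr
    have e2 : dir 1 g1 z + 4 * R ^ 2 * dir Complex.I gI z =
        f z ^ 2 + 2 * z.re * f z * dir 1 f z + 4 * R ^ 2 * (dir 1 f z ^ 2 + dir Complex.I f z ^ 2)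
          - 4 * R ^ 2 * lam ^ 2 * f z ^ 2 := by
      rw [e1, eI]; linear_combination 4 * R ^ 2 * f z * hp
    rw [e2]
    nlinarith [sq_nonneg (f z + 2 * z.re * dir 1 f z), sq_nonneg (R * dir Complex.I f z),
      mul_nonneg (sub_nonneg.2 hx2) (sq_nonneg (dir 1 f z)), sq_nonneg (R * dir 1 f z)]
  have hmono := setIntegral_mono_on
    ((hf.integrableOn hb (hf.analytic.pow 2)).const_mul (1 / 2 - 4 * R ^ 2 * lam ^ 2))
    ((hf.integrableOn hb (a1.dir 1)).add ((hf.integrableOn hb (aI.dir Complex.I)).const_mul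
      (4 * R ^ 2))) hD.measurableSet hdiv
  have hs : ∫ z in D, (dir 1 g1 z + 4 * R ^ 2 * dir Complex.I gI z) = 0 := by
    rw [integral_add (hf.integrableOn hb (a1.dir 1)) ((hf.integrableOn hb
      (aI.dir Complex.I)).const_mul (4 * R ^ 2)), integral_const_mul, i1', iI']
    simp
  have hmono' : (1 / 2 - 4 * R ^ 2 * lam ^ 2) * ∫ z in D, f z ^ 2 ≤ 0 := by
    rw [← integral_const_mul, ← hs]
    exact hmono
  have h3 : lam * (3 * R) < 1 := (lt_div_iff₀ (by positivity)).1 hlt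
  have h4 : 0 < lam * (3 * R) := by positivity
  have h5 : 0 < 1 / 2 - 4 * R ^ 2 * lam ^ 2 := by nlinarith
  exact absurd hmono' (not_le.2 (mul_pos h5 hpos))

end LowerBound

namespace Collar

variable {D U : Set ℂ} {f : ℂ → ℝ} {lam : ℝ}

theorem exists_abs_normalDeriv_max (𝒞 : Collar D) (hf : PlaneEigen D lam f U) :
    ∃ x₀, ∀ x, |𝒞.normalDeriv f x| ≤ |𝒞.normalDeriv f x₀| := by
  have hc : Continuous fun x => |𝒞.normalDeriv f x| := by
    have := continuousOn_univ.1 (𝒞.analyticOnNhd_normalDeriv hf).continuousOn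
    have h2 : (fun x => |𝒞.normalDeriv f x|) = fun x => ‖(𝒞.normalDeriv f x : ℂ)‖ := by
      funext x; simp
    rw [h2]; exact this.norm
  obtain ⟨x₀, -, hx₀⟩ := isCompact_Icc.exists_isMaxOn (Set.nonempty_Icc.2 𝒞.ℓ_pos.le)
    hc.continuousOn
  refine ⟨x₀, fun x => ?_⟩
  obtain ⟨y, hy, hxy⟩ := 𝒞.normalDeriv_periodic.exists_mem_Ico₀ (f := 𝒞.normalDeriv f) 𝒞.ℓ_pos x
  rw [hxy]
  exact hx₀ (Set.Ico_subset_Icc_self hy)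

/-- The real zeros of the normal derivative, counted with multiplicity over one period, number at
most a constant multiple of the frequency. -/
theorem exists_card_zeros_normalDeriv_le (𝒞 : Collar D) (hD : IsOpen D)
    (hb : Bornology.IsBounded D) :
    ∃ C > 0, ∀ lam f U, 0 < lam → PlaneEigen D lam f U → (∃ z ∈ D, f z ≠ 0) →
      ∃ x₀ : ℝ, ∀ s : Multiset ℝ, (∀ p ∈ s, p ∈ Set.Icc x₀ (x₀ + 𝒞.ℓ)) →
        (∀ p ∈ s, ∀ j < s.count p, dir Complex.I ((dir 1)^[j] (𝒞.pull f)) p = 0) →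
        (s.card : ℝ) ≤ C * lam := by
  obtain ⟨c, hc, hlow⟩ := 𝒞.exists_eigenvalue_lower_bound hD hb
  obtain ⟨R, hR, hrel⟩ := 𝒞.exists_rellich_le hD hb
  obtain ⟨β, hβ0, hβ, K, hK, r, hr, hest⟩ := 𝒞.exists_iteratedDeriv_normalDeriv_le
  obtain ⟨a, ha0, ha1, hzero⟩ := exists_norm_apply_le_of_real_zeros (ℓ := 𝒞.ℓ) (half_pos hr)
  have hloga : 0 < -log a := by have := log_neg ha0 ha1; linarith
  set A := 4 * √R * K / c with hA
  have hA0 : 0 < A := by positivity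
  refine ⟨(|log A| / c + 1) / (-log a), by positivity, fun lam f U hlam hf hne => ?_⟩
  obtain ⟨x₀, hx₀⟩ := 𝒞.exists_abs_normalDeriv_max hf
  refine ⟨x₀, fun s hs hord => ?_⟩
  set m := |𝒞.normalDeriv f x₀| with hm
  set J := ∫ z in D, f z ^ 2 with hJ
  obtain ⟨z₀, hz₀, hz₀'⟩ := id hne
  have hJ0 : 0 < J := hf.integral_sq_pos hD hb hz₀ hz₀'
  have hlc : c ≤ lam := hlow lam f U hlam hf hne
  have h1 := hrel lam f U hf m hx₀
  have hm0 : 0 < m := by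
    rcases (abs_nonneg (𝒞.normalDeriv f x₀)).eq_or_lt with h | h
    · rw [hm, ← h] at h1
      have : 0 < lam ^ 2 * J := by positivity
      linarith
    · exact h
  set X := ∫ p in rect 𝒞.ℓ β, 𝒞.pull f (toC p) ^ 2 with hX
  have hXJ : X ≤ 4 * J := 𝒞.integral_pull_sq_le hb hβ hf
  have hsX : √X ≤ 2 * √R * m / lam := by
    rw [Real.sqrt_le_left (by positivity), div_pow, le_div_iff₀ (by positivity), mul_pow, mul_pow,
      sq_sqrt hR.le]
    nlinarith
  obtain ⟨G, hG, hGx, hGb⟩ := exists_strip_extension (𝒞.analyticOnNhd_normalDeriv hf) hr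
    (hest lam f U hlam.le hf)
  have hsub : {w : ℂ | |w.im| < r / 2} ⊆ {w : ℂ | |w.im| < r} := fun w hw =>
    lt_trans hw (half_lt_self hr)
  have hz := hzero G (2 * (√X * K * exp lam)) x₀ (hG.mono hsub) (fun w hw => hGb w hw.le) s hs
    (fun p hp => by
      have hmem : (p : ℂ) ∈ {w : ℂ | |w.im| < r} := by simpa using hr
      have hO : IsOpen {w : ℂ | |w.im| < r} := isOpen_hStrip r
      rw [natCast_le_analyticOrderAt_iff_iteratedDeriv_eq_zero (hG.analyticAt (hO.mem_nhds hmem))]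
      intro j hj
      rw [← iteratedDeriv_comp_ofReal hO hG j p hmem, funext hGx,
        (𝒞.iteratedDeriv_normalDeriv hf j p).2, hord p hp j hj]
      simp)
  rw [hGx, Complex.norm_real, Real.norm_eq_abs, ← hm] at hz
  have h2 : m ≤ m * (A * exp lam * a ^ s.card) := by
    refine hz.trans ?_
    calc 2 * (√X * K * exp lam) * a ^ s.card
        ≤ 2 * (2 * √R * m / c * K * exp lam) * a ^ s.card := by
          have : 2 * √R * m / lam ≤ 2 * √R * m / c := by gcongr
          have := hsX.trans this
          gcongr
      _ = m * (A * exp lam * a ^ s.card) := by rw [hA]; ring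
  have h3 : 1 ≤ A * exp lam * a ^ s.card := by
    by_contra! hlt
    nlinarith
  have h4 := log_le_log one_pos h3
  rw [log_one, log_mul (by positivity) (by positivity), log_mul (by positivity) (by positivity),
    log_exp, log_pow] at h4
  rw [div_mul_eq_mul_div, le_div_iff₀ hloga]
  have h5 : |log A| ≤ |log A| / c * lam := by
    rw [div_mul_eq_mul_div, le_div_iff₀ hc]; gcongr
  have := le_abs_self (log A)
  linarith

end Collar

section Rolle

theorem exists_finset_zeros_deriv {g : ℝ → ℝ} (hg : Differentiable ℝ g) {a b : ℝ} {n : ℕ}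
    {s : Finset ℝ} (hs : s.card = n + 1) (hab : ∀ x ∈ s, x ∈ Set.Icc a b) (hz : ∀ x ∈ s, g x = 0) :
    ∃ t : Finset ℝ, t.card = n ∧ (∀ x ∈ t, x ∈ Set.Icc a b) ∧ ∀ x ∈ t, deriv g x = 0 := by
  set e := s.orderEmbOfFin hs with he
  have hmem : ∀ i, e i ∈ s := fun i => s.orderEmbOfFin_mem hs i
  have h : ∀ i : Fin n, ∃ x ∈ Set.Ioo (e i.castSucc) (e i.succ), deriv g x = 0 := fun i =>
    exists_deriv_eq_zero (e.strictMono Fin.castSucc_lt_succ) hg.continuous.continuousOn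
      ((hz _ (hmem _)).trans (hz _ (hmem _)).symm)
  choose x hx hx0 using h
  have hmono : StrictMono x := by
    intro i j hij
    refine (hx i).2.trans_le (le_trans (e.monotone ?_) (hx j).1.le)
    exact hij
  refine ⟨Finset.univ.map ⟨x, hmono.injective⟩, by simp, ?_, ?_⟩
  · intro y hy
    obtain ⟨i, -, rfl⟩ := Finset.mem_map.1 hy
    exact ⟨(hab _ (hmem _)).1.trans (hx i).1.le, (hx i).2.le.trans (hab _ (hmem _)).2⟩
  · intro y hy
    obtain ⟨i, -, rfl⟩ := Finset.mem_map.1 hy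
    exact hx0 i

theorem exists_iteratedDeriv_eq_zero_of_zeros {a b : ℝ} (j : ℕ) :
    ∀ {g : ℝ → ℝ}, ContDiff ℝ ⊤ g → ∀ {s : Finset ℝ}, j < s.card → (∀ x ∈ s, x ∈ Set.Icc a b) →
      (∀ x ∈ s, g x = 0) → ∃ x ∈ Set.Icc a b, iteratedDeriv j g x = 0 := by
  induction j with
  | zero =>
    intro g _ s hs hab hz
    obtain ⟨x, hx⟩ := Finset.card_pos.1 hs
    exact ⟨x, hab x hx, by simpa using hz x hx⟩
  | succ j ih =>
    intro g hg s hs hab hz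
    obtain ⟨n, hn⟩ : ∃ n, s.card = n + 1 := ⟨s.card - 1, by omega⟩
    obtain ⟨t, ht, htab, htz⟩ := exists_finset_zeros_deriv (hg.differentiable (by simp)) hn hab hz
    have hg' : ContDiff ℝ ⊤ (deriv g) := (contDiff_succ_iff_deriv (n := ⊤).1 hg).2.2
    obtain ⟨x, hx, hx0⟩ := ih hg' (s := t) (by omega) htab htz
    exact ⟨x, hx, by rwa [iteratedDeriv_succ']⟩

end Rolle

namespace Collar

variable {D U : Set ℂ} {f : ℂ → ℝ} {lam : ℝ} {x : ℂ}

theorem im_eq_of_Q_eq (𝒞 : Collar D) {w w' : ℂ} (hw : w ∈ hStrip 𝒞.ε) (hw' : w' ∈ hStrip 𝒞.ε)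
    (h : 𝒞.Q w = 𝒞.Q w') : w'.im = w.im := by
  obtain ⟨n, hn⟩ := 𝒞.inj w hw w' hw' h
  rw [hn]; simp

theorem isOpen_image_Q (𝒞 : Collar D) {O : Set ℂ} (hO : IsOpen O) (hsub : O ⊆ hStrip 𝒞.ε) :
    IsOpen (𝒞.Q '' O) := by
  refine isOpen_iff_mem_nhds.2 ?_
  rintro _ ⟨w, hw, rfl⟩
  have hne : deriv 𝒞.Q w ≠ 0 := by
    have := 𝒞.le_deriv w (hsub hw)
    intro h; rw [h, norm_zero] at this; norm_num at this
  rw [← (𝒞.analyticAt_Q (hsub hw)).hasStrictDerivAt.map_nhds_eq hne]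
  exact Filter.image_mem_map (hO.mem_nhds hw)

theorem isClosed_image_Q (𝒞 : Collar D) {c : ℝ} (hc : c < 𝒞.ε) :
    IsClosed (𝒞.Q '' {w | w.im ∈ Set.Icc 0 c}) := by
  have hsub : ∀ w : ℂ, w.im ∈ Set.Icc 0 c → w ∈ hStrip 𝒞.ε := fun w hw =>
    (𝒞.mem_preim subset_rfl hw.1 (hw.2.trans_lt hc)).1
  have h : 𝒞.Q '' {w | w.im ∈ Set.Icc 0 c} = 𝒞.Q '' (Set.Icc 0 𝒞.ℓ ×ℂ Set.Icc 0 c) := by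
    refine Set.Subset.antisymm ?_ (Set.image_mono fun w hw => hw.2)
    rintro _ ⟨w, hw, rfl⟩
    obtain ⟨n, hn⟩ := exists_int_add_mem_Ico 𝒞.ℓ_pos w
    exact ⟨w + n * 𝒞.ℓ, ⟨Set.Ico_subset_Icc_self hn, by simpa using hw⟩,
      periodic_int 𝒞.periodic n w (hsub w hw)⟩
  rw [h]
  refine IsCompact.isClosed ((isCompact_Icc.reProdIm isCompact_Icc).image_of_continuousOn ?_)
  exact 𝒞.diff.continuousOn.mono fun w hw => hsub w hw.2

theorem eventually_notMem_image_Q (𝒞 : Collar D) (hD : IsOpen D) (hx : x ∈ D) :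
    ∀ᶠ c in nhdsWithin (0 : ℝ) (Set.Ioi 0), x ∉ 𝒞.Q '' {w | w.im ∈ Set.Icc 0 c} := by
  by_cases h : ∃ w ∈ hStrip 𝒞.ε, 𝒞.Q w = x
  · obtain ⟨w, hw, rfl⟩ := h
    have hpos : 0 < w.im := by
      rcases lt_trichotomy w.im 0 with h | h | h
      · exact absurd (subset_closure hx) (𝒞.outside w ⟨(abs_lt.1 hw).1, h⟩)
      · have : w = (w.re : ℂ) := Complex.ext rfl (by simpa using h)
        rw [this] at hx
        have h2 := 𝒞.real_mem w.re
        rw [hD.frontier_eq] at h2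
        exact absurd hx h2.2
      · exact h
    filter_upwards [Ioo_mem_nhdsGT (lt_min hpos 𝒞.ε_pos)] with c hc
    rintro ⟨w', hw', h'⟩
    have := 𝒞.im_eq_of_Q_eq (𝒞.mem_preim subset_rfl hw'.1
      (hw'.2.trans_lt (hc.2.trans_le (min_le_right _ _)))).1 hw h'
    have := hc.2.trans_le (min_le_left _ _)
    linarith [hw'.2]
  · filter_upwards [Ioo_mem_nhdsGT 𝒞.ε_pos] with c hc
    rintro ⟨w', hw', h'⟩
    exact h ⟨w', (𝒞.mem_preim subset_rfl hw'.1 (hw'.2.trans_lt hc.2)).1, h'⟩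

/-- A connected subset of the domain whose closure reaches the frontier crosses every level
curve of the collar close to the frontier. -/
theorem eventually_exists_mem (𝒞 : Collar D) (hD : IsOpen D) {K : Set ℂ} (hK : IsPreconnected K)
    (hKD : K ⊆ D) (hcl : (closure K ∩ frontier D).Nonempty) (x₀ : ℝ) :
    ∀ᶠ c : ℝ in nhdsWithin (0 : ℝ) (Set.Ioi 0),
      ∃ s : ℝ, s ∈ Set.Icc x₀ (x₀ + 𝒞.ℓ) ∧ 𝒞.Q (s + c * Complex.I) ∈ K := by
  obtain ⟨y, hyK, hyD⟩ := hcl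
  obtain ⟨x, hx⟩ := closure_nonempty_iff.1 ⟨y, hyK⟩
  filter_upwards [𝒞.eventually_notMem_image_Q hD (hKD hx), Ioo_mem_nhdsGT 𝒞.ε_pos] with c hxc hc
  suffices h : ∃ w : ℂ, w.im = c ∧ 𝒞.Q w ∈ K by
    obtain ⟨w, hw, hwK⟩ := h
    obtain ⟨n, hn⟩ := exists_int_add_mem_Ico 𝒞.ℓ_pos (w - x₀)
    have hws : w ∈ hStrip 𝒞.ε :=
      (𝒞.mem_preim subset_rfl (hw.symm ▸ hc.1.le) (hw.symm ▸ hc.2)).1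
    refine ⟨w.re + n * 𝒞.ℓ, ?_, ?_⟩
    · simp only [Complex.add_re, Complex.sub_re, Complex.ofReal_re, Complex.mul_re,
        Complex.intCast_re, Complex.intCast_im, Complex.ofReal_im, mul_zero, sub_zero] at hn
      constructor <;> linarith [hn.1, hn.2]
    · have : (((w.re + n * 𝒞.ℓ : ℝ) : ℂ)) + c * Complex.I = w + n * 𝒞.ℓ := by
        rw [← hw]
        apply Complex.ext <;> simp
      rw [this, periodic_int 𝒞.periodic n w hws]
      exact hwK
  by_contra! hno
  have hup : {w : ℂ | w.im ∈ Set.Ioo 0 c} ⊆ hStrip 𝒞.ε := fun w hw =>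
    (𝒞.mem_preim subset_rfl hw.1.le (hw.2.trans hc.2)).1
  have hsmall : hStrip c ⊆ hStrip 𝒞.ε := hStrip_mono hc.2.le
  have hA := 𝒞.isOpen_image_Q (isOpen_Ioo.preimage Complex.continuous_im) hup
  have hB := (𝒞.isClosed_image_Q hc.2).isOpen_compl
  have hreal : ∀ w : ℂ, w.im = 0 → 𝒞.Q w ∉ D := by
    intro w hw h
    have : w = (w.re : ℂ) := Complex.ext rfl (by simpa using hw)
    have h2 := 𝒞.real_mem w.re
    rw [hD.frontier_eq, ← this] at h2
    exact h2.2 h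
  have hcov : K ⊆ 𝒞.Q '' {w | w.im ∈ Set.Ioo 0 c} ∪ (𝒞.Q '' {w | w.im ∈ Set.Icc 0 c})ᶜ := by
    intro z hz
    by_cases hz' : z ∈ 𝒞.Q '' {w | w.im ∈ Set.Icc 0 c}
    · obtain ⟨w, hw, rfl⟩ := hz'
      refine Or.inl ⟨w, ⟨lt_of_le_of_ne hw.1 fun h => hreal w h.symm (hKD hz),
        lt_of_le_of_ne hw.2 fun h => hno w h hz⟩, rfl⟩
    · exact Or.inr hz'
  have hdisj : K ∩ (𝒞.Q '' {w | w.im ∈ Set.Ioo 0 c} ∩ (𝒞.Q '' {w | w.im ∈ Set.Icc 0 c})ᶜ) = ∅ := by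
    rw [Set.eq_empty_iff_forall_notMem]
    rintro z ⟨-, ⟨w, hw, rfl⟩, hz⟩
    exact hz ⟨w, ⟨hw.1.le, hw.2.le⟩, rfl⟩
  rcases isPreconnected_iff_subset_of_disjoint.1 hK _ _ hA hB hcov hdisj with h | h
  · obtain ⟨w, hw, hwx⟩ := h hx
    exact hxc ⟨w, ⟨hw.1.le, hw.2.le⟩, hwx⟩
  · obtain ⟨t, rfl⟩ := 𝒞.surj y hyD
    obtain ⟨_, ⟨w, hw, rfl⟩, hwK⟩ := mem_closure_iff.1 hyK _
      (𝒞.isOpen_image_Q (isOpen_hStrip c) hsmall) ⟨t, ofReal_mem_hStrip hc.1 t, rfl⟩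
    have hw' := abs_lt.1 (show |w.im| < c from hw)
    refine h hwK ⟨w, ⟨?_, hw'.2.le⟩, rfl⟩
    by_contra! hneg
    exact 𝒞.outside w ⟨by linarith [hc.2], hneg⟩ (subset_closure (hKD hwK))

end Collar

namespace Collar

variable {D U : Set ℂ} {f : ℂ → ℝ} {lam : ℝ}

/-- Many zeros on a level curve produce a nearby zero of a mixed derivative. -/
theorem exists_mixed_zero (𝒞 : Collar D) (hf : PlaneEigen D lam f U) {c a b : ℝ}
    (hc : c ∈ Set.Ioo 0 𝒞.ε) {s : Finset ℝ} {j : ℕ} (hs : j < s.card)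
    (hab : ∀ x ∈ s, x ∈ Set.Icc a b) (hz : ∀ x ∈ s, f (𝒞.Q (x + c * Complex.I)) = 0) :
    ∃ ξ ∈ Set.Icc a b, ∃ τ ∈ Set.Icc 0 c,
      dir Complex.I ((dir 1)^[j] (𝒞.pull f)) ((ξ : ℂ) + (τ : ℂ) * Complex.I) = 0 := by
  have hO := 𝒞.isOpen_preim hf.isOpen_U
  have hv := 𝒞.analyticOnNhd_pull hf.analytic
  have hmem : ∀ t τ : ℝ, τ ∈ Set.Icc 0 c → (t : ℂ) + τ * Complex.I ∈ 𝒞.preim U := fun t τ hτ =>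
    𝒞.mem_preim hf.closure_subset (by simpa using hτ.1) (by simpa using hτ.2.trans_lt hc.2)
  have hcc : c ∈ Set.Icc 0 c := ⟨hc.1.le, le_rfl⟩
  set g : ℝ → ℝ := fun t => 𝒞.pull f (c * Complex.I + t) with hg
  have hga : ContDiff ℝ ⊤ g := by
    refine contDiff_iff_contDiffAt.2 fun t => AnalyticAt.contDiffAt ?_
    refine (hv _ ?_).comp (analyticAt_const.add (Complex.ofRealCLM.analyticAt t))
    rw [add_comm]
    exact hmem t c hcc
  obtain ⟨ξ, hξ, hξ0⟩ := exists_iteratedDeriv_eq_zero_of_zeros j hga hs hab (fun x hx => by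
    show 𝒞.pull f (c * Complex.I + x) = 0
    rw [add_comm, 𝒞.pull_eq (hmem x c hcc).1, hz x hx])
  refine ⟨ξ, hξ, ?_⟩
  rw [hg, iteratedDeriv_line hO hv _ j ξ (by rw [add_comm]; exact hmem ξ c hcc)] at hξ0
  have hder : ∀ τ ∈ Set.Icc 0 c, HasDerivAt (fun t : ℝ => (dir 1)^[j] (𝒞.pull f) (ξ + t * Complex.I))
      (dir Complex.I ((dir 1)^[j] (𝒞.pull f)) ((ξ : ℂ) + (τ : ℂ) * Complex.I)) τ := fun τ hτ =>
    hasDerivAt_line (hv.iterate_dir 1 j _ (hmem ξ τ hτ)).differentiableAt τ rfl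
  obtain ⟨τ, hτ, hτ0⟩ := exists_hasDerivAt_eq_zero hc.1
    (fun τ hτ => (hder τ hτ).continuousAt.continuousWithinAt)
    (by
      have := 𝒞.iterate_dir_pull_real hf j ξ
      rw [add_comm] at hξ0
      simpa [this] using hξ0.symm)
    (fun τ hτ => hder τ (Set.Ioo_subset_Icc_self hτ))
  exact ⟨τ, Set.Ioo_subset_Icc_self hτ, hτ0⟩

theorem exists_limit_points (𝒞 : Collar D) (hD : IsOpen D) {ι : Type*} [Fintype ι] (x₀ : ℝ)
    {K : ι → Set ℂ} (hK : ∀ i, IsPreconnected (K i)) (hKD : ∀ i, K i ⊆ D)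
    (hcl : ∀ i, (closure (K i) ∩ frontier D).Nonempty) :
    ∃ p : ι → ℝ, (∀ i, p i ∈ Set.Icc x₀ (x₀ + 𝒞.ℓ)) ∧ ∃ c : ℕ → ℝ, ∃ s : ℕ → ι → ℝ,
      (∀ n, c n ∈ Set.Ioo 0 𝒞.ε) ∧ Filter.Tendsto c Filter.atTop (nhds 0) ∧
      Filter.Tendsto s Filter.atTop (nhds p) ∧
      ∀ n i, 𝒞.Q (s n i + c n * Complex.I) ∈ K i := by
  have hev : ∀ᶠ c : ℝ in nhdsWithin 0 (Set.Ioi 0), c ∈ Set.Ioo 0 𝒞.ε ∧ ∀ i, ∃ s : ℝ,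
      s ∈ Set.Icc x₀ (x₀ + 𝒞.ℓ) ∧ 𝒞.Q (s + c * Complex.I) ∈ K i :=
    (Filter.eventually_of_mem (Ioo_mem_nhdsGT 𝒞.ε_pos) fun _ h => h).and
      (Filter.eventually_all.2 fun i => 𝒞.eventually_exists_mem hD (hK i) (hKD i) (hcl i) x₀)
  obtain ⟨c, hc, hcP⟩ := Filter.exists_seq_forall_of_frequently hev.frequently
  choose s hs using fun n => (hcP n).2
  obtain ⟨p, hp, ψ, hψ, hlim⟩ := (isCompact_univ_pi fun _ : ι =>
    isCompact_Icc (a := x₀) (b := x₀ + 𝒞.ℓ)).tendsto_subseq (x := s)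
    (fun n i _ => (hs n i).1)
  exact ⟨p, fun i => hp i trivial, c ∘ ψ, s ∘ ψ, fun n => (hcP _).1,
    (hc.mono_right nhdsWithin_le_nhds).comp hψ.tendsto_atTop, hlim, fun n i => (hs _ i).2⟩

theorem exists_card_le (𝒞 : Collar D) (hD : IsOpen D) (hb : Bornology.IsBounded D) :
    ∃ C > 0, ∀ lam f U, 0 < lam → PlaneEigen D lam f U → (∃ z ∈ D, f z ≠ 0) →
      ∀ (ι : Type) [Fintype ι] (K : ι → Set ℂ), (∀ i, IsPreconnected (K i)) →
        (∀ i, K i ⊆ {z ∈ D | f z = 0}) → (∀ i, (closure (K i) ∩ frontier D).Nonempty) →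
        Pairwise (fun i i' => Disjoint (K i) (K i')) → (Fintype.card ι : ℝ) ≤ C * lam := by
  classical
  obtain ⟨C, hC, hbound⟩ := 𝒞.exists_card_zeros_normalDeriv_le hD hb
  refine ⟨C, hC, fun lam f U hlam hf hne ι _ K hK hKN hcl hdisj => ?_⟩
  obtain ⟨x₀, hx₀⟩ := hbound lam f U hlam hf hne
  obtain ⟨p, hp, c, s, hc, hc0, hsp, hsK⟩ :=
    𝒞.exists_limit_points hD x₀ hK (fun i z hz => (hKN i hz).1) hcl
  have hinj : ∀ n, Function.Injective (s n) := fun n i i' h => by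
    by_contra hii
    exact Set.disjoint_left.1 (hdisj hii) (hsK n i) (h ▸ hsK n i')
  have key := hx₀ (Finset.univ.val.map p) (by
    intro q hq
    obtain ⟨i, -, rfl⟩ := Multiset.mem_map.1 hq
    exact hp i) ?_
  · simpa using key
  intro q _ j hj
  set I := Finset.univ.filter fun i => q = p i with hI
  have hjI : j < I.card := by
    rwa [Multiset.count_map, ← Finset.filter_val, Finset.card_val] at hj
  set η : ℕ → ℝ := fun n => ∑ i ∈ I, |s n i - q| with hη
  have hη0 : Filter.Tendsto η Filter.atTop (nhds 0) := by
    have : Filter.Tendsto η Filter.atTop (nhds (∑ i ∈ I, |p i - q|)) :=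
      tendsto_finsetSum _ fun i _ => (((tendsto_pi_nhds.1 hsp i).sub_const q).abs)
    rwa [Finset.sum_eq_zero fun i hi => by rw [← (Finset.mem_filter.1 hi).2]; simp] at this
  have hex : ∀ n, ∃ ξ ∈ Set.Icc (q - η n) (q + η n), ∃ τ ∈ Set.Icc 0 (c n),
      dir Complex.I ((dir 1)^[j] (𝒞.pull f)) ((ξ : ℂ) + (τ : ℂ) * Complex.I) = 0 := by
    intro n
    refine 𝒞.exists_mixed_zero hf (hc n) (s := I.image (s n))
      (by rwa [Finset.card_image_of_injective _ (hinj n)]) ?_ ?_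
    · intro x hx
      obtain ⟨i, hi, rfl⟩ := Finset.mem_image.1 hx
      have h1 : |s n i - q| ≤ η n :=
        Finset.single_le_sum (f := fun i => |s n i - q|) (fun i _ => abs_nonneg _) hi
      rw [abs_le] at h1
      constructor <;> linarith [h1.1, h1.2]
    · intro x hx
      obtain ⟨i, hi, rfl⟩ := Finset.mem_image.1 hx
      exact (hKN i (hsK n i)).2
  choose ξ hξ τ hτ hzero using hex
  have hξq : Filter.Tendsto ξ Filter.atTop (nhds q) := by
    refine tendsto_of_tendsto_of_tendsto_of_le_of_le (g := fun n => q - η n) (h := fun n => q + η n)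
      ?_ ?_ (fun n => (hξ n).1) (fun n => (hξ n).2)
    · simpa using hη0.const_sub q
    · simpa using hη0.const_add q
  have hτ0 : Filter.Tendsto τ Filter.atTop (nhds 0) :=
    tendsto_of_tendsto_of_tendsto_of_le_of_le tendsto_const_nhds hc0 (fun n => (hτ n).1)
      (fun n => (hτ n).2)
  have hw : Filter.Tendsto (fun n => (ξ n : ℂ) + (τ n : ℂ) * Complex.I) Filter.atTop
      (nhds (q : ℂ)) := by
    have := ((Complex.continuous_ofReal.tendsto q).comp hξq).add
      (((Complex.continuous_ofReal.tendsto 0).comp hτ0).mul_const Complex.I)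
    simpa using this
  have hcont := (((𝒞.analyticOnNhd_pull hf.analytic).iterate_dir 1 j).dir Complex.I _
    (𝒞.real_mem_preim hf.closure_subset q)).continuousAt
  refine tendsto_nhds_unique (hcont.tendsto.comp hw) ?_
  exact tendsto_const_nhds.congr fun n => (hzero n).symm

end Collar

/-- The identification of `ℂ` with the Euclidean plane. -/
def planeIso : ℂ ≃ₗᵢ[ℝ] E2 := Complex.orthonormalBasisOneI.repr

theorem planeIso_one : planeIso 1 = EuclideanSpace.single 0 1 := by
  have := Complex.orthonormalBasisOneI.repr_self 0
  simpa [planeIso] using this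

theorem planeIso_I : planeIso Complex.I = EuclideanSpace.single 1 1 := by
  have := Complex.orthonormalBasisOneI.repr_self 1
  simpa [planeIso] using this

theorem fderiv_comp_planeIso (g : E2 → ℝ) (e z : ℂ) :
    dir e (g ∘ planeIso) z = fderiv ℝ g (planeIso z) (planeIso e) := by
  have := planeIso.toContinuousLinearEquiv.comp_right_fderiv (f := g) (x := z)
  rw [dir]
  exact congrArg (fun L => L e) this

theorem lap_planeIso (φ : E2 → ℝ) (z : ℂ) :
    dir 1 (dir 1 (φ ∘ planeIso)) z + dir Complex.I (dir Complex.I (φ ∘ planeIso)) z =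
      lap φ (planeIso z) := by
  have h : ∀ e : ℂ, dir e (φ ∘ planeIso) =
      (fun y => fderiv ℝ φ y (planeIso e)) ∘ planeIso := fun e =>
    funext fun z => fderiv_comp_planeIso φ e z
  rw [h, h, fderiv_comp_planeIso, fderiv_comp_planeIso, lap, Fin.sum_univ_two, planeIso_one,
    planeIso_I]

theorem frontier_preimage_planeIso (Ω : Set E2) :
    frontier (planeIso ⁻¹' Ω) = planeIso ⁻¹' frontier Ω :=
  (planeIso.toHomeomorph.preimage_frontier Ω).symm

theorem closure_preimage_planeIso (Ω : Set E2) :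
    closure (planeIso ⁻¹' Ω) = planeIso ⁻¹' closure Ω :=
  (planeIso.toHomeomorph.preimage_closure Ω).symm

theorem BoundaryParam.exists_collar_preimage {Ω : Set E2} (hΩ : IsPlaneDomain Ω)
    (B : BoundaryParam Ω) (hB : B.IsAnalytic) : Nonempty (Collar (planeIso ⁻¹' Ω)) := by
  have hder : ∀ s, HasDerivAt (fun s => planeIso.symm (B.q s)) (planeIso.symm (B.qd s)) s :=
    fun s => planeIso.symm.toContinuousLinearEquiv.hasFDerivAt.comp_hasDerivAt s (B.hasDerivAt s)
  obtain ⟨𝒞, -⟩ := exists_collar (hΩ.isOpen.preimage planeIso.continuous)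
    (planeIso.antilipschitz.isBounded_preimage hΩ.isBounded) (fun s => planeIso.symm (B.q s))
    B.len_pos
    (fun s hs => (planeIso.symm.toContinuousLinearEquiv.toContinuousLinearMap.analyticAt _).comp
      (hB s hs))
    (fun s => congrArg planeIso.symm (B.periodic s))
    (planeIso.symm.injective.comp_injOn B.injOn)
    (fun s => by rw [(hder s).deriv, planeIso.symm.norm_map, B.unitSpeed])
    (by
      rw [frontier_preimage_planeIso, ← B.range_eq]
      ext z
      simp [LinearIsometryEquiv.symm_apply_eq])
  exact ⟨𝒞⟩

theorem IsDirichletEigenfunction.exists_planeEigen {Ω : Set E2} {B : BoundaryParam Ω} {lam : ℝ}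
    {φ : E2 → ℝ} (h : IsDirichletEigenfunction B lam φ) :
    ∃ U, PlaneEigen (planeIso ⁻¹' Ω) lam (φ ∘ planeIso) U := by
  obtain ⟨U, hU, hcl, ha⟩ := h.analytic
  refine ⟨planeIso ⁻¹' U, hU.preimage planeIso.continuous, ?_, fun z hz => ?_, fun z hz => ?_,
    fun z hz => ?_⟩
  · rw [closure_preimage_planeIso]
    exact Set.preimage_mono hcl
  · exact (ha _ hz).comp (planeIso.toContinuousLinearEquiv.toContinuousLinearMap.analyticAt z)
  · rw [lap_planeIso, h.eigen _ hz, Function.comp_apply]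
  · rw [frontier_preimage_planeIso, ← B.range_eq] at hz
    obtain ⟨s, hs⟩ := hz
    rw [Function.comp_apply, ← hs, h.dirichlet]

theorem Set.finite_and_ncard_le_of_finset_card_le {α : Type*} {s : Set α} {r : ℝ}
    (h : ∀ t : Finset α, (t : Set α) ⊆ s → (t.card : ℝ) ≤ r) : s.Finite ∧ (s.ncard : ℝ) ≤ r := by
  have hs : s.Finite := by
    by_contra hinf
    obtain ⟨n, hn⟩ := exists_nat_gt r
    obtain ⟨t, ht, hcard⟩ := Set.Infinite.exists_subset_card_eq hinf n
    exact (h t ht).not_gt (hcard ▸ hn)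
  refine ⟨hs, ?_⟩
  rw [Set.ncard_eq_toFinset_card s hs]
  exact h _ (by simp)

/-- The number of connected components of the nodal set (inside `Ω`) of a Dirichlet
eigenfunction whose closure touches the boundary is at most `C·λ`. -/
theorem dirichlet_nodal_components_touching_boundary
    (Ω : Set E2) (hΩ : IsPlaneDomain Ω) (B : BoundaryParam Ω) (hB : B.IsAnalytic) :
    ∃ C > 0, ∀ lam : ℝ, 0 < lam → ∀ φ : E2 → ℝ, IsDirichletEigenfunction B lam φ →
      ({K : Set E2 | ∃ x ∈ {x ∈ Ω | φ x = 0},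
          K = connectedComponentIn {x ∈ Ω | φ x = 0} x ∧
            (closure K ∩ frontier Ω).Nonempty}).Finite ∧
      (({K : Set E2 | ∃ x ∈ {x ∈ Ω | φ x = 0},
          K = connectedComponentIn {x ∈ Ω | φ x = 0} x ∧
            (closure K ∩ frontier Ω).Nonempty}).ncard : ℝ) ≤ C * lam := by
  obtain ⟨𝒞⟩ := B.exists_collar_preimage hΩ hB
  obtain ⟨C, hC, hcard⟩ := 𝒞.exists_card_le (hΩ.isOpen.preimage planeIso.continuous)
    (planeIso.antilipschitz.isBounded_preimage hΩ.isBounded)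
  refine ⟨C, hC, fun lam hlam φ hφ => Set.finite_and_ncard_le_of_finset_card_le fun t ht => ?_⟩
  obtain ⟨U, hU⟩ := hφ.exists_planeEigen
  obtain ⟨x₀, hx₀, hx₀'⟩ := hφ.nontrivial
  rw [← Fintype.card_coe]
  refine hcard lam _ U hlam hU ⟨planeIso.symm x₀, by simpa using hx₀, by simpa using hx₀'⟩
    t (fun K => planeIso ⁻¹' (K : Set E2)) (fun K => ?_) (fun K => ?_) (fun K => ?_) ?_
  · obtain ⟨x, -, hK, -⟩ := ht K.2
    rw [hK]
    exact planeIso.toHomeomorph.isPreconnected_preimage.2 isPreconnected_connectedComponentIn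
  · obtain ⟨x, -, hK, -⟩ := ht K.2
    rw [hK]
    exact Set.preimage_mono (connectedComponentIn_subset _ _)
  · obtain ⟨x, -, -, y, hy⟩ := ht K.2
    rw [closure_preimage_planeIso, frontier_preimage_planeIso]
    exact ⟨planeIso.symm y, by simpa using hy⟩
  · intro K L hKL
    obtain ⟨x, -, hK, -⟩ := ht K.2
    obtain ⟨y, -, hL, -⟩ := ht L.2
    refine Disjoint.preimage _ (Set.disjoint_left.2 fun z hz hz' => hKL (Subtype.ext ?_))
    rw [hK] at hz ⊢
    rw [hL] at hz' ⊢
    rw [connectedComponentIn_eq hz, connectedComponentIn_eq hz']
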